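/- (Interior Hölder estimate) There exist a universal exponent α ∈ (0,1) and a universal constant C > 0, depending only on n, Λ, M and C₀, such that every bounded viscosity solution η ≥ 0 of the linearized oblique problem on K₁⁺ satisfies ‖η‖_{C^{0,α}_{x,t}(K⁺_{1/2})} ≤ C·sup over K₁⁺ of |η|. -/

import Mathlib

open Set MeasureTheory Metric
open scoped RealInnerProductSpace

noncomputable section

abbrev Eucl (n : ℕ) : Type := EuclideanSpace ℝ (Fin n)
abbrev SpaceTime (n : ℕ) : Type := Eucl n × ℝ

/-- The operator norm of an `n × n` real matrix, acting on Euclidean space. -/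
noncomputable def matOpNorm {n : ℕ} (A : Matrix (Fin n) (Fin n) ℝ) : ℝ :=
  ‖(LinearMap.toContinuousLinearMap (Matrix.toEuclideanLin A))‖

/-- `F` is uniformly elliptic with ellipticity constant `Λ`. -/
def UniformlyElliptic {n : ℕ} (Λ : ℝ) (F : Matrix (Fin n) (Fin n) ℝ → ℝ) : Prop :=
  ∀ M N : Matrix (Fin n) (Fin n) ℝ, M.IsSymm → N.IsSymm → N.PosSemidef →
    Λ⁻¹ * matOpNorm N ≤ F (M + N) - F M ∧ F (M + N) - F M ≤ Λ * matOpNorm N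

/-- Pucci minimal operator `P⁻(R, a, b) = a ∑_{eᵢ>0} eᵢ + b ∑_{eᵢ<0} eᵢ`. -/
noncomputable def pucciMinus {n : ℕ} (R : Matrix (Fin n) (Fin n) ℝ) (a b : ℝ) : ℝ :=
  if h : R.IsHermitian then
    a * ∑ i, max (h.eigenvalues i) 0 + b * ∑ i, min (h.eigenvalues i) 0
  else 0

/-- Pucci maximal operator `P⁺(R, a, b) = a ∑_{eᵢ<0} eᵢ + b ∑_{eᵢ>0} eᵢ`. -/
noncomputable def pucciPlus {n : ℕ} (R : Matrix (Fin n) (Fin n) ℝ) (a b : ℝ) : ℝ :=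
  if h : R.IsHermitian then
    a * ∑ i, min (h.eigenvalues i) 0 + b * ∑ i, max (h.eigenvalues i) 0
  else 0

/-- Parabolic cylinder `E_ρ(x₀,t₀) = B_ρ(x₀) × (t₀ − ρ², t₀]`. -/
def cylE {n : ℕ} (x₀ : Eucl n) (t₀ ρ : ℝ) : Set (SpaceTime n) :=
  (ball x₀ ρ) ×ˢ (Ioc (t₀ - ρ ^ 2) t₀)

/-- `φ` is C² in `x` and C¹ in `t` on `D`, with time derivative `φt`,
spatial gradient `gφ` and spatial Hessian `Hφ`. -/
structure ParabolicTest {n : ℕ} (φ : SpaceTime n → ℝ) (D : Set (SpaceTime n))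
    (φt : SpaceTime n → ℝ) (gφ : SpaceTime n → Eucl n)
    (Hφ : SpaceTime n → Matrix (Fin n) (Fin n) ℝ) : Prop where
  contPhi : ContinuousOn φ D
  contPhit : ContinuousOn φt D
  contGrad : ContinuousOn gφ D
  contHess : ContinuousOn Hφ D
  symmHess : ∀ p ∈ D, (Hφ p).IsSymm
  timeDeriv : ∀ p ∈ D, HasDerivWithinAt (fun s : ℝ => φ (p.1, s)) (φt p) {s : ℝ | (p.1, s) ∈ D} p.2
  spaceGrad : ∀ p ∈ D, HasGradientWithinAt (fun y => φ (y, p.2)) (gφ p) {y | (y, p.2) ∈ D} p.1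
  spaceHess : ∀ p ∈ D, HasFDerivWithinAt (fun y => gφ (y, p.2))
      (LinearMap.toContinuousLinearMap (Matrix.toEuclideanLin (Hφ p))) {y | (y, p.2) ∈ D} p.1

/-- `φ` touches `u` from above at `p₀` in the set `E`. -/
def TouchesAbove {n : ℕ} (φ u : SpaceTime n → ℝ) (E : Set (SpaceTime n)) (p₀ : SpaceTime n) :
    Prop :=
  p₀ ∈ E ∧ φ p₀ = u p₀ ∧ ∀ p ∈ E, u p ≤ φ p

/-- `φ` touches `u` from below at `p₀` in the set `E`. -/
def TouchesBelow {n : ℕ} (φ u : SpaceTime n → ℝ) (E : Set (SpaceTime n)) (p₀ : SpaceTime n) :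
    Prop :=
  p₀ ∈ E ∧ φ p₀ = u p₀ ∧ ∀ p ∈ E, φ p ≤ u p

/-- `u` is a viscosity subsolution of `u_t = F(D²u)` in `D`. -/
def ViscSub {n : ℕ} (F : Matrix (Fin n) (Fin n) ℝ → ℝ) (u : SpaceTime n → ℝ)
    (D : Set (SpaceTime n)) : Prop :=
  ∀ (φ φt : SpaceTime n → ℝ) (gφ : SpaceTime n → Eucl n)
    (Hφ : SpaceTime n → Matrix (Fin n) (Fin n) ℝ) (p₀ : SpaceTime n) (ρ : ℝ),
    0 < ρ → p₀ ∈ D → cylE p₀.1 p₀.2 ρ ⊆ D →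
    ParabolicTest φ (cylE p₀.1 p₀.2 ρ) φt gφ Hφ →
    TouchesAbove φ u (cylE p₀.1 p₀.2 ρ) p₀ →
    φt p₀ ≤ F (Hφ p₀)

/-- `u` is a viscosity supersolution of `u_t = F(D²u)` in `D`. -/
def ViscSup {n : ℕ} (F : Matrix (Fin n) (Fin n) ℝ → ℝ) (u : SpaceTime n → ℝ)
    (D : Set (SpaceTime n)) : Prop :=
  ∀ (φ φt : SpaceTime n → ℝ) (gφ : SpaceTime n → Eucl n)
    (Hφ : SpaceTime n → Matrix (Fin n) (Fin n) ℝ) (p₀ : SpaceTime n) (ρ : ℝ),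
    0 < ρ → p₀ ∈ D → cylE p₀.1 p₀.2 ρ ⊆ D →
    ParabolicTest φ (cylE p₀.1 p₀.2 ρ) φt gφ Hφ →
    TouchesBelow φ u (cylE p₀.1 p₀.2 ρ) p₀ →
    F (Hφ p₀) ≤ φt p₀

end

/-- The last ("vertical") coordinate `xₙ` of a point in `ℝⁿ = ℝ^{d+1}`. -/
def lastC {d : ℕ} (x : Eucl (d + 1)) : ℝ := x (Fin.last d)

/-- `K_r = (B_r ∩ {xₙ > 0}) × (−r, 0]`. -/
def Kc (d : ℕ) (r : ℝ) : Set (SpaceTime (d + 1)) :=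
  {p | p.1 ∈ ball 0 r ∧ 0 < lastC p.1 ∧ p.2 ∈ Ioc (-r) 0}

/-- `F_r = (B_r ∩ {xₙ = 0}) × (−r, 0]`. -/
def Fc (d : ℕ) (r : ℝ) : Set (SpaceTime (d + 1)) :=
  {p | p.1 ∈ ball 0 r ∧ lastC p.1 = 0 ∧ p.2 ∈ Ioc (-r) 0}

/-- `K_r⁺ = K_r ∪ F_r`. -/
def KcP (d : ℕ) (r : ℝ) : Set (SpaceTime (d + 1)) := Kc d r ∪ Fc d r

/-- The Dirichlet part `∂_b K₁` of the boundary of `K₁`: the part of the topological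
boundary not contained in `F₁ ∪ ((B₁ ∩ {xₙ>0}) × {0})`. -/
def bdryK (d : ℕ) : Set (SpaceTime (d + 1)) :=
  frontier (Kc d 1) \
    (Fc d 1 ∪ {p | p.1 ∈ ball 0 1 ∧ 0 < lastC p.1 ∧ p.2 = 0})

/-- Coefficient data for the linearized oblique problem: `Q` is symmetric, uniformly
elliptic, differentiable (entrywise, with derivative `Q'`) with `‖Q'‖ ≤ C₀/λ`, and the
oblique vector `v` is differentiable with `vₙ ≥ M⁻¹`, `|v| ≤ M`, `|v'| ≤ λ⁻¹`. -/
structure ObliqueData (d : ℕ) (lam Λ M C₀ : ℝ)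
    (Q Q' : ℝ → Matrix (Fin (d + 1)) (Fin (d + 1)) ℝ)
    (v v' : ℝ → Eucl (d + 1)) : Prop where
  lam_pos : 0 < lam
  lam_le_one : lam ≤ 1
  Lam_ge_one : 1 ≤ Λ
  M_ge_one : 1 ≤ M
  C0_pos : 0 < C₀
  Qsymm : ∀ t ∈ Icc (-1 : ℝ) 0, (Q t).IsSymm
  Qlower : ∀ t ∈ Icc (-1 : ℝ) 0,
    (Q t - (Λ * M ^ 2)⁻¹ • (1 : Matrix (Fin (d + 1)) (Fin (d + 1)) ℝ)).PosSemidef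
  Qupper : ∀ t ∈ Icc (-1 : ℝ) 0,
    ((Λ * M ^ 2) • (1 : Matrix (Fin (d + 1)) (Fin (d + 1)) ℝ) - Q t).PosSemidef
  Qderiv : ∀ t ∈ Icc (-1 : ℝ) 0, ∀ i j,
    HasDerivWithinAt (fun s => Q s i j) (Q' t i j) (Icc (-1 : ℝ) 0) t
  Qderiv_bound : ∀ t ∈ Icc (-1 : ℝ) 0, matOpNorm (Q' t) ≤ C₀ / lam
  vderiv : ∀ t ∈ Icc (-1 : ℝ) 0, HasDerivWithinAt v (v' t) (Icc (-1 : ℝ) 0) t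
  vlast : ∀ t ∈ Icc (-1 : ℝ) 0, M⁻¹ ≤ lastC (v t)
  vbound : ∀ t ∈ Icc (-1 : ℝ) 0, ‖v t‖ ≤ M
  vderiv_bound : ∀ t ∈ Icc (-1 : ℝ) 0, ‖v' t‖ ≤ lam⁻¹

/-- `η` is a viscosity subsolution of the linearized oblique problem
`λ η_t = tr(Q(t) D²η)` in `K₁`, `η_t = v(t)·∇η` on `F₁`. -/
def ObliqueSub (d : ℕ) (lam : ℝ) (Q : ℝ → Matrix (Fin (d + 1)) (Fin (d + 1)) ℝ)
    (v : ℝ → Eucl (d + 1)) (η : SpaceTime (d + 1) → ℝ) : Prop :=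
  ContinuousOn η (KcP d 1) ∧
  ∀ (φ φt : SpaceTime (d + 1) → ℝ) (gφ : SpaceTime (d + 1) → Eucl (d + 1))
    (Hφ : SpaceTime (d + 1) → Matrix (Fin (d + 1)) (Fin (d + 1)) ℝ)
    (p₀ : SpaceTime (d + 1)) (ρ : ℝ),
    0 < ρ →
    ParabolicTest φ (cylE p₀.1 p₀.2 ρ ∩ closure (Kc d 1)) φt gφ Hφ →
    TouchesAbove φ η (cylE p₀.1 p₀.2 ρ ∩ closure (Kc d 1)) p₀ →
    (p₀ ∈ Kc d 1 → lam * φt p₀ ≤ (Q p₀.2 * Hφ p₀).trace) ∧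
    (p₀ ∈ Fc d 1 → φt p₀ ≤ ⟪v p₀.2, gφ p₀⟫)

/-- `η` is a viscosity supersolution of the linearized oblique problem. -/
def ObliqueSup (d : ℕ) (lam : ℝ) (Q : ℝ → Matrix (Fin (d + 1)) (Fin (d + 1)) ℝ)
    (v : ℝ → Eucl (d + 1)) (η : SpaceTime (d + 1) → ℝ) : Prop :=
  ContinuousOn η (KcP d 1) ∧
  ∀ (φ φt : SpaceTime (d + 1) → ℝ) (gφ : SpaceTime (d + 1) → Eucl (d + 1))
    (Hφ : SpaceTime (d + 1) → Matrix (Fin (d + 1)) (Fin (d + 1)) ℝ)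
    (p₀ : SpaceTime (d + 1)) (ρ : ℝ),
    0 < ρ →
    ParabolicTest φ (cylE p₀.1 p₀.2 ρ ∩ closure (Kc d 1)) φt gφ Hφ →
    TouchesBelow φ η (cylE p₀.1 p₀.2 ρ ∩ closure (Kc d 1)) p₀ →
    (p₀ ∈ Kc d 1 → (Q p₀.2 * Hφ p₀).trace ≤ lam * φt p₀) ∧
    (p₀ ∈ Fc d 1 → ⟪v p₀.2, gφ p₀⟫ ≤ φt p₀)

/-- `η` is a viscosity solution of the linearized oblique problem on `K₁⁺`. -/
def ObliqueSolution (d : ℕ) (lam : ℝ) (Q : ℝ → Matrix (Fin (d + 1)) (Fin (d + 1)) ℝ)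
    (v : ℝ → Eucl (d + 1)) (η : SpaceTime (d + 1) → ℝ) : Prop :=
  ObliqueSub d lam Q v η ∧ ObliqueSup d lam Q v η

/-- The distance `|x' − y'|` between the horizontal projections. -/
noncomputable def primeDist {d : ℕ} (x y : Eucl (d + 1)) : ℝ :=
  Real.sqrt (∑ i : Fin d, (x i.castSucc - y i.castSucc) ^ 2)

/-- The boundary-adapted parabolic distance `d(·,·)`. -/
noncomputable def pdist {d : ℕ} (P₁ P₂ : SpaceTime (d + 1)) : ℝ :=
  primeDist P₁.1 P₂.1 +
    min (|lastC P₁.1| + |lastC P₂.1| + |P₁.2 - P₂.2|)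
      (|lastC P₁.1 - lastC P₂.1| + Real.sqrt |P₁.2 - P₂.2|)

/-- The rescaled distance `d_λ(P₁,P₂) = λ⁻¹ d(λP₁, λP₂)`. -/
noncomputable def pdistL {d : ℕ} (lam : ℝ) (P₁ P₂ : SpaceTime (d + 1)) : ℝ :=
  lam⁻¹ * pdist (lam • P₁.1, lam * P₁.2) (lam • P₂.1, lam * P₂.2)


open Filter Topology

noncomputable section Toolkit

variable {n : ℕ}

/-- A globally defined test function. -/
abbrev GT (φ φt : SpaceTime n → ℝ) (g : SpaceTime n → Eucl n)
    (H : SpaceTime n → Matrix (Fin n) (Fin n) ℝ) : Prop :=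
  ParabolicTest φ univ φt g H

lemma PTmono {φ φt : SpaceTime n → ℝ} {g : SpaceTime n → Eucl n}
    {H : SpaceTime n → Matrix (Fin n) (Fin n) ℝ} {D D' : Set (SpaceTime n)}
    (h : ParabolicTest φ D φt g H) (hD : D' ⊆ D) : ParabolicTest φ D' φt g H where
  contPhi := h.contPhi.mono hD
  contPhit := h.contPhit.mono hD
  contGrad := h.contGrad.mono hD
  contHess := h.contHess.mono hD
  symmHess p hp := h.symmHess p (hD hp)
  timeDeriv p hp := (h.timeDeriv p (hD hp)).mono (fun _ hs => hD hs)
  spaceGrad p hp := by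
    have := h.spaceGrad p (hD hp)
    rw [hasGradientWithinAt_iff_hasFDerivWithinAt] at this ⊢
    exact this.mono (fun _ hs => hD hs)
  spaceHess p hp := (h.spaceHess p (hD hp)).mono (fun _ hs => hD hs)

/-- The bounded linear map of a matrix. -/
def mL (A : Matrix (Fin n) (Fin n) ℝ) : Eucl n →L[ℝ] Eucl n :=
  LinearMap.toContinuousLinearMap (Matrix.toEuclideanLin A)

lemma mL_add (A B : Matrix (Fin n) (Fin n) ℝ) : mL (A + B) = mL A + mL B := by
  simp [mL, map_add]

lemma mL_smul (c : ℝ) (A : Matrix (Fin n) (Fin n) ℝ) : mL (c • A) = c • mL A := by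
  simp [mL, map_smul]

lemma mL_apply (A : Matrix (Fin n) (Fin n) ℝ) (x : Eucl n) (i : Fin n) :
    mL A x i = ∑ j, A i j * x j := by
  simp [mL, Matrix.toLpLin_apply, Matrix.mulVec, dotProduct]

/-- rank one matrix -/
def r1 (a b : Eucl n) : Matrix (Fin n) (Fin n) ℝ := Matrix.of fun i j => a i * b j

lemma mL_r1 (a b x : Eucl n) : mL (r1 a b) x = (inner ℝ b x) • a := by
  ext i
  simp [mL_apply, r1, PiLp.inner_apply, Finset.sum_mul]
  refine Finset.sum_congr rfl fun j _ => by ring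

lemma mL_one : mL (1 : Matrix (Fin n) (Fin n) ℝ) = ContinuousLinearMap.id ℝ _ := by
  ext x i
  simp [mL_apply, Matrix.one_apply]

lemma GT_mk {φ φt : SpaceTime n → ℝ} {g : SpaceTime n → Eucl n}
    {H : SpaceTime n → Matrix (Fin n) (Fin n) ℝ}
    (h1 : Continuous φ) (h2 : Continuous φt) (h3 : Continuous g) (h4 : Continuous H)
    (h5 : ∀ p, (H p).IsSymm)
    (h6 : ∀ x t, HasDerivAt (fun s : ℝ => φ (x, s)) (φt (x, t)) t)
    (h7 : ∀ x t, HasFDerivAt (fun y => φ (y, t)) (innerSL ℝ (g (x, t))) x)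
    (h8 : ∀ x t, HasFDerivAt (fun y => g (y, t)) (mL (H (x, t))) x) : GT φ φt g H where
  contPhi := h1.continuousOn
  contPhit := h2.continuousOn
  contGrad := h3.continuousOn
  contHess := h4.continuousOn
  symmHess p _ := h5 p
  timeDeriv p _ := (h6 p.1 p.2).hasDerivWithinAt
  spaceGrad p _ := by
    rw [hasGradientWithinAt_iff_hasFDerivWithinAt]
    exact (h7 p.1 p.2).hasFDerivWithinAt
  spaceHess p _ := (h8 p.1 p.2).hasFDerivWithinAt

section
variable {φ φt ψ ψt : SpaceTime n → ℝ} {g k : SpaceTime n → Eucl n}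
    {H J : SpaceTime n → Matrix (Fin n) (Fin n) ℝ}
lemma GT.c1 (h : GT φ φt g H) : Continuous φ := continuousOn_univ.1 h.contPhi
lemma GT.c2 (h : GT φ φt g H) : Continuous φt := continuousOn_univ.1 h.contPhit
lemma GT.c3 (h : GT φ φt g H) : Continuous g := continuousOn_univ.1 h.contGrad
lemma GT.c4 (h : GT φ φt g H) : Continuous H := continuousOn_univ.1 h.contHess
lemma GT.sy (h : GT φ φt g H) (p : SpaceTime n) : (H p).IsSymm := h.symmHess p (mem_univ _)
lemma GT.dt (h : GT φ φt g H) (x : Eucl n) (t : ℝ) :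
    HasDerivAt (fun s : ℝ => φ (x, s)) (φt (x, t)) t := by
  have h1 : HasDerivWithinAt (fun s : ℝ => φ (x, s)) (φt (x, t)) univ t :=
    h.timeDeriv (x, t) (mem_univ _)
  exact hasDerivWithinAt_univ.1 h1
lemma GT.dx (h : GT φ φt g H) (x : Eucl n) (t : ℝ) :
    HasFDerivAt (fun y => φ (y, t)) (innerSL ℝ (g (x, t))) x := by
  have h0 := h.spaceGrad (x, t) (mem_univ _)
  rw [hasGradientWithinAt_iff_hasFDerivWithinAt] at h0
  have h1 : HasFDerivWithinAt (fun y => φ (y, t)) (innerSL ℝ (g (x, t))) univ x := h0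
  exact hasFDerivWithinAt_univ.1 h1
lemma GT.dxx (h : GT φ φt g H) (x : Eucl n) (t : ℝ) :
    HasFDerivAt (fun y => g (y, t)) (mL (H (x, t))) x := by
  have h1 : HasFDerivWithinAt (fun y => g (y, t)) (mL (H (x, t))) univ x :=
    h.spaceHess (x, t) (mem_univ _)
  exact hasFDerivWithinAt_univ.1 h1

lemma GT.add (h : GT φ φt g H) (h' : GT ψ ψt k J) :
    GT (fun p => φ p + ψ p) (fun p => φt p + ψt p) (fun p => g p + k p) (fun p => H p + J p) := by
  refine GT_mk (h.c1.add h'.c1) (h.c2.add h'.c2) (h.c3.add h'.c3) (h.c4.add h'.c4)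
    (fun p => (h.sy p).add (h'.sy p)) (fun x t => (h.dt x t).add (h'.dt x t)) (fun x t => ?_)
    (fun x t => ?_)
  · rw [map_add]; exact (h.dx x t).add (h'.dx x t)
  · rw [mL_add]; exact (h.dxx x t).add (h'.dxx x t)

/-- multiplication with a function of time -/
lemma GT.tmul (h : GT φ φt g H) {a a' : ℝ → ℝ} (ha : ∀ t, HasDerivAt a (a' t) t)
    (ha' : Continuous a') :
    GT (fun p => a p.2 * φ p) (fun p => a' p.2 * φ p + a p.2 * φt p) (fun p => a p.2 • g p)
      (fun p => a p.2 • H p) := by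
  have hc : Continuous a := continuous_iff_continuousAt.2 fun t => (ha t).continuousAt
  have c1 := h.c1
  have c2 := h.c2
  have c3 := h.c3
  have c4 := h.c4
  refine GT_mk (by fun_prop) (by fun_prop) (by fun_prop) (by fun_prop)
    (fun p => (h.sy p).smul _) (fun x t => (ha t).mul (h.dt x t)) (fun x t => ?_)
    (fun x t => ?_)
  · rw [map_smul]; exact (h.dx x t).const_mul (a t)
  · rw [mL_smul]; exact (h.dxx x t).const_smul (a t)

lemma GT.smul (h : GT φ φt g H) (c : ℝ) :
    GT (fun p => c * φ p) (fun p => c * φt p) (fun p => c • g p) (fun p => c • H p) := by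
  have := h.tmul (a := fun _ => c) (a' := fun _ => 0) (fun t => hasDerivAt_const t c)
    continuous_const
  simpa using this

/-- functions of time -/
lemma GT.time {a a' : ℝ → ℝ} (ha : ∀ t, HasDerivAt a (a' t) t)
    (ha' : Continuous a') :
    GT (n := n) (fun p => a p.2) (fun p => a' p.2) (fun _ => 0) (fun _ => 0) := by
  have hc : Continuous a := continuous_iff_continuousAt.2 fun t => (ha t).continuousAt
  refine GT_mk (hc.comp continuous_snd) (ha'.comp continuous_snd) continuous_const
    continuous_const (fun p => by simp [Matrix.IsSymm]) (fun x t => ha t) (fun x t => ?_)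
    (fun x t => ?_)
  · rw [map_zero]; exact hasFDerivAt_const (a t) x
  · have : mL (0 : Matrix (Fin n) (Fin n) ℝ) = 0 := by simp [mL]
    rw [this]; exact hasFDerivAt_const _ _

lemma GT.lin (w : Eucl n) :
    GT (fun p => inner ℝ w p.1) (fun _ => 0) (fun _ => w) (fun _ => 0) := by
  refine GT_mk (by fun_prop) (by fun_prop) continuous_const continuous_const
    (fun p => by simp [Matrix.IsSymm]) (fun x t => hasDerivAt_const t (inner ℝ w x)) (fun x t => ?_)
    (fun x t => ?_)
  · exact (innerSL ℝ w).hasFDerivAt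
  · have : mL (0 : Matrix (Fin n) (Fin n) ℝ) = 0 := by simp [mL]
    rw [this]; exact hasFDerivAt_const _ _

lemma GT.quad (z : Eucl n) :
    GT (fun p => ‖p.1 - z‖ ^ 2) (fun _ => 0) (fun p => (2 : ℝ) • (p.1 - z))
      (fun _ => (2 : ℝ) • 1) := by
  refine GT_mk (by fun_prop) (by fun_prop) (by fun_prop) (by fun_prop)
    (fun p => Matrix.isSymm_one.smul _) (fun x t => hasDerivAt_const t (‖x - z‖ ^ 2)) (fun x t => ?_)
    (fun x t => ?_)
  · have := ((hasFDerivAt_id x).sub_const z).norm_sq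
    refine HasFDerivAt.congr_fderiv this ?_
    ext1 y
    simp [two_smul]
  · rw [mL_smul, mL_one]
    exact ((hasFDerivAt_id x).sub_const z).const_smul (2 : ℝ)

/-- chain rule -/
lemma GT.comp (h : GT φ φt g H) {f f' f'' : ℝ → ℝ} (hf : ∀ s, HasDerivAt f (f' s) s)
    (hf' : ∀ s, HasDerivAt f' (f'' s) s) (hf'' : Continuous f'') :
    GT (fun p => f (φ p)) (fun p => f' (φ p) * φt p) (fun p => f' (φ p) • g p)
      (fun p => f'' (φ p) • r1 (g p) (g p) + f' (φ p) • H p) := by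
  have hc : Continuous f := continuous_iff_continuousAt.2 fun t => (hf t).continuousAt
  have hc' : Continuous f' := continuous_iff_continuousAt.2 fun t => (hf' t).continuousAt
  have c1 := h.c1
  have c2 := h.c2
  have c3 := h.c3
  have c4 := h.c4
  have c5 : Continuous (fun p => r1 (g p) (g p)) := by
    refine continuous_matrix fun i j => ?_
    simp only [r1, Matrix.of_apply]
    fun_prop
  refine GT_mk (by fun_prop) (by fun_prop) (by fun_prop) (by fun_prop)
    (fun p => ?_) (fun x t => ?_) (fun x t => ?_)
    (fun x t => ?_)
  · refine Matrix.IsSymm.add (Matrix.IsSymm.smul ?_ _) ((h.sy p).smul _)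
    ext i j
    simp [r1, mul_comm]
  · exact (hf _).comp t (h.dt x t)
  · rw [map_smul]
    exact (hf _).comp_hasFDerivAt x (h.dx x t)
  · have := ((hf' (φ (x, t))).comp_hasFDerivAt x (h.dx x t)).smul (h.dxx x t)
    refine HasFDerivAt.congr_fderiv this ?_
    rw [mL_add, mL_smul, mL_smul, add_comm]
    congr 1
    ext1 y
    simp [mL_r1, smul_smul]

/-- affine change of variables -/
lemma GT.aff (h : GT φ φt g H) (r m : ℝ) (x0 : Eucl n) (t0 : ℝ) :
    GT (fun p => φ (r • p.1 + x0, m * p.2 + t0)) (fun p => m * φt (r • p.1 + x0, m * p.2 + t0))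
      (fun p => r • g (r • p.1 + x0, m * p.2 + t0))
      (fun p => r ^ 2 • H (r • p.1 + x0, m * p.2 + t0)) := by
  have c1 := h.c1
  have c2 := h.c2
  have c3 := h.c3
  have c4 := h.c4
  have hx : ∀ x : Eucl n, HasFDerivAt (fun y : Eucl n => r • y + x0)
      (r • ContinuousLinearMap.id ℝ (Eucl n)) x := fun x =>
    ((hasFDerivAt_id x).const_smul r).add_const x0
  refine GT_mk (by fun_prop) (by fun_prop) (by fun_prop) (by fun_prop)
    (fun p => (h.sy _).smul _) (fun x t => ?_) (fun x t => ?_)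
    (fun x t => ?_)
  · have h2 : HasDerivAt (fun s : ℝ => m * s + t0) m t := by
      simpa using ((hasDerivAt_id t).const_mul m).add_const t0
    have := (h.dt (r • x + x0) (m * t + t0)).comp t h2
    rw [mul_comm]; exact this
  · have := (h.dx (r • x + x0) (m * t + t0)).comp x (hx x)
    refine HasFDerivAt.congr_fderiv this ?_
    ext1 y
    simp [inner_smul_left]
  · have := ((h.dxx (r • x + x0) (m * t + t0)).comp x (hx x)).const_smul r
    refine HasFDerivAt.congr_fderiv this ?_
    rw [mL_smul]
    ext1 y
    simp [smul_smul, pow_two]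
end

end Toolkit

noncomputable section MatrixTools

variable {n : ℕ}

open scoped MatrixOrder in
lemma psd_exists {B : Matrix (Fin n) (Fin n) ℝ} (hB : B.PosSemidef) :
    ∃ C : Matrix (Fin n) (Fin n) ℝ, B = C.conjTranspose * C := by
  have h0 : 0 ≤ B := Matrix.nonneg_iff_posSemidef.2 hB
  obtain ⟨C, hC⟩ := CStarAlgebra.nonneg_iff_eq_star_mul_self.1 h0
  exact ⟨C, hC⟩

lemma trace_psd_nonneg {A B : Matrix (Fin n) (Fin n) ℝ} (hA : A.PosSemidef) (hB : B.PosSemidef) :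
    0 ≤ (A * B).trace := by
  obtain ⟨C, rfl⟩ := psd_exists hB
  rw [← Matrix.mul_assoc, Matrix.trace_mul_comm, ← Matrix.mul_assoc]
  exact (hA.mul_mul_conjTranspose_same C).trace_nonneg

/-- Ellipticity of a matrix. -/
def Ell (L : ℝ) (A : Matrix (Fin n) (Fin n) ℝ) : Prop :=
  (A - L⁻¹ • (1 : Matrix (Fin n) (Fin n) ℝ)).PosSemidef ∧
    (L • (1 : Matrix (Fin n) (Fin n) ℝ) - A).PosSemidef

lemma r1_psd (a : Eucl n) : (r1 a a).PosSemidef := by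
  have := Matrix.posSemidef_vecMulVec_self_star (fun i => a i : Fin n → ℝ)
  convert this using 1
  ext i j
  simp [r1, Matrix.vecMulVec]

lemma trace_r1 (a : Eucl n) : (r1 a a).trace = ‖a‖ ^ 2 := by
  rw [EuclideanSpace.norm_sq_eq]
  simp [Matrix.trace, r1, pow_two]

lemma trace_mul_r1 (A : Matrix (Fin n) (Fin n) ℝ) (a b : Eucl n) :
    (A * r1 a b).trace = inner ℝ b (mL A a) := by
  simp [Matrix.trace, r1, Matrix.mul_apply, PiLp.inner_apply, mL_apply, Finset.sum_mul]
  refine Finset.sum_congr rfl fun i _ => Finset.sum_congr rfl fun j _ => by ring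

lemma Ell.lower {L : ℝ} {A : Matrix (Fin n) (Fin n) ℝ} (h : Ell L A)
    {B : Matrix (Fin n) (Fin n) ℝ} (hB : B.PosSemidef) : L⁻¹ * B.trace ≤ (A * B).trace := by
  have := trace_psd_nonneg h.1 hB
  rw [Matrix.sub_mul, Matrix.trace_sub] at this
  simp at this
  linarith

lemma Ell.upper {L : ℝ} {A : Matrix (Fin n) (Fin n) ℝ} (h : Ell L A)
    {B : Matrix (Fin n) (Fin n) ℝ} (hB : B.PosSemidef) : (A * B).trace ≤ L * B.trace := by
  have := trace_psd_nonneg h.2 hB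
  rw [Matrix.sub_mul, Matrix.trace_sub] at this
  simp at this
  linarith

lemma Ell.r1_lower {L : ℝ} {A : Matrix (Fin n) (Fin n) ℝ} (h : Ell L A) (a : Eucl n) :
    L⁻¹ * ‖a‖ ^ 2 ≤ (A * r1 a a).trace := by
  rw [← trace_r1]; exact h.lower (r1_psd a)

lemma Ell.r1_upper {L : ℝ} {A : Matrix (Fin n) (Fin n) ℝ} (h : Ell L A) (a : Eucl n) :
    (A * r1 a a).trace ≤ L * ‖a‖ ^ 2 := by
  rw [← trace_r1]; exact h.upper (r1_psd a)

lemma Ell.tr_upper {L : ℝ} {A : Matrix (Fin n) (Fin n) ℝ} (h : Ell L A) :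
    A.trace ≤ L * n := by
  have := h.upper (Matrix.PosSemidef.one)
  simpa using this

lemma Ell.tr_lower {L : ℝ} (hL : 0 < L) {A : Matrix (Fin n) (Fin n) ℝ} (h : Ell L A) :
    0 ≤ A.trace := by
  have := h.lower (Matrix.PosSemidef.one)
  simp at this
  exact le_trans (by positivity) this

lemma psd_of_quad {Z : Matrix (Fin n) (Fin n) ℝ} (hs : Z.IsSymm)
    (h : ∀ e : Eucl n, inner ℝ e (mL Z e) ≤ 0) : (-Z).PosSemidef := by
  refine Matrix.PosSemidef.of_dotProduct_mulVec_nonneg ?_ fun x => ?_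
  · rw [Matrix.IsHermitian, Matrix.conjTranspose_eq_transpose_of_trivial, Matrix.transpose_neg, hs.eq]
  · have := h (WithLp.toLp 2 x)
    have e : (star x ⬝ᵥ ((-Z).mulVec x)) = - inner ℝ (WithLp.toLp 2 x : Eucl n) (mL Z (WithLp.toLp 2 x)) := by
      simp [dotProduct, Matrix.mulVec, PiLp.inner_apply, mL_apply, Finset.mul_sum, Finset.sum_mul]
      refine Finset.sum_congr rfl fun i _ => Finset.sum_congr rfl fun j _ => by ring
    rw [e]; linarith

lemma one_sub_r1_psd {e : Eucl n} (he : ‖e‖ = 1) :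
    (1 - r1 e e : Matrix (Fin n) (Fin n) ℝ).PosSemidef := by
  have : (-(r1 e e - 1) : Matrix (Fin n) (Fin n) ℝ).PosSemidef := by
    refine psd_of_quad ?_ fun a => ?_
    · ext i j
      simp [r1, mul_comm, Matrix.one_apply, eq_comm]
    · have h1 : mL (r1 e e - 1) = mL (r1 e e) - mL 1 := by simp [mL, map_sub]
      rw [h1]
      simp only [sub_apply, mL_r1, mL_one, inner_sub_right, inner_smul_right]
      have := real_inner_le_norm e a
      have h2 := abs_real_inner_le_norm e a
      rw [he, one_mul] at h2
      simp only [ContinuousLinearMap.id_apply, real_inner_self_eq_norm_sq]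
      rw [real_inner_comm e a]
      have h3 := sq_le_sq' (by linarith [abs_le.1 h2]) (abs_le.1 h2).2
      nlinarith
  simpa using this

lemma Ell.neg_bound {L : ℝ} (hL : 0 < L) {A Z : Matrix (Fin n) (Fin n) ℝ} (h : Ell L A)
    (hs : Z.IsSymm) (hq : ∀ e : Eucl n, inner ℝ e (mL Z e) ≤ 0) {e : Eucl n} (he : ‖e‖ = 1) :
    (A * Z).trace ≤ L⁻¹ * inner ℝ e (mL Z e) := by
  have hZ := psd_of_quad hs hq
  have h1 := h.lower hZ
  have h2 := trace_psd_nonneg hZ (one_sub_r1_psd he)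
  rw [Matrix.mul_sub, Matrix.trace_sub, Matrix.mul_one, Matrix.neg_mul, Matrix.trace_neg,
    Matrix.trace_neg, trace_mul_r1] at h2
  rw [Matrix.mul_neg, Matrix.trace_neg, Matrix.trace_neg] at h1
  have : L⁻¹ * Z.trace ≤ L⁻¹ * inner ℝ e (mL Z e) :=
    mul_le_mul_of_nonneg_left (by linarith) (by positivity)
  linarith

lemma Ell.nonpos {L : ℝ} (hL : 0 < L) {A Z : Matrix (Fin n) (Fin n) ℝ} (h : Ell L A)
    (hs : Z.IsSymm) (hq : ∀ e : Eucl n, inner ℝ e (mL Z e) ≤ 0) :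
    (A * Z).trace ≤ 0 := by
  have hZ := psd_of_quad hs hq
  have h1 := h.lower hZ
  rw [Matrix.mul_neg, Matrix.trace_neg (A * Z)] at h1
  have h2 := hZ.trace_nonneg
  have : 0 ≤ L⁻¹ * (-Z).trace := by positivity
  linarith

end MatrixTools

noncomputable section Visc

variable {d : ℕ}

def UU (d : ℕ) (b : ℝ) : Set (SpaceTime (d + 1)) :=
  {p | ‖p.1‖ < 1 ∧ b ≤ lastC p.1 ∧ -1 < p.2 ∧ p.2 ≤ 0}

/-- viscosity supersolutions in `UU` (tested by global test functions) -/
def VS (b lam : ℝ) (Q : ℝ → Matrix (Fin (d + 1)) (Fin (d + 1)) ℝ) (v : ℝ → Eucl (d + 1))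
    (u : SpaceTime (d + 1) → ℝ) : Prop :=
  ContinuousOn u (UU d b) ∧
  ∀ (φ φt : SpaceTime (d + 1) → ℝ) (g : SpaceTime (d + 1) → Eucl (d + 1))
    (H : SpaceTime (d + 1) → Matrix (Fin (d + 1)) (Fin (d + 1)) ℝ) (p : SpaceTime (d + 1)),
    GT φ φt g H → p ∈ UU d b →
    (∀ᶠ q in 𝓝 p, q.2 ≤ p.2 → b ≤ lastC q.1 → u p - φ p ≤ u q - φ q) →
    (b < lastC p.1 → (Q p.2 * H p).trace ≤ lam * φt p) ∧
    (lastC p.1 = b → ⟪v p.2, g p⟫ ≤ φt p)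

lemma lastC_continuous : Continuous (lastC : Eucl (d + 1) → ℝ) := by
  unfold lastC; fun_prop

lemma lastC_add (x y : Eucl (d + 1)) : lastC (x + y) = lastC x + lastC y := by simp [lastC]
lemma lastC_sub (x y : Eucl (d + 1)) : lastC (x - y) = lastC x - lastC y := by simp [lastC]
lemma lastC_neg (x : Eucl (d + 1)) : lastC (-x) = - lastC x := by simp [lastC]
lemma lastC_smul (c : ℝ) (x : Eucl (d + 1)) : lastC (c • x) = c * lastC x := by simp [lastC]
lemma abs_lastC_le (x : Eucl (d + 1)) : |lastC x| ≤ ‖x‖ := by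
  have := PiLp.norm_apply_le x (Fin.last d)
  simpa [lastC] using this

/-- last basis vector -/
def eN (d : ℕ) : Eucl (d + 1) := EuclideanSpace.single (Fin.last d) 1

lemma lastC_eN : lastC (eN d) = 1 := by simp [lastC, eN]
lemma norm_eN : ‖eN d‖ = 1 := by simp [eN]
lemma inner_eN (x : Eucl (d + 1)) : inner ℝ x (eN d) = lastC x := by
  simp [eN, lastC, EuclideanSpace.inner_single_right]

lemma VS.congr {b lam : ℝ} {Q Q₂ : ℝ → Matrix (Fin (d + 1)) (Fin (d + 1)) ℝ}
    {v v₂ : ℝ → Eucl (d + 1)} {u : SpaceTime (d + 1) → ℝ} (h : VS b lam Q v u)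
    (hQ : ∀ t, -1 < t → t ≤ 0 → Q t = Q₂ t) (hv : ∀ t, -1 < t → t ≤ 0 → v t = v₂ t) :
    VS b lam Q₂ v₂ u := by
  refine ⟨h.1, fun φ φt g H p hG hp he => ?_⟩
  have := h.2 φ φt g H p hG hp he
  rwa [hQ _ hp.2.2.1 hp.2.2.2, hv _ hp.2.2.1 hp.2.2.2] at this

lemma VS.transfer {b b' lam : ℝ} {Q : ℝ → Matrix (Fin (d + 1)) (Fin (d + 1)) ℝ}
    {v : ℝ → Eucl (d + 1)} {u : SpaceTime (d + 1) → ℝ} (h : VS b lam Q v u)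
    {R μ c : ℝ} (hR : 0 < R) (hμ : 0 < μ) (hc : 0 < c) (c0 : ℝ) (x0 : Eucl (d + 1)) (t0 : ℝ)
    (hb : R * b' + lastC x0 = b)
    (hU : ∀ p ∈ UU d b', (R • p.1 + x0, μ * p.2 + t0) ∈ UU d b) :
    VS b' (lam * R ^ 2 / μ) (fun t => Q (μ * t + t0)) (fun t => (μ / R) • v (μ * t + t0))
      (fun p => c * u (R • p.1 + x0, μ * p.2 + t0) + c0) := by
  refine ⟨?_, fun φ φt g H p hG hp he => ?_⟩
  · have h1 : ContinuousOn (fun p : SpaceTime (d + 1) => u (R • p.1 + x0, μ * p.2 + t0))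
        (UU d b') := by
      refine h.1.comp (f := fun p : SpaceTime (d + 1) => (R • p.1 + x0, μ * p.2 + t0)) ?_ hU
      fun_prop
    exact (continuousOn_const.mul h1).add continuousOn_const
  · have hG2 := (hG.aff R⁻¹ μ⁻¹ (-(R⁻¹ • x0)) (-(μ⁻¹ * t0))).smul c⁻¹
    have hinv : ∀ q : SpaceTime (d + 1),
        (R⁻¹ • (R • q.1 + x0) + -(R⁻¹ • x0), μ⁻¹ * (μ * q.2 + t0) + -(μ⁻¹ * t0)) = q := by
      intro q
      ext1
      · simp [smul_smul, hR.ne']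
      · simp; field_simp; ring
    have hinv2 : ∀ q : SpaceTime (d + 1),
        (R • (R⁻¹ • q.1 + -(R⁻¹ • x0)) + x0, μ * (μ⁻¹ * q.2 + -(μ⁻¹ * t0)) + t0) = q := by
      intro q
      ext1
      · simp [smul_smul, hR.ne']
      · simp; field_simp; ring
    have key := h.2 _ _ _ _ (R • p.1 + x0, μ * p.2 + t0) hG2 (hU p hp) ?_
    · simp only [hinv] at key
      refine ⟨fun h1 => ?_, fun h1 => ?_⟩
      · have := key.1 (by simp only [lastC_add, lastC_smul]; nlinarith)
        rw [Matrix.mul_smul, Matrix.mul_smul, Matrix.trace_smul, Matrix.trace_smul] at this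
        simp only [smul_eq_mul] at this
        have h2 : (Q (μ * p.2 + t0) * H p).trace
            = c * R ^ 2 * (c⁻¹ * (R⁻¹ ^ 2 * (Q (μ * p.2 + t0) * H p).trace)) := by
          field_simp
        have h3 : lam * R ^ 2 / μ * φt p = c * R ^ 2 * (lam * (c⁻¹ * (μ⁻¹ * φt p))) := by
          field_simp
        rw [h2, h3]
        exact mul_le_mul_of_nonneg_left this (by positivity)
      · have := key.2 (by simp only [lastC_add, lastC_smul]; nlinarith)
        simp only [inner_smul_right] at this
        simp only [inner_smul_left, conj_trivial]
        have h2 : μ / R * ⟪v (μ * p.2 + t0), g p⟫ = c * μ * (c⁻¹ * (R⁻¹ * ⟪v (μ * p.2 + t0), g p⟫)) := by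
          field_simp
        have h3 : φt p = c * μ * (c⁻¹ * (μ⁻¹ * φt p)) := by field_simp
        rw [h2, h3]
        exact mul_le_mul_of_nonneg_left this (by positivity)
    · have hcont : Tendsto (fun q : SpaceTime (d + 1) =>
          (R⁻¹ • q.1 + -(R⁻¹ • x0), μ⁻¹ * q.2 + -(μ⁻¹ * t0)))
          (𝓝 (R • p.1 + x0, μ * p.2 + t0)) (𝓝 p) := by
        have : Continuous (fun q : SpaceTime (d + 1) =>
          (R⁻¹ • q.1 + -(R⁻¹ • x0), μ⁻¹ * q.2 + -(μ⁻¹ * t0))) := by fun_prop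
        have h2 := this.tendsto (R • p.1 + x0, μ * p.2 + t0)
        simp only [hinv] at h2
        exact h2
      filter_upwards [hcont.eventually he] with q hq h1 h2
      have h3 := hq ?_ ?_
      · simp only [hinv2] at h3
        simp only [hinv]
        have e1 : c⁻¹ * (c * u (R • p.1 + x0, μ * p.2 + t0) + c0 - φ p) ≤
            c⁻¹ * (c * u q + c0 - φ (R⁻¹ • q.1 + -(R⁻¹ • x0), μ⁻¹ * q.2 + -(μ⁻¹ * t0))) :=
          mul_le_mul_of_nonneg_left h3 (by positivity)
        have e2 : c⁻¹ * c = 1 := by field_simp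
        simp only [mul_sub, mul_add, ← mul_assoc, e2] at e1
        linarith
      · have : q.2 ≤ μ * p.2 + t0 := h1
        have h4 : μ⁻¹ * q.2 ≤ μ⁻¹ * (μ * p.2 + t0) := mul_le_mul_of_nonneg_left this (by positivity)
        have h5 : μ⁻¹ * (μ * p.2 + t0) = p.2 + μ⁻¹ * t0 := by field_simp
        show μ⁻¹ * q.2 + -(μ⁻¹ * t0) ≤ p.2
        linarith
      · simp only [lastC_add, lastC_smul, lastC_neg]
        have h4 : b' = R⁻¹ * (b - lastC x0) := by rw [← hb]; field_simp; ring
        rw [h4]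
        have : R⁻¹ * b ≤ R⁻¹ * lastC q.1 := mul_le_mul_of_nonneg_left h2 (by positivity)
        linarith

/-- Comparison with a compact family of barriers. -/
lemma VS.comparison {b lam : ℝ} {Q : ℝ → Matrix (Fin (d + 1)) (Fin (d + 1)) ℝ}
    {v : ℝ → Eucl (d + 1)} {u : SpaceTime (d + 1) → ℝ} (hu : VS b lam Q v u)
    {r t0 t1 : ℝ} (hr : r < 1) (h0 : -1 < t0) (h1 : t1 ≤ 0)
    {Y : Set (Eucl (d + 1))} (hY : IsCompact Y)
    {φ φt : Eucl (d + 1) → SpaceTime (d + 1) → ℝ} {g : Eucl (d + 1) → SpaceTime (d + 1) → Eucl (d + 1)}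
    {H : Eucl (d + 1) → SpaceTime (d + 1) → Matrix (Fin (d + 1)) (Fin (d + 1)) ℝ}
    (hG : ∀ y ∈ Y, GT (φ y) (φt y) (g y) (H y))
    (hc : Continuous (fun q : Eucl (d + 1) × SpaceTime (d + 1) => φ q.1 q.2))
    (hinit : ∀ y ∈ Y, ∀ x, ‖x‖ ≤ r → b ≤ lastC x → φ y (x, t0) ≤ u (x, t0))
    (hstep : ∀ y ∈ Y, ∀ x t, ‖x‖ ≤ r → b ≤ lastC x → t0 < t → t ≤ t1 →
      u (x, t) < φ y (x, t) → (∀ y' ∈ Y, φ y' (x, t) ≤ φ y (x, t)) →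
      ‖x‖ < r ∧ (b < lastC x → lam * φt y (x, t) < (Q t * H y (x, t)).trace) ∧
      (lastC x = b → φt y (x, t) < ⟪v t, g y (x, t)⟫)) :
    ∀ y ∈ Y, ∀ x t, ‖x‖ ≤ r → b ≤ lastC x → t0 ≤ t → t ≤ t1 → φ y (x, t) ≤ u (x, t) := by
  by_contra hcon
  push Not at hcon
  obtain ⟨y₁, hy₁, x₁, t₁, a1, a2, a3, a4, a5⟩ := hcon
  obtain ⟨S, hS⟩ : ∃ S : Set (Eucl (d + 1) × SpaceTime (d + 1)), S =
    Y ×ˢ ((closedBall 0 r ∩ {x | b ≤ lastC x}) ×ˢ Icc t0 t1) := ⟨_, rfl⟩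
  have hmemS : ∀ y x t, (y, (x, t)) ∈ S ↔ y ∈ Y ∧ ‖x‖ ≤ r ∧ b ≤ lastC x ∧ t0 ≤ t ∧ t ≤ t1 := by
    intro y x t
    rw [hS]
    simp only [mem_prod, mem_inter_iff, mem_closedBall, dist_zero_right, mem_ofPred_eq, mem_Icc]
    tauto
  have hScomp : IsCompact S := by
    rw [hS]
    refine hY.prod (IsCompact.prod ?_ isCompact_Icc)
    exact (isCompact_closedBall _ _).inter_right (isClosed_le continuous_const lastC_continuous)
  have hSU : ∀ q ∈ S, q.2 ∈ UU d b := by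
    rintro ⟨y, x, t⟩ hq
    obtain ⟨_, hx, hx2, ht, ht2⟩ := (hmemS y x t).1 hq
    exact ⟨lt_of_le_of_lt hx hr, hx2, lt_of_lt_of_le h0 ht, ht2.trans h1⟩
  clear hS
  have hcont : ContinuousOn (fun q : Eucl (d + 1) × SpaceTime (d + 1) => φ q.1 q.2 - u q.2) S := by
    refine hc.continuousOn.sub ?_
    exact hu.1.comp (f := fun q : Eucl (d + 1) × SpaceTime (d + 1) => q.2)
      continuous_snd.continuousOn hSU
  have hmem : (y₁, (x₁, t₁)) ∈ S := (hmemS _ _ _).2 ⟨hy₁, a1, a2, a3, a4⟩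
  obtain ⟨q0, hq, hmax⟩ := hScomp.exists_isMaxOn ⟨_, hmem⟩ hcont
  obtain ⟨y, x, t⟩ := q0
  obtain ⟨hy, hx', hxb, htl, htu⟩ := (hmemS _ _ _).1 hq
  have hmax' : ∀ y' x' t', (y', (x', t')) ∈ S →
      φ y' (x', t') - u (x', t') ≤ φ y (x, t) - u (x, t) := fun y' x' t' h => hmax h
  have hpos : 0 < φ y (x, t) - u (x, t) := by
    have := hmax' _ _ _ hmem
    linarith
  have htt : t0 < t := by
    rcases htl.eq_or_lt with h | h
    · exfalso
      have := hinit y hy x hx' hxb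
      rw [h] at this
      linarith
    · exact h
  obtain ⟨b1, b2, b3⟩ := hstep y hy x t hx' hxb htt htu (by linarith) (fun y' hy' => by
    have := hmax' y' x t ((hmemS _ _ _).2 ⟨hy', hx', hxb, htl, htu⟩)
    linarith)
  have e1 : ∀ᶠ q : SpaceTime (d + 1) in 𝓝 (x, t), ‖q.1‖ < r :=
    (continuous_fst.norm).continuousAt.eventually_lt continuousAt_const b1
  have e2 : ∀ᶠ q : SpaceTime (d + 1) in 𝓝 (x, t), t0 < q.2 :=
    continuousAt_const.eventually_lt continuous_snd.continuousAt htt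
  have e3 : ∀ᶠ q : SpaceTime (d + 1) in 𝓝 (x, t), q.2 ≤ t → b ≤ lastC q.1 →
      u (x, t) - φ y (x, t) ≤ u q - φ y q := by
    filter_upwards [e1, e2] with q c1 c2 c3 c4
    obtain ⟨q1, q2⟩ := q
    have h5 : φ y (q1, q2) - u (q1, q2) ≤ φ y (x, t) - u (x, t) :=
      hmax' y q1 q2 ((hmemS y q1 q2).2 ⟨hy, le_of_lt c1, c4, le_of_lt c2, le_trans c3 htu⟩)
    linarith only [h5]
  have key := hu.2 (φ y) (φt y) (g y) (H y) (x, t) (hG y hy) (hSU (y, (x, t)) hq) e3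
  rcases lt_or_eq_of_le hxb with h | h
  · exact absurd (key.1 h) (not_le.2 (b2 h))
  · exact absurd (key.2 h.symm) (not_le.2 (b3 h.symm))

lemma KcP_eq : KcP d 1 = UU d 0 := by
  ext p
  simp only [KcP, Kc, Fc, UU, mem_union, mem_ofPred_eq, mem_ball, dist_zero_right, mem_Ioc]
  constructor
  · rintro (⟨h1, h2, h3, h4⟩ | ⟨h1, h2, h3, h4⟩)
    · exact ⟨h1, h2.le, h3, h4⟩
    · exact ⟨h1, h2.ge, h3, h4⟩
  · rintro ⟨h1, h2, h3, h4⟩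
    rcases h2.lt_or_eq with h | h
    · exact Or.inl ⟨h1, h, h3, h4⟩
    · exact Or.inr ⟨h1, h.symm, h3, h4⟩

lemma UU_closure {p : SpaceTime (d + 1)} (hp : p ∈ UU d 0) : p ∈ closure (Kc d 1) := by
  have hc : Continuous (fun s : ℝ => ((p.1 + s • eN d, p.2) : SpaceTime (d + 1))) := by fun_prop
  have h1 : Tendsto (fun s : ℝ => ((p.1 + s • eN d, p.2) : SpaceTime (d + 1))) (𝓝[>] 0) (𝓝 p) := by
    have := hc.tendsto 0
    simp only [zero_smul, add_zero] at this
    exact this.mono_left nhdsWithin_le_nhds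
  refine mem_closure_of_tendsto h1 ?_
  have h2 : ∀ᶠ s : ℝ in 𝓝[>] 0, ‖p.1 + s • eN d‖ < 1 := by
    have : ContinuousAt (fun s : ℝ => ‖p.1 + s • eN d‖) 0 := by fun_prop
    have h3 := this.eventually_lt (continuousAt_const (y := (1 : ℝ))) (by simpa using hp.1)
    exact nhdsWithin_le_nhds h3
  filter_upwards [h2, self_mem_nhdsWithin] with s hs hs2
  have hs2 : 0 < s := hs2
  refine ⟨by simpa using hs, ?_, hp.2.2.1, hp.2.2.2⟩
  simp only [lastC_add, lastC_smul, lastC_eN]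
  have := hp.2.1
  linarith

lemma closure_Kc_sub {p : SpaceTime (d + 1)} (hp : p ∈ closure (Kc d 1)) : 0 ≤ lastC p.1 := by
  have : closure (Kc d 1) ⊆ {p | 0 ≤ lastC p.1} :=
    closure_minimal (fun q hq => hq.2.1.le)
      (isClosed_le continuous_const (lastC_continuous.comp continuous_fst))
  exact this hp

lemma VS_of_sup {lam : ℝ} {Q : ℝ → Matrix (Fin (d + 1)) (Fin (d + 1)) ℝ}
    {v : ℝ → Eucl (d + 1)} {η : SpaceTime (d + 1) → ℝ} (h : ObliqueSup d lam Q v η) :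
    VS 0 lam Q v η := by
  refine ⟨KcP_eq (d := d) ▸ h.1, fun φ φt g H p hG hp he => ?_⟩
  obtain ⟨ε, hε, hball⟩ := Metric.eventually_nhds_iff.1 he
  have hG2 := hG.add (GT.time (n := d + 1) (a := fun _ => η p - φ p) (a' := fun _ => 0)
    (fun t => hasDerivAt_const t _) continuous_const)
  have key := h.2 _ _ _ _ p (min ε 1 / 2) (by positivity)
    (PTmono hG2 (subset_univ _)) ⟨⟨⟨?_, ?_⟩, UU_closure hp⟩, by simp, ?_⟩
  · refine ⟨fun h1 => ?_, fun h1 => ?_⟩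
    · simpa using key.1 ⟨by simpa using hp.1, h1, hp.2.2.1, hp.2.2.2⟩
    · simpa using key.2 ⟨by simpa using hp.1, h1, hp.2.2.1, hp.2.2.2⟩
  · simp; positivity
  · constructor
    · have : 0 < (min ε 1 / 2) ^ 2 := by positivity
      linarith
    · exact le_rfl
  · rintro ⟨x, t⟩ ⟨⟨hx, ht⟩, hcl⟩
    have hm1 := min_le_left ε 1
    have hm2 := min_le_right ε 1
    have hm3 : 0 < min ε 1 := by positivity
    have := hball (y := (x, t)) ?_ ht.2 (closure_Kc_sub hcl)
    · linarith
    · rw [Prod.dist_eq]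
      have hx' : dist x p.1 < min ε 1 / 2 := hx
      have ht1 : p.2 - (min ε 1 / 2) ^ 2 < t := ht.1
      have ht2 : t ≤ p.2 := ht.2
      refine max_lt (by linarith) ?_
      rw [Real.dist_eq, abs_sub_lt_iff]
      constructor <;> nlinarith

lemma GT.neg' {n : ℕ} {φ φt : SpaceTime n → ℝ} {g : SpaceTime n → Eucl n}
    {H : SpaceTime n → Matrix (Fin n) (Fin n) ℝ} (h : GT φ φt g H) :
    GT (fun p => - φ p) (fun p => - φt p) (fun p => - g p) (fun p => - H p) := by
  simpa using h.smul (-1)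

lemma VS_of_sub {lam : ℝ} {Q : ℝ → Matrix (Fin (d + 1)) (Fin (d + 1)) ℝ}
    {v : ℝ → Eucl (d + 1)} {η : SpaceTime (d + 1) → ℝ} (h : ObliqueSub d lam Q v η) :
    VS 0 lam Q v (fun p => - η p) := by
  refine ⟨(KcP_eq (d := d) ▸ h.1).neg, fun φ φt g H p hG hp he => ?_⟩
  obtain ⟨ε, hε, hball⟩ := Metric.eventually_nhds_iff.1 he
  have hG2 := hG.neg'.add (GT.time (n := d + 1) (a := fun _ => η p + φ p) (a' := fun _ => 0)
    (fun t => hasDerivAt_const t _) continuous_const)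
  have key := h.2 _ _ _ _ p (min ε 1 / 2) (by positivity)
    (PTmono hG2 (subset_univ _)) ⟨⟨⟨?_, ?_⟩, UU_closure hp⟩, by simp, ?_⟩
  · refine ⟨fun h1 => ?_, fun h1 => ?_⟩
    · have := key.1 ⟨by simpa using hp.1, h1, hp.2.2.1, hp.2.2.2⟩
      simp at this
      linarith
    · have := key.2 ⟨by simpa using hp.1, h1, hp.2.2.1, hp.2.2.2⟩
      simp at this
      linarith
  · simp; positivity
  · constructor
    · have : 0 < (min ε 1 / 2) ^ 2 := by positivity
      linarith
    · exact le_rfl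
  · rintro ⟨x, t⟩ ⟨⟨hx, ht⟩, hcl⟩
    have hm1 := min_le_left ε 1
    have hm2 := min_le_right ε 1
    have hm3 : 0 < min ε 1 := by positivity
    have := hball (y := (x, t)) ?_ ht.2 (closure_Kc_sub hcl)
    · linarith
    · rw [Prod.dist_eq]
      have hx' : dist x p.1 < min ε 1 / 2 := hx
      have ht1 : p.2 - (min ε 1 / 2) ^ 2 < t := ht.1
      have ht2 : t ≤ p.2 := ht.2
      refine max_lt (by linarith) ?_
      rw [Real.dist_eq, abs_sub_lt_iff]
      constructor <;> nlinarith

end Visc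

noncomputable section Fourier

variable {d : ℕ}

/-- lattice period -/
def latt (d : ℕ) (m : Fin (d + 1) → ℤ) : Eucl (d + 1) := WithLp.toLp 2 fun i => (m i : ℝ) / (d + 1)

/-- classical periodic solutions -/
def PSol (Q : ℝ → Matrix (Fin (d + 1)) (Fin (d + 1)) ℝ) (U : SpaceTime (d + 1) → ℝ) : Prop :=
  (∃ Ut g H, GT U Ut g H ∧ ∀ p, Ut p = (Q p.2 * H p).trace) ∧
  ∀ m y t, U (y + latt d m, t) = U (y, t)

lemma PSol.add {Q : ℝ → Matrix (Fin (d + 1)) (Fin (d + 1)) ℝ} {U V : SpaceTime (d + 1) → ℝ}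
    (hU : PSol Q U) (hV : PSol Q V) : PSol Q (fun p => U p + V p) := by
  obtain ⟨⟨Ut, g, H, h1, h2⟩, h3⟩ := hU
  obtain ⟨⟨Ut', g', H', h1', h2'⟩, h3'⟩ := hV
  refine ⟨⟨_, _, _, h1.add h1', fun p => ?_⟩, fun m y t => by simp only [h3, h3']⟩
  rw [Matrix.mul_add, Matrix.trace_add, h2, h2']

lemma PSol.smul {Q : ℝ → Matrix (Fin (d + 1)) (Fin (d + 1)) ℝ} {U : SpaceTime (d + 1) → ℝ}
    (hU : PSol Q U) (c : ℝ) : PSol Q (fun p => c * U p) := by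
  obtain ⟨⟨Ut, g, H, h1, h2⟩, h3⟩ := hU
  refine ⟨⟨_, _, _, h1.smul c, fun p => ?_⟩, fun m y t => by simp only [h3]⟩
  rw [Matrix.mul_smul, Matrix.trace_smul, h2, smul_eq_mul]

lemma PSol.neg {Q : ℝ → Matrix (Fin (d + 1)) (Fin (d + 1)) ℝ} {U : SpaceTime (d + 1) → ℝ}
    (hU : PSol Q U) : PSol Q (fun p => - U p) := by
  simpa using hU.smul (-1)

lemma PSol.zero {Q : ℝ → Matrix (Fin (d + 1)) (Fin (d + 1)) ℝ} : PSol Q (fun _ => 0) := by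
  refine ⟨⟨_, _, _, GT.time (a := fun _ => 0) (a' := fun _ => 0) (fun t => hasDerivAt_const t _)
    continuous_const, fun p => by simp⟩, fun _ _ _ => rfl⟩

/-- frequency vector -/
def freq (d : ℕ) (k : Fin (d + 1) → ℤ) : Eucl (d + 1) :=
  WithLp.toLp 2 fun i => 2 * Real.pi * (d + 1) * k i

lemma inner_freq_latt (k m : Fin (d + 1) → ℤ) :
    ∃ N : ℤ, inner ℝ (freq d k) (latt d m) = N * (2 * Real.pi) := by
  refine ⟨∑ i, k i * m i, ?_⟩
  simp only [freq, latt, PiLp.inner_apply]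
  push_cast
  rw [Finset.sum_mul]
  refine Finset.sum_congr rfl fun i _ => ?_
  simp
  field_simp

lemma PSol_trig {Q : ℝ → Matrix (Fin (d + 1)) (Fin (d + 1)) ℝ} (hQ : Continuous Q) (t0 : ℝ)
    (k : Fin (d + 1) → ℤ) {f f' f'' : ℝ → ℝ} (hf : ∀ s, HasDerivAt f (f' s) s)
    (hf' : ∀ s, HasDerivAt f' (f'' s) s) (hf'' : ∀ s, f'' s = - f s)
    (hper : ∀ s (N : ℤ), f (s + N * (2 * Real.pi)) = f s) :
    ∃ U, PSol Q U ∧ ∀ x, U (x, t0) = f (inner ℝ (freq d k) x) := by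
  have hfc : Continuous f := continuous_iff_continuousAt.2 fun t => (hf t).continuousAt
  set ω := freq d k with hω
  set q' : ℝ → ℝ := fun s => inner ℝ ω (mL (Q s) ω) with hq'
  have hq'c : Continuous q' := by
    have : q' = fun s => (Q s * r1 ω ω).trace := by
      funext s; rw [trace_mul_r1]
    rw [this]
    exact (hQ.matrix_mul continuous_const).matrix_trace
  set q : ℝ → ℝ := fun t => ∫ s in t0..t, q' s with hq
  have hqd : ∀ t, HasDerivAt q (q' t) t := fun t =>
    intervalIntegral.integral_hasDerivAt_right (hq'c.intervalIntegrable _ _)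
      hq'c.stronglyMeasurable.stronglyMeasurableAtFilter hq'c.continuousAt
  have hqc : Continuous q := continuous_iff_continuousAt.2 fun t => (hqd t).continuousAt
  have he : ∀ t, HasDerivAt (fun t => Real.exp (- q t)) (Real.exp (- q t) * (- q' t)) t :=
    fun t => (hqd t).neg.exp
  have hG := ((GT.lin ω).comp hf hf' (by
    have : f'' = fun s => - f s := funext hf''
    rw [this]; exact hfc.neg)).tmul he (by fun_prop)
  refine ⟨_, ⟨⟨_, _, _, hG, fun p => ?_⟩, fun m y t => ?_⟩, fun x => ?_⟩
  · simp only [smul_zero, add_zero, mul_zero, hf'', Matrix.mul_smul, Matrix.trace_smul,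
      trace_mul_r1, smul_eq_mul, hq']
    ring
  · obtain ⟨N, hN⟩ := inner_freq_latt k m
    simp only [inner_add_right, hω, hN, hper]
  · simp [hq]

/-- the covering map of the torus -/
def tor (x : Eucl (d + 1)) : UnitAddTorus (Fin (d + 1)) :=
  fun i => (((d + 1 : ℝ) * x i : ℝ) : UnitAddCircle)

lemma mFourier_tor (k : Fin (d + 1) → ℤ) (x : Eucl (d + 1)) :
    UnitAddTorus.mFourier k (tor x) = Complex.exp ((inner ℝ (freq d k) x : ℝ) * Complex.I) := by
  simp only [UnitAddTorus.mFourier, ContinuousMap.coe_mk, tor, fourier_coe_apply]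
  rw [← Complex.exp_sum]
  congr 1
  simp only [PiLp.inner_apply, freq]
  push_cast
  rw [Finset.sum_mul]
  refine Finset.sum_congr rfl fun i _ => ?_
  simp
  ring

lemma PSol_span {Q : ℝ → Matrix (Fin (d + 1)) (Fin (d + 1)) ℝ} (hQ : Continuous Q) (t0 : ℝ)
    {P : C(UnitAddTorus (Fin (d + 1)), ℂ)}
    (hP : P ∈ Submodule.span ℂ (range (UnitAddTorus.mFourier (d := Fin (d + 1))))) :
    ∃ U V, PSol Q U ∧ PSol Q V ∧ (∀ x, U (x, t0) = (P (tor x)).re) ∧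
      ∀ x, V (x, t0) = (P (tor x)).im := by
  induction hP using Submodule.span_induction with
  | mem x h =>
    obtain ⟨k, rfl⟩ := h
    obtain ⟨U, hU, hU2⟩ := PSol_trig hQ t0 k (f := Real.cos) (f' := fun s => - Real.sin s)
      (f'' := fun s => - Real.cos s) Real.hasDerivAt_cos (fun s => (Real.hasDerivAt_sin s).neg)
      (fun s => rfl) (fun s N => Real.cos_add_int_mul_two_pi s N)
    obtain ⟨V, hV, hV2⟩ := PSol_trig hQ t0 k (f := Real.sin) (f' := Real.cos)
      (f'' := fun s => - Real.sin s) Real.hasDerivAt_sin Real.hasDerivAt_cos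
      (fun s => rfl) (fun s N => Real.sin_add_int_mul_two_pi s N)
    refine ⟨U, V, hU, hV, fun x => ?_, fun x => ?_⟩
    · rw [hU2, mFourier_tor, Complex.exp_ofReal_mul_I_re]
    · rw [hV2, mFourier_tor, Complex.exp_ofReal_mul_I_im]
  | zero => exact ⟨_, _, PSol.zero, PSol.zero, fun x => by simp, fun x => by simp⟩
  | add x y hx hy ih1 ih2 =>
    obtain ⟨U, V, h1, h2, h3, h4⟩ := ih1
    obtain ⟨U', V', h1', h2', h3', h4'⟩ := ih2
    exact ⟨_, _, h1.add h1', h2.add h2', fun x => by simp [h3, h3'], fun x => by simp [h4, h4']⟩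
  | smul a x hx ih =>
    obtain ⟨U, V, h1, h2, h3, h4⟩ := ih
    refine ⟨_, _, (h1.smul a.re).add (h2.smul (- a.im)), (h1.smul a.im).add (h2.smul a.re),
      fun x => ?_, fun x => ?_⟩
    · simp [h3, h4]; ring
    · simp [h3, h4]; ring

/-- the folding map -/
def foldT (θ : UnitAddTorus (Fin (d + 1))) : Eucl (d + 1) :=
  WithLp.toLp 2 fun i => Real.arcsin ((fourier 1 (θ i) : ℂ).im) / (2 * Real.pi * (d + 1))

lemma foldT_cont : Continuous (foldT (d := d)) := by
  unfold foldT
  have : Continuous fun θ : UnitAddTorus (Fin (d + 1)) => (fun i =>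
      Real.arcsin ((fourier 1 (θ i) : ℂ).im) / (2 * Real.pi * (d + 1)) : Fin (d + 1) → ℝ) := by
    refine continuous_pi fun i => ?_
    refine Continuous.div_const ?_ _
    refine Real.continuous_arcsin.comp (Complex.continuous_im.comp ?_)
    exact (fourier 1).continuous.comp (continuous_apply i)
  exact (PiLp.continuous_toLp 2 _).comp this

lemma norm_le_of_coord {x : Eucl (d + 1)} {c : ℝ} (hc : 0 ≤ c) (h : ∀ i, |x i| ≤ c) :
    ‖x‖ ≤ (d + 1) * c := by
  rw [EuclideanSpace.norm_eq]
  refine Real.sqrt_le_iff.2 ⟨by positivity, ?_⟩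
  calc ∑ i, ‖x i‖ ^ 2 ≤ ∑ i : Fin (d + 1), c ^ 2 := by
        refine Finset.sum_le_sum fun i _ => ?_
        exact pow_le_pow_left₀ (norm_nonneg _) (h i) 2
    _ = (d + 1) * c ^ 2 := by simp
    _ ≤ ((d + 1) * c) ^ 2 := by
        have : (0 : ℝ) ≤ d := by positivity
        nlinarith [sq_nonneg c, mul_nonneg this (sq_nonneg c)]

lemma foldT_norm (θ : UnitAddTorus (Fin (d + 1))) : ‖foldT θ‖ ≤ 1 / 4 := by
  have h := norm_le_of_coord (x := foldT θ) (c := 1 / (4 * (d + 1))) (by positivity) (fun i => ?_)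
  · refine h.trans (le_of_eq ?_)
    field_simp
  · simp only [foldT]
    rw [abs_div, abs_of_pos (show (0 : ℝ) < 2 * Real.pi * (d + 1) by positivity),
      div_le_div_iff₀ (by positivity) (by positivity)]
    have h1 : |Real.arcsin ((fourier 1 (θ i) : ℂ).im)| ≤ Real.pi / 2 :=
      abs_le.2 ⟨Real.neg_pi_div_two_le_arcsin _, Real.arcsin_le_pi_div_two _⟩
    have h2 : (0 : ℝ) < d + 1 := by positivity
    nlinarith

lemma foldT_tor {x : Eucl (d + 1)} (hx : ‖x‖ ≤ 1 / (4 * (d + 1))) : foldT (tor x) = x := by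
  ext i
  have hi : |x i| ≤ 1 / (4 * (d + 1)) := (PiLp.norm_apply_le x i).trans hx
  simp only [foldT, tor, fourier_coe_apply]
  have e : (2 * Real.pi * Complex.I * ((1 : ℤ) : ℂ) * (((d + 1 : ℝ) * x i : ℝ) : ℂ) / ((1 : ℝ) : ℂ) : ℂ)
     = ((2 * Real.pi * (d + 1) * x i : ℝ) : ℂ) * Complex.I := by
    push_cast; ring
  rw [e, Complex.exp_ofReal_mul_I_im]
  have h2 : (0 : ℝ) < d + 1 := by positivity
  have h3 : |2 * Real.pi * (d + 1) * x i| ≤ Real.pi / 2 := by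
    rw [abs_mul, abs_of_pos (show (0 : ℝ) < 2 * Real.pi * (d + 1) by positivity)]
    calc 2 * Real.pi * (d + 1) * |x i| ≤ 2 * Real.pi * (d + 1) * (1 / (4 * (d + 1))) := by gcongr
      _ = Real.pi / 2 := by field_simp; ring
  rw [Real.arcsin_sin (abs_le.1 h3).1 (abs_le.1 h3).2]
  field_simp

/-- approximation of initial data by classical solutions -/
lemma PSol_approx {Q : ℝ → Matrix (Fin (d + 1)) (Fin (d + 1)) ℝ} (hQ : Continuous Q) (t0 : ℝ)
    {f : Eucl (d + 1) → ℝ} (hf : ContinuousOn f (closedBall 0 (1 / 4)))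
    (hf1 : ∀ x, ‖x‖ ≤ 1 / 4 → |f x| ≤ 1) {ε : ℝ} (hε : 0 < ε) :
    ∃ U, PSol Q U ∧ (∀ x, |U (x, t0)| ≤ 1 + ε) ∧
      ∀ x, ‖x‖ ≤ 1 / (4 * (d + 1)) → |U (x, t0) - f x| ≤ ε := by
  have hfold : ∀ θ : UnitAddTorus (Fin (d + 1)), foldT θ ∈ closedBall (0 : Eucl (d + 1)) (1 / 4) :=
    fun θ => by simpa using foldT_norm θ
  have hFc : Continuous fun θ : UnitAddTorus (Fin (d + 1)) => ((f (foldT θ) : ℝ) : ℂ) :=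
    Complex.continuous_ofReal.comp (hf.comp_continuous foldT_cont hfold)
  set F : C(UnitAddTorus (Fin (d + 1)), ℂ) := ⟨_, hFc⟩ with hF
  have hmem : F ∈ (Submodule.span ℂ (range (UnitAddTorus.mFourier (d := Fin (d + 1))))).topologicalClosure := by
    rw [UnitAddTorus.span_mFourier_closure_eq_top]; trivial
  obtain ⟨P, hP, hPF⟩ := Metric.mem_closure_iff.1 hmem ε hε
  obtain ⟨U, V, hU, -, hU2, -⟩ := PSol_span hQ t0 hP
  have key : ∀ x, |U (x, t0) - f (foldT (tor x))| ≤ ε := by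
    intro x
    have h1 : ‖(F - P) (tor x)‖ ≤ ‖F - P‖ := (F - P).norm_coe_le_norm _
    have h2 : ‖F - P‖ < ε := by rwa [← dist_eq_norm]
    have h3 := Complex.abs_re_le_norm ((F - P) (tor x))
    have h4 : ((F - P) (tor x)).re = f (foldT (tor x)) - U (x, t0) := by
      simp [hF, hU2]
    rw [h4, abs_sub_comm] at h3
    linarith
  refine ⟨U, hU, fun x => ?_, fun x hx => ?_⟩
  · have h1 := key x
    have h2 := hf1 _ (foldT_norm (tor x))
    rw [abs_le] at *
    constructor <;> linarith
  · have := key x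
    rwa [foldT_tor hx] at this

lemma exists_latt (x : Eucl (d + 1)) : ∃ m, ‖x + latt d m‖ ≤ 1 := by
  refine ⟨fun i => - ⌊(d + 1) * x i⌋, ?_⟩
  have h2 : (0 : ℝ) < d + 1 := by positivity
  refine (norm_le_of_coord (c := 1 / (d + 1)) (by positivity) fun i => ?_).trans (le_of_eq ?_)
  · have e : (x + latt d (fun i => - ⌊(d + 1) * x i⌋)) i = Int.fract ((d + 1) * x i) / (d + 1) := by
      simp only [latt, PiLp.add_apply, Int.fract]
      push_cast
      field_simp
      ring
    rw [e, abs_div, abs_of_pos h2, abs_of_nonneg (Int.fract_nonneg _)]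
    gcongr
    exact (Int.fract_lt_one _).le
  · field_simp

end Fourier

noncomputable section Classical

lemma sdt {f f' : ℝ → ℝ} {c : ℝ} (h1 : ∀ s, HasDerivAt f (f' s) s) (h2 : HasDerivAt f' c 0)
    (hm : IsLocalMax f 0) : c ≤ 0 := by
  by_contra hc
  push Not at hc
  have hd : deriv f = f' := funext fun s => (h1 s).deriv
  have hd0 : f' 0 = 0 := hm.hasDerivAt_eq_zero (h1 0)
  have hmin : IsLocalMin f 0 := by
    refine isLocalMin_of_deriv_deriv_pos ?_ (by rw [hd, hd0]) (h1 0).continuousAt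
    rw [hd, h2.deriv]; exact hc
  have hconst : ∀ᶠ s in 𝓝 (0 : ℝ), f s = f 0 := by
    filter_upwards [hm, hmin] with s a b
    exact le_antisymm a b
  have h3 : f' =ᶠ[𝓝 0] fun _ => 0 := by
    filter_upwards [hconst.eventually_nhds] with s hs
    have : f =ᶠ[𝓝 s] fun _ => f 0 := hs
    have := this.deriv_eq
    rw [hd] at this
    simpa using this
  have := (h2.congr_of_eventuallyEq h3.symm).unique (hasDerivAt_const 0 0)
  linarith

lemma left_deriv {f : ℝ → ℝ} {c t0 t : ℝ} (h : HasDerivAt f c t) (ht : t0 < t)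
    (hm : ∀ s, t0 ≤ s → s ≤ t → f s ≤ f t) : 0 ≤ c := by
  have h1 := hasDerivAt_iff_tendsto_slope.1 h
  have h2 : Tendsto (slope f t) (𝓝[<] t) (𝓝 c) :=
    h1.mono_left (nhdsWithin_mono _ fun s hs => ne_of_lt hs)
  refine ge_of_tendsto h2 ?_
  have : ∀ᶠ s in 𝓝[<] t, t0 < s := nhdsWithin_le_nhds (lt_mem_nhds ht)
  filter_upwards [this, self_mem_nhdsWithin] with s hs1 hs2
  have hs2 : s < t := hs2
  rw [slope_def_field]
  exact div_nonneg_of_nonpos (by linarith [hm s hs1.le hs2.le]) (by linarith)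

section
variable {n : ℕ} {φ φt : SpaceTime n → ℝ} {g : SpaceTime n → Eucl n}
    {H : SpaceTime n → Matrix (Fin n) (Fin n) ℝ}

lemma GT.line (h : GT φ φt g H) (x e : Eucl n) (t s : ℝ) :
    HasDerivAt (fun s : ℝ => φ (x + s • e, t)) (inner ℝ (g (x + s • e, t)) e) s := by
  have h1 : HasDerivAt (fun s : ℝ => x + s • e) e s := by
    simpa using ((hasDerivAt_id s).smul_const e).const_add x
  exact (h.dx (x + s • e) t).comp_hasDerivAt s h1

lemma GT.line2 (h : GT φ φt g H) (x e : Eucl n) (t : ℝ) :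
    HasDerivAt (fun s : ℝ => (inner ℝ (g (x + s • e, t)) e : ℝ)) (inner ℝ e (mL (H (x, t)) e)) 0 := by
  have h1 : HasDerivAt (fun s : ℝ => x + s • e) e 0 := by
    simpa using ((hasDerivAt_id (0 : ℝ)).smul_const e).const_add x
  have h0 : HasFDerivAt (fun y => g (y, t)) (mL (H (x, t))) (x + (0 : ℝ) • e) := by
    simpa using h.dxx x t
  have h2 : HasDerivAt (fun s : ℝ => g (x + s • e, t)) (mL (H (x, t)) e) 0 :=
    HasFDerivAt.comp_hasDerivAt (f := fun s : ℝ => x + s • e) (0 : ℝ) h0 h1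
  have := h2.inner ℝ (hasDerivAt_const (0 : ℝ) e)
  simp only [inner_zero_right, zero_add] at this
  rwa [real_inner_comm] at this
end

variable {d : ℕ}

lemma PSol.max_le {Q : ℝ → Matrix (Fin (d + 1)) (Fin (d + 1)) ℝ} {U : SpaceTime (d + 1) → ℝ}
    (hU : PSol Q U) {L : ℝ} (hL : 0 < L) (hQ : ∀ t, Ell L (Q t)) {t0 m : ℝ}
    (h0 : ∀ x, U (x, t0) ≤ m) : ∀ x t, t0 ≤ t → U (x, t) ≤ m := by
  intro x1 t1 ht1
  by_contra hcon
  push Not at hcon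
  obtain ⟨⟨Ut, g, H, hG, heq⟩, hper⟩ := hU
  obtain ⟨κ, hκ, hκ2⟩ : ∃ κ : ℝ, 0 < κ ∧ m < U (x1, t1) - κ * (t1 - t0) := by
    refine ⟨(U (x1, t1) - m) / (2 * (t1 - t0 + 1)), ?_, ?_⟩
    · apply div_pos <;> linarith
    · have h1 : 0 < t1 - t0 + 1 := by linarith
      have : (U (x1, t1) - m) / (2 * (t1 - t0 + 1)) * (t1 - t0) ≤ (U (x1, t1) - m) / 2 := by
        rw [div_mul_eq_mul_div, div_le_div_iff₀ (by positivity) (by positivity)]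
        nlinarith
      linarith
  have hc := hG.c1
  have hcomp : IsCompact ((closedBall (0 : Eucl (d + 1)) 1) ×ˢ Icc t0 t1) :=
    (isCompact_closedBall _ _).prod isCompact_Icc
  have hcont : Continuous fun p : SpaceTime (d + 1) => U p - κ * (p.2 - t0) := by fun_prop
  obtain ⟨⟨x, t⟩, hp, hmax⟩ := hcomp.exists_isMaxOn ⟨(0, t1), by simp [ht1]⟩ hcont.continuousOn
  have hmax' : ∀ y s, t0 ≤ s → s ≤ t1 → U (y, s) - κ * (s - t0) ≤ U (x, t) - κ * (t - t0) := by
    intro y s hs1 hs2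
    obtain ⟨k, hk⟩ := exists_latt y
    have : U (y + latt d k, s) - κ * (s - t0) ≤ U (x, t) - κ * (t - t0) :=
      hmax (show (y + latt d k, s) ∈ _ from ⟨by simpa using hk, hs1, hs2⟩)
    rwa [hper] at this
  have htl : t0 ≤ t := hp.2.1
  have htu : t ≤ t1 := hp.2.2
  have ht : t0 < t := by
    rcases htl.eq_or_lt with h | h
    · exfalso
      have := hmax' x1 t1 ht1 le_rfl
      have h2 := h0 x
      rw [h] at h2
      nlinarith
    · exact h
  have hq : ∀ e : Eucl (d + 1), inner ℝ e (mL (H (x, t)) e) ≤ 0 := by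
    intro e
    refine sdt (fun s => hG.line x e t s) (hG.line2 x e t) (Eventually.of_forall fun s => ?_)
    have := hmax' (x + s • e) t htl htu
    simp only [zero_smul, add_zero]
    linarith
  have h1 := (hQ t).nonpos hL (hG.sy (x, t)) hq
  have h2 : HasDerivAt (fun s => U (x, s) - κ * (s - t0)) (Ut (x, t) - κ) t := by
    have := (hG.dt x t).sub (((hasDerivAt_id t).sub_const t0).const_mul κ)
    exact this.congr_deriv (by ring)
  have h3 := left_deriv h2 ht (fun s hs1 hs2 => hmax' x s hs1 (hs2.trans htu))
  have h4 := heq (x, t)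
  simp only at h4
  linarith

lemma PSol.two_point {Q : ℝ → Matrix (Fin (d + 1)) (Fin (d + 1)) ℝ} {U : SpaceTime (d + 1) → ℝ}
    (hU : PSol Q U) {L : ℝ} (hL : 1 ≤ L) (hQ : ∀ t, Ell L (Q t)) {t0 m s : ℝ} (hm : 0 < m)
    (hs : 0 < s) (hb : ∀ x t, t0 ≤ t → |U (x, t)| ≤ m) (x y : Eucl (d + 1)) :
    U (x, t0 + s ^ 2) - U (y, t0 + s ^ 2) ≤ 4 * m * L / s * ‖x - y‖ := by
  obtain ⟨s1, hs1⟩ : ∃ s1, s1 = 2 * s / L := ⟨_, rfl⟩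
  have hL0 : 0 < L := by linarith
  have hs1p : 0 < s1 := by rw [hs1]; positivity
  obtain ⟨C, hC⟩ : ∃ C, C = 8 * m / s1 := ⟨_, rfl⟩
  have hC' : C = 4 * m * L / s := by rw [hC, hs1]; field_simp; ring
  have hCs : C * s1 = 8 * m := by rw [hC]; field_simp
  have hCp : 0 < C := by rw [hC]; positivity
  rw [← hC']
  have hδ : 0 < s ^ 2 := by positivity
  obtain ⟨κ, hκ⟩ : ∃ κ, κ = 2 * m / s ^ 2 := ⟨_, rfl⟩
  have hκδ : κ * s ^ 2 = 2 * m := by rw [hκ]; field_simp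
  have hκp : 0 < κ := by rw [hκ]; positivity
  have hκ4 : κ < L⁻¹ * (4 * (C / s1)) := by
    rw [hκ, hC, hs1]
    have : L⁻¹ * (4 * (8 * m / (2 * s / L) / (2 * s / L))) = (8 * L * m) / s ^ 2 := by
      field_simp; ring
    rw [this]
    gcongr ?_ / _
    nlinarith
  by_cases hxy : s1 < ‖x - y‖
  · have h1 := abs_le.1 (hb x (t0 + s ^ 2) (by linarith))
    have h2 := abs_le.1 (hb y (t0 + s ^ 2) (by linarith))
    nlinarith
  push Not at hxy
  obtain ⟨φ, hφ⟩ : ∃ φ : ℝ → ℝ, φ = fun r => C * (r - r ^ 2 / (2 * s1)) := ⟨_, rfl⟩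
  have hφle : ∀ r, φ r ≤ C * r := by
    intro r
    rw [hφ]
    have : 0 ≤ r ^ 2 / (2 * s1) := by positivity
    simp only
    nlinarith
  suffices hmain : ∀ x y t, ‖x - y‖ ≤ s1 → t0 ≤ t → t ≤ t0 + s ^ 2 →
      U (x, t) - U (y, t) - φ ‖x - y‖ - 2 * m + κ * (t - t0) ≤ 0 by
    have h1 := hmain x y (t0 + s ^ 2) hxy (by linarith) le_rfl
    have h2 := hφle ‖x - y‖
    have h3 : κ * (t0 + s ^ 2 - t0) = 2 * m := by rw [← hκδ]; ring
    linarith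
  by_contra hcon
  push Not at hcon
  obtain ⟨xa, ya, ta, hxa, hta, hta2, hpos⟩ := hcon
  obtain ⟨⟨Ut, g, H, hG, heq⟩, hper⟩ := hU
  have hUc := hG.c1
  have hφc : Continuous φ := by rw [hφ]; fun_prop
  let G : Eucl (d + 1) × (Eucl (d + 1) × ℝ) → ℝ := fun q =>
    U (q.1, q.2.2) - U (q.2.1, q.2.2) - φ ‖q.1 - q.2.1‖ - 2 * m + κ * (q.2.2 - t0)
  have hGc : Continuous G := by fun_prop
  have hcomp : IsCompact ((closedBall (0 : Eucl (d + 1)) 1 ×ˢ (closedBall (0 : Eucl (d + 1)) (1 + s1)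
      ×ˢ Icc t0 (t0 + s ^ 2))) ∩ {q | ‖q.1 - q.2.1‖ ≤ s1}) := by
    refine ((isCompact_closedBall _ _).prod ((isCompact_closedBall _ _).prod
      isCompact_Icc)).inter_right (isClosed_le (by fun_prop) continuous_const)
  have hshift : ∀ x y t, ‖x - y‖ ≤ s1 → t0 ≤ t → t ≤ t0 + s ^ 2 → ∃ q ∈
      ((closedBall (0 : Eucl (d + 1)) 1 ×ˢ (closedBall (0 : Eucl (d + 1)) (1 + s1)
      ×ˢ Icc t0 (t0 + s ^ 2))) ∩ {q | ‖q.1 - q.2.1‖ ≤ s1}), G q = G (x, (y, t)) := by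
    intro x y t h1 h2 h3
    obtain ⟨k, hk⟩ := exists_latt x
    refine ⟨(x + latt d k, (y + latt d k, t)), ⟨⟨by simpa using hk, ?_, h2, h3⟩, ?_⟩, ?_⟩
    · simp only [mem_closedBall, dist_zero_right]
      have e : y + latt d k = (x + latt d k) - (x - y) := by abel
      rw [e]
      exact (norm_sub_le _ _).trans (by linarith)
    · simpa using h1
    · simp only [G, hper, add_sub_add_right_eq_sub]
  obtain ⟨qa, hqa, hqa2⟩ := hshift xa ya ta hxa hta hta2
  obtain ⟨⟨x, y, t⟩, hp, hmax⟩ := hcomp.exists_isMaxOn ⟨qa, hqa⟩ hGc.continuousOn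
  have hmax' : ∀ x' y' t', ‖x' - y'‖ ≤ s1 → t0 ≤ t' → t' ≤ t0 + s ^ 2 →
      G (x', (y', t')) ≤ G (x, (y, t)) := by
    intro x' y' t' h1 h2 h3
    obtain ⟨q, hq, hq2⟩ := hshift x' y' t' h1 h2 h3
    rw [← hq2]
    exact hmax hq
  have hGpos : 0 < G (x, (y, t)) := lt_of_lt_of_le hpos (hmax' xa ya ta hxa hta hta2)
  have hxy1 : ‖x - y‖ ≤ s1 := hp.2
  have htl : t0 ≤ t := hp.1.2.2.1
  have htu : t ≤ t0 + s ^ 2 := hp.1.2.2.2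
  have hbx := abs_le.1 (hb x t htl)
  have hby := abs_le.1 (hb y t htl)
  have hφ0 : ∀ r, 0 ≤ r → r ≤ s1 → 0 ≤ φ r := by
    intro r h1 h2
    rw [hφ]
    refine mul_nonneg hCp.le ?_
    rw [sub_nonneg, div_le_iff₀ (by positivity)]
    nlinarith
  have hκt : κ * (t - t0) ≤ 2 * m := by
    rw [← hκδ]; exact mul_le_mul_of_nonneg_left (by linarith) hκp.le
  have hGdef : G (x, (y, t)) = U (x, t) - U (y, t) - φ ‖x - y‖ - 2 * m + κ * (t - t0) := rfl
  have htt : t0 < t := by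
    rcases htl.eq_or_lt with h | h
    · exfalso
      have h1 := hφ0 _ (norm_nonneg (x - y)) hxy1
      rw [hGdef, ← h] at hGpos
      rw [← h] at hbx hby
      linarith [hbx.1, hbx.2, hby.1, hby.2]
    · exact h
  have hρ1 : ‖x - y‖ < s1 := by
    rcases hxy1.lt_or_eq with h | h
    · exact h
    · exfalso
      have : φ s1 = 4 * m := by
        rw [hφ]; simp only
        have : s1 - s1 ^ 2 / (2 * s1) = s1 / 2 := by field_simp; ring
        rw [this]; linarith
      rw [hGdef, h, this] at hGpos
      linarith
  have hρ0 : 0 < ‖x - y‖ := by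
    rcases (norm_nonneg (x - y)).eq_or_lt with h | h
    · exfalso
      have hxy0 : x = y := by rw [← sub_eq_zero]; exact norm_eq_zero.1 h.symm
      have h1 := hφ0 0 le_rfl hs1p.le
      rw [hGdef, ← h, hxy0] at hGpos
      linarith
    · exact h
  -- the second order conditions
  have hmL : ∀ e, mL (H (x, t) - H (y, t)) e = mL (H (x, t)) e - mL (H (y, t)) e := by
    intro e
    simp [mL, map_sub]
  have hq : ∀ e : Eucl (d + 1), inner ℝ e (mL (H (x, t) - H (y, t)) e) ≤ 0 := by
    intro e
    rw [hmL, inner_sub_right]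
    refine sdt (fun r => (hG.line x e t r).sub (hG.line y e t r))
      ((hG.line2 x e t).sub (hG.line2 y e t)) (Eventually.of_forall fun r => ?_)
    have h1 := hmax' (x + r • e) (y + r • e) t (by simpa using hxy1) htl htu
    simp only [G, add_sub_add_right_eq_sub] at h1
    simp only [Pi.sub_apply, zero_smul, add_zero]
    linarith
  set e : Eucl (d + 1) := ‖x - y‖⁻¹ • (x - y) with he
  have hen : ‖e‖ = 1 := by
    rw [he, norm_smul, norm_inv, norm_norm]; field_simp
  have hxe : x - y = ‖x - y‖ • e := by
    rw [he, smul_smul, mul_inv_cancel₀ hρ0.ne', one_smul]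
  have hφd : ∀ r, HasDerivAt (fun r => φ (‖x - y‖ + 2 * r)) (2 * (C * (1 - (‖x - y‖ + 2 * r) / s1))) r := by
    intro r
    have h1 : HasDerivAt (fun r : ℝ => ‖x - y‖ + 2 * r) 2 r := by
      simpa using ((hasDerivAt_id r).const_mul 2).const_add ‖x - y‖
    have h2 := ((h1.sub ((h1.pow 2).div_const (2 * s1))).const_mul C)
    rw [hφ]
    refine h2.congr_deriv ?_
    field_simp
    ring
  have hφdd : HasDerivAt (fun r => 2 * (C * (1 - (‖x - y‖ + 2 * r) / s1))) (- (4 * (C / s1))) 0 := by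
    have h1 : HasDerivAt (fun r : ℝ => ‖x - y‖ + 2 * r) 2 0 := by
      simpa using ((hasDerivAt_id (0 : ℝ)).const_mul 2).const_add ‖x - y‖
    have h2 := (((h1.div_const s1).const_sub 1).const_mul C).const_mul 2
    refine h2.congr_deriv ?_
    ring
  have hee : inner ℝ e (mL (H (x, t) - H (y, t)) e) ≤ - (4 * (C / s1)) := by
    rw [hmL, inner_sub_right]
    have hl := hG.line2 y (-e) t
    simp only [map_neg, inner_neg_left, inner_neg_right, neg_neg] at hl
    have := sdt (fun r => ((hG.line x e t r).sub (hG.line y (-e) t r)).sub (hφd r))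
      ((((hG.line2 x e t).sub (hG.line2 y (-e) t))).sub hφdd) ?_
    · simp only [map_neg, inner_neg_left, inner_neg_right, neg_neg] at this
      linarith
    · have e1 : ∀ᶠ r : ℝ in 𝓝 0, 0 < ‖x - y‖ + 2 * r := by
        have : ContinuousAt (fun r : ℝ => ‖x - y‖ + 2 * r) 0 := by fun_prop
        exact continuousAt_const.eventually_lt this (by simpa using hρ0)
      have e2 : ∀ᶠ r : ℝ in 𝓝 0, ‖x - y‖ + 2 * r < s1 := by
        have : ContinuousAt (fun r : ℝ => ‖x - y‖ + 2 * r) 0 := by fun_prop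
        exact this.eventually_lt continuousAt_const (by simpa using hρ1)
      filter_upwards [e1, e2] with r hr1 hr2
      have hn : ‖(x + r • e) - (y + r • (-e))‖ = ‖x - y‖ + 2 * r := by
        have : (x + r • e) - (y + r • (-e)) = (‖x - y‖ + 2 * r) • e := by
          rw [add_smul, ← hxe, two_mul, add_smul, smul_neg]; abel
        rw [this, norm_smul, hen, mul_one, Real.norm_of_nonneg hr1.le]
      have h1 := hmax' (x + r • e) (y + r • (-e)) t (by rw [hn]; exact hr2.le) htl htu
      simp only [G, hn] at h1
      simp only [Pi.sub_apply, zero_smul, add_zero, mul_zero]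
      linarith
  have hsy : (H (x, t) - H (y, t)).IsSymm := (hG.sy _).sub (hG.sy _)
  have h1 := (hQ t).neg_bound hL0 hsy hq hen
  have h2 : HasDerivAt (fun r => U (x, r) - U (y, r) - φ ‖x - y‖ - 2 * m + κ * (r - t0))
      (Ut (x, t) - Ut (y, t) + κ) t := by
    have := ((((hG.dt x t).sub (hG.dt y t)).sub_const (φ ‖x - y‖)).sub_const (2 * m)).add
      (((hasDerivAt_id t).sub_const t0).const_mul κ)
    exact this.congr_deriv (by ring)
  have h3 := left_deriv h2 htt (fun r hr1 hr2 => hmax' x y r hxy1 hr1 (hr2.trans htu))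
  have h4 := heq (x, t)
  have h5 := heq (y, t)
  simp only at h4 h5
  rw [Matrix.mul_sub, Matrix.trace_sub] at h1
  have h6 : L⁻¹ * inner ℝ e (mL (H (x, t) - H (y, t)) e) ≤ L⁻¹ * (- (4 * (C / s1))) :=
    mul_le_mul_of_nonneg_left hee (by positivity)
  linarith

end Classical

noncomputable section Interior

variable {d : ℕ}

lemma mem_UU_int {b : ℝ} (hb : b ≤ -1) {x : Eucl (d + 1)} {t : ℝ} (hx : ‖x‖ < 1) (h1 : -1 < t)
    (h2 : t ≤ 0) : (x, t) ∈ UU d b := by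
  have := abs_le.1 (abs_lastC_le x)
  exact ⟨hx, by simp only; linarith, h1, h2⟩

/-- comparison with a single barrier, interior case -/
lemma VS.comp_int {b : ℝ} (hb : b ≤ -1) {Q : ℝ → Matrix (Fin (d + 1)) (Fin (d + 1)) ℝ}
    {v : ℝ → Eucl (d + 1)} {u : SpaceTime (d + 1) → ℝ} (hu : VS b 1 Q v u)
    {r t0 t1 : ℝ} (hr : r < 1) (h0 : -1 < t0) (h1 : t1 ≤ 0)
    {φ φt : SpaceTime (d + 1) → ℝ} {g : SpaceTime (d + 1) → Eucl (d + 1)}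
    {H : SpaceTime (d + 1) → Matrix (Fin (d + 1)) (Fin (d + 1)) ℝ} (hG : GT φ φt g H)
    (hinit : ∀ x, ‖x‖ ≤ r → φ (x, t0) ≤ u (x, t0))
    (hbd : ∀ x t, ‖x‖ = r → t0 < t → t ≤ t1 → φ (x, t) ≤ u (x, t))
    (heq : ∀ x t, ‖x‖ ≤ r → t0 < t → t ≤ t1 → φt (x, t) < (Q t * H (x, t)).trace) :
    ∀ x t, ‖x‖ ≤ r → t0 ≤ t → t ≤ t1 → φ (x, t) ≤ u (x, t) := by
  intro x t hx ht ht2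
  have hlast : ∀ x : Eucl (d + 1), ‖x‖ ≤ r → b < lastC x := by
    intro x hx
    have := abs_le.1 (abs_lastC_le x)
    linarith
  refine hu.comparison (Y := {0}) hr h0 h1 isCompact_singleton (φ := fun _ => φ) (φt := fun _ => φt)
    (g := fun _ => g) (H := fun _ => H) (fun _ _ => hG) (hG.c1.comp continuous_snd)
    (fun _ _ x hx _ => hinit x hx) ?_ 0 rfl x t hx (hlast x hx).le ht ht2
  intro y _ x t hx hbx ht1 ht2 hlt _
  refine ⟨lt_of_le_of_ne hx fun h => ?_, fun _ => ?_, fun h => ?_⟩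
  · exact absurd (hbd x t h ht1 ht2) (not_le.2 hlt)
  · rw [one_mul]; exact heq x t hx ht1 ht2
  · exact absurd h (hlast x hx).ne'

lemma IL_one {L : ℝ} (hL : 1 ≤ L) {b : ℝ} (hb : b ≤ -1)
    {Q : ℝ → Matrix (Fin (d + 1)) (Fin (d + 1)) ℝ} (hE : ∀ t, Ell L (Q t))
    {v : ℝ → Eucl (d + 1)} {u U : SpaceTime (d + 1) → ℝ} (hu : VS b 1 Q v u)
    (hu1 : ∀ p ∈ UU d b, -1 ≤ u p) (hU : PSol Q U) {t0 ε r N : ℝ} (h0 : -1 < t0) (h00 : t0 ≤ 0)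
    (hε : 0 < ε) (hr : 0 < r) (hr1 : r < 1) (hN : N = 6 * L * (d + 1) / r ^ 2 + 1)
    (hUb : ∀ x t, t0 ≤ t → U (x, t) ≤ 1 + ε)
    (hUu : ∀ x, ‖x‖ ≤ r → U (x, t0) - u (x, t0) ≤ ε) (x : Eucl (d + 1)) (hx : ‖x‖ ≤ r) :
    U (x, 0) - ε - 3 / r ^ 2 * ‖x‖ ^ 2 - N * (- t0) ≤ u (x, 0) := by
  obtain ⟨⟨Ut, g, H, hG, heq⟩, -⟩ := hU
  have hG2 := (hG.add ((GT.quad (0 : Eucl (d + 1))).smul (- (3 / r ^ 2)))).add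
    (GT.time (n := d + 1) (a := fun t => - ε - N * (t - t0)) (a' := fun _ => - N)
    (fun t => (((hasDerivAt_id t).sub_const t0).const_mul N).const_sub (-ε) |>.congr_deriv
      (by simp)) continuous_const)
  have hNp : 0 < N := by rw [hN]; positivity
  have key := hu.comp_int hb hr1 h0 le_rfl hG2 ?_ ?_ ?_ x 0 hx h00 le_rfl
  · simp only [sub_zero] at key
    have e : N * (0 - t0) = N * (- t0) := by ring
    rw [e] at key
    linarith
  · intro x hx
    have h1 := hUu x hx
    have h2 : 0 ≤ 3 / r ^ 2 * ‖x‖ ^ 2 := by positivity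
    simp only [sub_zero, sub_self, mul_zero]
    linarith
  · intro x t hx ht ht2
    have h1 := hUb x t ht.le
    have h2 : 3 / r ^ 2 * ‖x‖ ^ 2 = 3 := by rw [hx]; field_simp
    have h3 := hu1 (x, t) (mem_UU_int hb (by linarith) (by linarith) ht2)
    have h4 : 0 ≤ N * (t - t0) := mul_nonneg hNp.le (by linarith)
    simp only [sub_zero]
    linarith
  · intro x t hx ht ht2
    have h1 := heq (x, t)
    simp only at h1
    simp only [Matrix.mul_add, Matrix.mul_smul, Matrix.mul_one, Matrix.trace_add, Matrix.trace_smul,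
      smul_eq_mul, mul_zero, add_zero, Matrix.trace_zero, h1]
    have h2 := (hE t).tr_upper
    push_cast at h2
    have h3 : 3 / r ^ 2 * (2 * (Q t).trace) ≤ 3 / r ^ 2 * (2 * (L * (d + 1))) := by gcongr
    have h4 : 3 / r ^ 2 * (2 * (L * (d + 1))) = N - 1 := by rw [hN]; ring
    linarith

lemma IL_space (d : ℕ) (L : ℝ) (hL : 1 ≤ L) : ∃ C1 : ℝ, 0 < C1 ∧ ∀ b : ℝ, b ≤ -1 →
    ∀ (Q : ℝ → Matrix (Fin (d + 1)) (Fin (d + 1)) ℝ), Continuous Q → (∀ t, Ell L (Q t)) →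
    ∀ (v : ℝ → Eucl (d + 1)) (u : SpaceTime (d + 1) → ℝ), VS b 1 Q v u →
    VS b 1 Q v (fun p => - u p) → (∀ p ∈ UU d b, |u p| ≤ 1) →
    ∀ s, 0 < s → s ≤ 1 / 2 → ∀ x, ‖x‖ ≤ s ^ 3 → |u (x, 0) - u (0, 0)| ≤ C1 * s ^ 2 := by
  obtain ⟨r, hr⟩ : ∃ r : ℝ, r = 1 / (4 * (d + 1)) := ⟨_, rfl⟩
  have hrp : 0 < r := by rw [hr]; positivity
  have hr14 : r ≤ 1 / 4 := by
    rw [hr, div_le_div_iff₀ (by positivity) (by positivity)]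
    have : (0 : ℝ) ≤ d := by positivity
    linarith
  obtain ⟨N, hN⟩ : ∃ N : ℝ, N = 6 * L * (d + 1) / r ^ 2 + 1 := ⟨_, rfl⟩
  have hNp : 0 < N := by rw [hN]; positivity
  refine ⟨2 / r + (2 + 3 / r ^ 2 + 2 * N + 8 * L), by positivity, ?_⟩
  intro b hb Q hQ hE v u hu hu' hu1 s hs hs2 x hx
  have hs22 : s ^ 2 ≤ 1 / 4 := by nlinarith
  have hsp : 0 < s ^ 2 := by positivity
  by_cases hxr : r < ‖x‖
  · have h3 : s ^ 3 ≤ s ^ 2 := pow_le_pow_of_le_one hs.le (by linarith) (by norm_num)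
    have hs3 : s ^ 3 < 1 := by nlinarith
    have h1 := abs_le.1 (hu1 (x, 0) (mem_UU_int hb (by linarith) (by norm_num) le_rfl))
    have h2 := abs_le.1 (hu1 (0, 0) (mem_UU_int hb (by simp) (by norm_num) le_rfl))
    have h4 : 2 ≤ 2 / r * s ^ 2 := by
      rw [div_mul_eq_mul_div, le_div_iff₀ hrp]; linarith
    have h5 : 0 ≤ (2 + 3 / r ^ 2 + 2 * N + 8 * L) * s ^ 2 := by positivity
    rw [abs_le]
    constructor <;> nlinarith
  push Not at hxr
  have hf1 : ContinuousOn (fun x => u (x, - s ^ 2)) (closedBall 0 (1 / 4)) := by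
    refine hu.1.comp (f := fun x : Eucl (d + 1) => (x, - s ^ 2)) (by fun_prop) fun x hx => ?_
    have : ‖x‖ ≤ 1 / 4 := by simpa using hx
    exact mem_UU_int hb (by linarith) (by linarith) (by linarith)
  have hf2 : ∀ x : Eucl (d + 1), ‖x‖ ≤ 1 / 4 → |u (x, - s ^ 2)| ≤ 1 := by
    intro x hx
    exact hu1 _ (mem_UU_int hb (by linarith) (by linarith) (by linarith))
  obtain ⟨U, hU, hU1, hU2⟩ := PSol_approx hQ (- s ^ 2) hf1 hf2 hsp
  · rw [← hr] at hU2
    have hL0 : 0 < L := by linarith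
    have hm1 := hU.max_le hL0 hE (fun x => (abs_le.1 (hU1 x)).2)
    have hm2 := hU.neg.max_le hL0 hE (t0 := - s ^ 2) (m := 1 + s ^ 2)
      (fun x => by linarith [(abs_le.1 (hU1 x)).1])
    have a1 : ∀ x, ‖x‖ ≤ r → _ := fun x hx =>
      IL_one (t0 := - s ^ 2) (ε := s ^ 2) hL hb hE hu (fun p hp => (abs_le.1 (hu1 p hp)).1) hU
      (by linarith) (by linarith) hsp hrp (by linarith) hN hm1
      (fun x hx => (abs_le.1 (hU2 x hx)).2) x hx
    have a2 : ∀ x, ‖x‖ ≤ r → _ := fun x hx =>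
      IL_one (t0 := - s ^ 2) (ε := s ^ 2) hL hb hE hu' (fun p hp => by linarith [(abs_le.1 (hu1 p hp)).2])
      hU.neg
      (by linarith) (by linarith) hsp hrp (by linarith) hN hm2
      (fun x hx => by linarith [(abs_le.1 (hU2 x hx)).1]) x hx
    have hbd : ∀ x t, - s ^ 2 ≤ t → |U (x, t)| ≤ 1 + s ^ 2 := by
      intro x t ht
      rw [abs_le]
      exact ⟨by linarith [hm2 x t ht], hm1 x t ht⟩
    have c1 := hU.two_point hL hE (by positivity) hs hbd x 0
    have c2 := hU.two_point hL hE (by positivity) hs hbd 0 x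
    rw [neg_add_cancel] at c1 c2
    rw [norm_sub_rev] at c2
    rw [sub_zero] at c1 c2
    have c3 : 4 * (1 + s ^ 2) * L / s * ‖x‖ ≤ 8 * L * s ^ 2 := by
      rw [div_mul_eq_mul_div, div_le_iff₀ hs]
      have : 4 * (1 + s ^ 2) * L * ‖x‖ ≤ 4 * 2 * L * s ^ 3 := by
        gcongr
        linarith
      nlinarith
    have c4 : 3 / r ^ 2 * ‖x‖ ^ 2 ≤ 3 / r ^ 2 * s ^ 2 := by
      have : ‖x‖ ≤ s := hx.trans (by
        have := pow_le_pow_of_le_one hs.le (by linarith : s ≤ 1) (show 1 ≤ 3 by norm_num)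
        simpa using this)
      gcongr
    have b1 := a1 x hxr
    have b2 := a2 x hxr
    have b3 := a1 0 (by simpa using hrp.le)
    have b4 := a2 0 (by simpa using hrp.le)
    simp only [norm_zero, neg_neg, ne_eq, OfNat.ofNat_ne_zero, not_false_eq_true, zero_pow, mul_zero] at b1 b2 b3 b4
    have h6 : 0 ≤ 2 / r * s ^ 2 := by positivity
    rw [abs_le]
    constructor <;> nlinarith

lemma IL_time_one {L : ℝ} (hL : 1 ≤ L) {b : ℝ} (hb : b ≤ -1)
    {Q : ℝ → Matrix (Fin (d + 1)) (Fin (d + 1)) ℝ} (hE : ∀ t, Ell L (Q t))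
    {v : ℝ → Eucl (d + 1)} {u : SpaceTime (d + 1) → ℝ} (hu : VS b 1 Q v u)
    (hu1 : ∀ p ∈ UU d b, |u p| ≤ 1) {t1 s C1 : ℝ} (h0 : - s ^ 8 ≤ t1) (h00 : t1 ≤ 0)
    (hs : 0 < s) (hs2 : s ≤ 1 / 2) (hC1 : 0 < C1)
    (hsp : ∀ x, ‖x‖ ≤ s ^ 3 / 2 → u (0, t1) - C1 * s ^ 2 ≤ u (x, t1)) :
    u (0, t1) - (C1 + 8 * (2 * L * (d + 1) + 1)) * s ^ 2 ≤ u (0, 0) := by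
  obtain ⟨N, hN⟩ : ∃ N : ℝ, N = 2 * L * (d + 1) + 1 := ⟨_, rfl⟩
  obtain ⟨A, hA⟩ : ∃ A : ℝ, A = 8 / s ^ 6 := ⟨_, rfl⟩
  have hAp : 0 < A := by rw [hA]; positivity
  have hNp : 0 < N := by rw [hN]; positivity
  have hG2 := (((GT.quad (0 : Eucl (d + 1))).smul (- A))).add
    (GT.time (n := d + 1) (a := fun t => u (0, t1) - C1 * s ^ 2 - A * N * (t - t1))
    (a' := fun _ => - (A * N))
    (fun t => (((hasDerivAt_id t).sub_const t1).const_mul (A * N)).const_sub _ |>.congr_deriv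
      (by simp)) continuous_const)
  have hs8 : s ^ 8 ≤ 1 / 256 := by
    calc s ^ 8 ≤ (1 / 2) ^ 8 := by gcongr
      _ = 1 / 256 := by norm_num
  have hs6 : s ^ 6 ≤ 1 / 64 := by
    calc s ^ 6 ≤ (1 / 2) ^ 6 := by gcongr
      _ = 1 / 64 := by norm_num
  have hA6 : A * s ^ 6 = 8 := by rw [hA]; field_simp
  have hu0 := abs_le.1 (hu1 (0, t1) (mem_UU_int hb (by simp) (by linarith) h00))
  have hC1s : 0 < C1 * s ^ 2 := by positivity
  have key := hu.comp_int hb (r := 1 / 2) (by norm_num) (t0 := t1) (by linarith) le_rfl hG2 ?_ ?_ ?_ 0 0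
    (by simp) h00 le_rfl
  · simp only [sub_zero, norm_zero, ne_eq, OfNat.ofNat_ne_zero, not_false_eq_true, zero_pow, mul_zero] at key
    have e : A * N * (0 - t1) ≤ 8 * N * s ^ 2 := by
      calc A * N * (0 - t1) ≤ A * N * s ^ 8 := by gcongr; linarith
        _ = (A * s ^ 6) * N * s ^ 2 := by ring
        _ = 8 * N * s ^ 2 := by rw [hA6]
    rw [hN] at e key
    nlinarith
  · intro x hx
    simp only [sub_zero, sub_self, mul_zero]
    by_cases hxs : ‖x‖ ≤ s ^ 3 / 2
    · have h1 := hsp x hxs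
      have h2 : 0 ≤ A * ‖x‖ ^ 2 := by positivity
      linarith
    · push Not at hxs
      have h3 := abs_le.1 (hu1 (x, t1) (mem_UU_int hb (by linarith) (by linarith) h00))
      have h4 : A * (s ^ 3 / 2) ^ 2 ≤ A * ‖x‖ ^ 2 := by gcongr
      have h5 : A * (s ^ 3 / 2) ^ 2 = 2 := by
        have : A * (s ^ 3 / 2) ^ 2 = A * s ^ 6 / 4 := by ring
        rw [this, hA6]; norm_num
      linarith
  · intro x t hx ht ht2
    have h3 := abs_le.1 (hu1 (x, t) (mem_UU_int hb (by linarith) (by linarith) ht2))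
    have h4 : 0 ≤ A * N * (t - t1) := mul_nonneg (by positivity) (by linarith)
    have h5 : 8 * 64 ≤ A := by nlinarith
    simp only [sub_zero, hx]
    linarith
  · intro x t hx ht ht2
    simp only [Matrix.mul_add, Matrix.mul_smul, Matrix.mul_one, Matrix.trace_add, Matrix.trace_smul,
      smul_eq_mul, mul_zero, add_zero, Matrix.trace_zero]
    have h2 := (hE t).tr_upper
    push_cast at h2
    have h3 : A * (2 * (Q t).trace) ≤ A * (2 * (L * (d + 1))) := by gcongr
    have h4 : A * (2 * (L * (d + 1))) = A * N - A := by rw [hN]; ring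
    linarith

lemma interior_est (d : ℕ) (L : ℝ) (hL : 1 ≤ L) : ∃ C : ℝ, 0 < C ∧ ∀ b : ℝ, b ≤ -1 →
    ∀ (Q : ℝ → Matrix (Fin (d + 1)) (Fin (d + 1)) ℝ), Continuous Q → (∀ t, Ell L (Q t)) →
    ∀ (v : ℝ → Eucl (d + 1)) (u : SpaceTime (d + 1) → ℝ), VS b 1 Q v u →
    VS b 1 Q v (fun p => - u p) → (∀ p ∈ UU d b, |u p| ≤ 1) →
    ∀ s, 0 < s → s ≤ 1 / 2 → ∀ x t, ‖x‖ ≤ s ^ 4 → - s ^ 8 ≤ t → t ≤ 0 →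
      |u (x, t) - u (0, 0)| ≤ C * s ^ 2 := by
  obtain ⟨C1, hC1, hsp⟩ := IL_space d L hL
  refine ⟨2 * C1 + 8 * (2 * L * (d + 1) + 1), by positivity, ?_⟩
  intro b hb Q hQ hE v u hu hu' hu1 s hs hs2 x t hx ht ht0
  have hs8 : s ^ 8 ≤ 1 / 256 := by
    calc s ^ 8 ≤ (1 / 2) ^ 8 := by gcongr
      _ = 1 / 256 := by norm_num
  have hUU : ∀ p ∈ UU d (2 * b), ((1 / 2 : ℝ) • p.1 + (0 : Eucl (d + 1)), 1 / 4 * p.2 + t) ∈ UU d b := by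
    intro p hp
    refine mem_UU_int hb ?_ ?_ ?_
    · rw [add_zero, norm_smul]; norm_num
      linarith [hp.1]
    · linarith [hp.2.2.1]
    · linarith [hp.2.2.2]
  have hb2 : 1 / 2 * (2 * b) + lastC (0 : Eucl (d + 1)) = b := by simp [lastC]
  have e0 : (1 : ℝ) * (1 / 2) ^ 2 / (1 / 4) = 1 := by norm_num
  have t1 := hu.transfer (b' := 2 * b) (R := 1 / 2) (μ := 1 / 4) (c := 1) (by norm_num) (by norm_num)
    (by norm_num) 0 0 t hb2 hUU
  have t2 := hu'.transfer (b' := 2 * b) (R := 1 / 2) (μ := 1 / 4) (c := 1) (by norm_num) (by norm_num)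
    (by norm_num) 0 0 t hb2 hUU
  rw [e0] at t1 t2
  simp only [add_zero, one_mul] at t1 t2
  have key : ∀ x, ‖x‖ ≤ s ^ 3 / 2 → |u (x, t) - u (0, t)| ≤ C1 * s ^ 2 := by
    intro x hx
    have := hsp (2 * b) (by linarith) _ (hQ.comp (by fun_prop)) (fun τ => hE _) _ _ t1 t2
      (fun p hp => by simpa using hu1 _ (hUU p hp)) s hs hs2 ((2 : ℝ) • x) (by
        rw [norm_smul]; norm_num; linarith)
    simpa [smul_smul] using this
  have k1 := IL_time_one hL hb hE hu hu1 ht ht0 hs hs2 hC1 (fun x hx => by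
    linarith [(abs_le.1 (key x hx)).1])
  have k2 := IL_time_one hL hb hE hu' (fun p hp => by simpa using hu1 p hp) ht ht0 hs hs2 hC1
    (fun x hx => by linarith [(abs_le.1 (key x hx)).2])
  have hx3 : ‖x‖ ≤ s ^ 3 / 2 := hx.trans (by
    have : s ^ 4 = s ^ 3 * s := by ring
    have h3 : 0 < s ^ 3 := by positivity
    nlinarith)
  have k3 := abs_le.1 (key x hx3)
  rw [abs_le]
  constructor <;> nlinarith [k3.1, k3.2]

end Interior

noncomputable section Boundary

variable {d : ℕ}

/-- interior bump -/
def hB (K N β θ a t0 lam : ℝ) (z : Eucl (d + 1)) (p : SpaceTime (d + 1)) : ℝ :=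
  a * Real.exp (-N * ((p.2 - t0) / lam)) *
    (Real.exp (-K * (‖p.1 - z‖ ^ 2 - β * ((p.2 - t0) / lam))) - θ)

lemma hB_cont (K N β θ a t0 lam : ℝ) (e : Eucl (d + 1)) :
    Continuous fun q : Eucl (d + 1) × SpaceTime (d + 1) => hB K N β θ a t0 lam (e + q.1) q.2 := by
  unfold hB
  fun_prop

lemma exp_lin_deriv (c t0 lam t : ℝ) : HasDerivAt (fun t => Real.exp (c * ((t - t0) / lam)))
    (c / lam * Real.exp (c * ((t - t0) / lam))) t := by
  have h1 : HasDerivAt (fun t => c * ((t - t0) / lam)) (c / lam) t := by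
    have := (((hasDerivAt_id t).sub_const t0).div_const lam).const_mul c
    exact this.congr_deriv (by simp; ring)
  exact h1.exp.congr_deriv (by ring)

lemma hB_GT {K N β θ a t0 lam L : ℝ} (hlam : 0 < lam) (hL : 0 < L) (hK : 0 < K) (ha : 0 < a)
    (z : Eucl (d + 1)) :
    ∃ (ht : SpaceTime (d + 1) → ℝ) (g : SpaceTime (d + 1) → Eucl (d + 1))
      (H : SpaceTime (d + 1) → Matrix (Fin (d + 1)) (Fin (d + 1)) ℝ),
      GT (hB K N β θ a t0 lam z) ht g H ∧ ∀ x t,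
      (lam * ht (x, t) = a * Real.exp (-N * ((t - t0) / lam)) *
        (- N * (Real.exp (-K * (‖x - z‖ ^ 2 - β * ((t - t0) / lam))) - θ)
          + K * β * Real.exp (-K * (‖x - z‖ ^ 2 - β * ((t - t0) / lam))))) ∧
      g (x, t) = (-(2 * K * (a * Real.exp (-N * ((t - t0) / lam))) *
        Real.exp (-K * (‖x - z‖ ^ 2 - β * ((t - t0) / lam))))) • (x - z) ∧
      ∀ A : Matrix (Fin (d + 1)) (Fin (d + 1)) ℝ, Ell L A →
        a * Real.exp (-N * ((t - t0) / lam)) *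
          (Real.exp (-K * (‖x - z‖ ^ 2 - β * ((t - t0) / lam))) * (K *
            (4 * K * ‖x - z‖ ^ 2 / L - 2 * (L * (d + 1))))) ≤ (A * H (x, t)).trace := by
  have h1 := ((GT.quad z).add (GT.time (n := d + 1) (a := fun t => - (β * ((t - t0) / lam)))
    (a' := fun _ => - (β / lam)) (fun t => by
      have := ((((hasDerivAt_id t).sub_const t0).div_const lam).const_mul β).neg
      exact this.congr_deriv (by ring)) continuous_const)).comp
    (f := fun y => Real.exp (-K * y) - θ) (f' := fun y => -K * Real.exp (-K * y))
    (f'' := fun y => K ^ 2 * Real.exp (-K * y))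
    (fun y => by
      have := (((hasDerivAt_id y).const_mul (-K)).exp).sub_const θ
      exact this.congr_deriv (by simp; ring))
    (fun y => by
      have := ((((hasDerivAt_id y).const_mul (-K)).exp)).const_mul (-K)
      exact this.congr_deriv (by simp; ring)) (by fun_prop)
  have h2 := h1.tmul (a := fun t => a * Real.exp (-N * ((t - t0) / lam)))
    (a' := fun t => a * ((-N) / lam * Real.exp (-N * ((t - t0) / lam))))
    (fun t => (exp_lin_deriv (-N) t0 lam t).const_mul a) (by fun_prop)
  refine ⟨_, _, _, h2, fun x t => ⟨?_, ?_, ?_⟩⟩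
  · simp only [← sub_eq_add_neg]
    field_simp
    ring
  · simp only [← sub_eq_add_neg, add_zero, smul_smul]
    congr 1
    ring
  · intro A hA
    simp only [← sub_eq_add_neg, add_zero, Matrix.mul_smul, Matrix.mul_add, Matrix.trace_smul,
      Matrix.trace_add, Matrix.mul_one, smul_eq_mul]
    have e1 := hA.r1_lower ((2 : ℝ) • (x - z))
    rw [norm_smul] at e1
    norm_num at e1
    have e2 := hA.tr_upper
    push_cast at e2
    generalize (A * r1 ((2 : ℝ) • (x - z)) ((2 : ℝ) • (x - z))).trace = T1 at *
    generalize A.trace = T2 at *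
    have hE := Real.exp_pos (-K * (‖x - z‖ ^ 2 - β * ((t - t0) / lam)))
    have ha' : 0 < a * Real.exp (-N * ((t - t0) / lam)) := by positivity
    generalize Real.exp (-K * (‖x - z‖ ^ 2 - β * ((t - t0) / lam))) = E at *
    generalize a * Real.exp (-N * ((t - t0) / lam)) = a' at *
    refine mul_le_mul_of_nonneg_left ?_ ha'.le
    have e3 : K ^ 2 * E * (L⁻¹ * (2 * ‖x - z‖) ^ 2) ≤ K ^ 2 * E * T1 :=
      mul_le_mul_of_nonneg_left e1 (by positivity)
    have e4 : K * E * (2 * T2) ≤ K * E * (2 * (L * (d + 1))) := by gcongr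
    have e5 : E * (K * (4 * K * ‖x - z‖ ^ 2 / L - 2 * (L * (d + 1)))) =
      K ^ 2 * E * (L⁻¹ * (2 * ‖x - z‖) ^ 2) - K * E * (2 * (L * (d + 1))) := by
      field_simp
      ring
    linarith

lemma kbar {K L M ε : ℝ} (hL : 1 ≤ L) (hM : 1 ≤ M) (hε : 0 < ε) (hε8 : ε ≤ 1 / 8)
    (hK : L * (L * (d + 1)) ≤ 2 * K) :
    ∃ (k kt : SpaceTime (d + 1) → ℝ) (g : SpaceTime (d + 1) → Eucl (d + 1))
      (H : SpaceTime (d + 1) → Matrix (Fin (d + 1)) (Fin (d + 1)) ℝ),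
      GT k kt g H ∧
      (∀ x t, kt (x, t) < 0) ∧
      (∀ x t, 0 ≤ lastC x → ∀ A, Ell L A → 0 ≤ (A * H (x, t)).trace) ∧
      (∀ x t, ‖x‖ ≤ 3 / 4 → ∀ v : Eucl (d + 1), ‖v‖ ≤ M → kt (x, t) < ⟪v, g (x, t)⟫) ∧
      (∀ x t, - (ε ^ 2 / (40 * M)) ≤ t → 0 < k (x, t) → ‖x‖ ^ 2 + 2 * lastC x < ε ^ 2 / 4) ∧
      (∀ x t, - (ε ^ 2 / (40 * M)) ≤ t → k (x, t) ≤ 1) ∧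
      (∃ κ, 0 < κ ∧ ∀ x t, ‖x‖ ≤ ε ^ 2 / 48 → t ≤ 0 → κ ≤ k (x, t)) := by
  have hKp : 0 < K := by
    have : 0 < L * (L * (d + 1)) := by positivity
    linarith
  obtain ⟨τ, hτ⟩ : ∃ τ, τ = ε ^ 2 / (40 * M) := ⟨_, rfl⟩
  rw [← hτ]
  have hMτ : M * τ = ε ^ 2 / 40 := by rw [hτ]; field_simp
  have h1 := ((GT.quad (-eN d)).add (GT.time (n := d + 1) (a := fun t => 5 * M * (t + τ))
    (a' := fun _ => 5 * M) (fun t => by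
      have := ((hasDerivAt_id t).add_const τ).const_mul (5 * M)
      exact this.congr_deriv (by ring)) continuous_const)).comp
    (f := fun y => Real.exp (-K * y) - Real.exp (-K * (1 + ε ^ 2 / 4)))
    (f' := fun y => -K * Real.exp (-K * y))
    (f'' := fun y => K ^ 2 * Real.exp (-K * y))
    (fun y => by
      have := (((hasDerivAt_id y).const_mul (-K)).exp).sub_const (Real.exp (-K * (1 + ε ^ 2 / 4)))
      exact this.congr_deriv (by simp; ring))
    (fun y => by
      have := ((((hasDerivAt_id y).const_mul (-K)).exp)).const_mul (-K)
      exact this.congr_deriv (by simp; ring)) (by fun_prop)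
  have hsq : ∀ x : Eucl (d + 1), ‖x - -eN d‖ ^ 2 = ‖x‖ ^ 2 + 2 * lastC x + 1 := by
    intro x
    rw [sub_neg_eq_add, norm_add_sq_real, inner_eN, norm_eN]; norm_num
  refine ⟨_, _, _, _, h1, ?_, ?_, ?_, ?_, ?_, ?_⟩
  · intro x t
    simp only [zero_add]
    have := Real.exp_pos (-K * (‖x - -eN d‖ ^ 2 + 5 * M * (t + τ)))
    have : 0 < K * Real.exp (-K * (‖x - -eN d‖ ^ 2 + 5 * M * (t + τ))) * (5 * M) := by positivity
    linarith
  · intro x t hx A hA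
    simp only [add_zero, Matrix.mul_smul, Matrix.mul_add, Matrix.trace_smul,
      Matrix.trace_add, Matrix.mul_one, smul_eq_mul]
    have e1 := hA.r1_lower ((2 : ℝ) • (x - -eN d))
    rw [norm_smul, mul_pow, hsq, Real.norm_eq_abs, sq_abs] at e1
    have e0 : (2 : ℝ) ^ 2 = 4 := by norm_num
    rw [e0] at e1
    have e2 := hA.tr_upper
    push_cast at e2
    have hE := Real.exp_pos (-K * (‖x - -eN d‖ ^ 2 + 5 * M * (t + τ)))
    generalize Real.exp (-K * (‖x - -eN d‖ ^ 2 + 5 * M * (t + τ))) = E at *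
    generalize (A * r1 ((2 : ℝ) • (x - - eN d)) ((2 : ℝ) • (x - - eN d))).trace = T1 at *
    generalize A.trace = T2 at *
    have e3 : L⁻¹ * 4 ≤ T1 := by
      refine le_trans ?_ e1
      gcongr
      nlinarith [sq_nonneg ‖x‖]
    have e4 : 2 * (L * (d + 1)) ≤ K * (L⁻¹ * 4) := by
      have : K * (L⁻¹ * 4) = 2 * (2 * K) / L := by field_simp; ring
      rw [this, le_div_iff₀ (by positivity)]
      nlinarith
    have e5 : 2 * T2 ≤ K * T1 := by nlinarith
    have : 0 ≤ K * E * (K * T1 - 2 * T2) := mul_nonneg (by positivity) (by linarith)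
    linarith
  · intro x t hx v hv
    simp only [zero_add, add_zero]
    have hE := Real.exp_pos (-K * (‖x - -eN d‖ ^ 2 + 5 * M * (t + τ)))
    generalize Real.exp (-K * (‖x - -eN d‖ ^ 2 + 5 * M * (t + τ))) = E at *
    rw [inner_smul_right, inner_smul_right]
    have e1 := real_inner_le_norm v (x - -eN d)
    have e2 : ‖x - -eN d‖ ≤ 7 / 4 := by
      rw [sub_neg_eq_add]
      refine (norm_add_le _ _).trans ?_
      rw [norm_eN]; linarith
    have e3 : ‖v‖ * ‖x - -eN d‖ ≤ M * (7 / 4) := by gcongr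
    generalize inner ℝ v (x - -eN d) = T at *
    have : 0 < K * E * (5 * M - 2 * T) := mul_pos (by positivity) (by linarith)
    linarith
  · intro x t ht hk
    simp only at hk
    rw [sub_pos, Real.exp_lt_exp, hsq] at hk
    have e1 : ‖x‖ ^ 2 + 2 * lastC x + 1 + 5 * M * (t + τ) < 1 + ε ^ 2 / 4 := by nlinarith
    have e2 : 0 ≤ 5 * M * (t + τ) := mul_nonneg (by positivity) (by linarith)
    linarith
  · intro x t ht
    simp only
    have e1 := Real.exp_pos (-K * (1 + ε ^ 2 / 4))
    have e2 : Real.exp (-K * (‖x - -eN d‖ ^ 2 + 5 * M * (t + τ))) ≤ 1 := by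
      rw [Real.exp_le_one_iff]
      have e2 : 0 ≤ 5 * M * (t + τ) := mul_nonneg (by positivity) (by linarith)
      have : 0 ≤ K * (‖x - -eN d‖ ^ 2 + 5 * M * (t + τ)) := by positivity
      linarith
    linarith
  · refine ⟨Real.exp (-K * (1 + 3 * ε ^ 2 / 16)) - Real.exp (-K * (1 + ε ^ 2 / 4)), ?_, ?_⟩
    · rw [sub_pos, Real.exp_lt_exp]
      have : 0 < K * ε ^ 2 := by positivity
      linarith
    · intro x t hx ht
      simp only
      rw [sub_le_sub_iff_right, Real.exp_le_exp, hsq]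
      have e1 : 5 * M * (t + τ) ≤ ε ^ 2 / 8 := by
        have : 5 * M * t ≤ 0 := mul_nonpos_of_nonneg_of_nonpos (by positivity) ht
        linarith
      have e2 := (abs_le.1 (abs_lastC_le x)).2
      have e31 : ‖x‖ ≤ 1 := by nlinarith
      have e3 : ‖x‖ ^ 2 ≤ ‖x‖ := by nlinarith [norm_nonneg x]
      have : K * (‖x‖ ^ 2 + 2 * lastC x + 1 + 5 * M * (t + τ)) ≤ K * (1 + 3 * ε ^ 2 / 16) :=
        mul_le_mul_of_nonneg_left (by linarith) hKp.le
      linarith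

lemma hcore {K N B β θ L ε q s nn : ℝ} (hL : 1 ≤ L) (hε : 0 < ε) (hβ : 0 ≤ β) (hβB : β ≤ B)
    (hnn : 0 ≤ nn)
    (hK : 4 * L * (B + 2 * nn + 1) ≤ K * ε ^ 2)
    (hN : K * (B + 2 * nn) + 1 ≤ N * (1 - Real.exp (-K * (3 * ε ^ 2 / 16))))
    (hθ : θ ≤ Real.exp (-K * (ε ^ 2 / 4))) (hs : 0 ≤ s) (hq : 0 ≤ q)
    (hE : θ ≤ Real.exp (-K * (q ^ 2 - β * s))) :
    (- N * (Real.exp (-K * (q ^ 2 - β * s)) - θ) + K * β * Real.exp (-K * (q ^ 2 - β * s))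
      < Real.exp (-K * (q ^ 2 - β * s)) * (K * (4 * K * q ^ 2 / L - 2 * nn))) ∧
    (ε / 4 ≤ q → - N * (Real.exp (-K * (q ^ 2 - β * s)) - θ)
        + K * β * Real.exp (-K * (q ^ 2 - β * s)) + K * Real.exp (-K * (q ^ 2 - β * s))
      ≤ Real.exp (-K * (q ^ 2 - β * s)) * (K * (4 * K * q ^ 2 / L - 2 * nn))) := by
  have hB : 0 ≤ B := hβ.trans hβB
  have hKp : 0 < K := by
    have : 0 < K * ε ^ 2 := lt_of_lt_of_le (by positivity) hK
    exact pos_of_mul_pos_left this (by positivity)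
  have h1e : 0 < 1 - Real.exp (-K * (3 * ε ^ 2 / 16)) := by
    rw [sub_pos, Real.exp_lt_one_iff]
    have : 0 < K * (3 * ε ^ 2 / 16) := by positivity
    linarith
  have hNp : 0 < N := by
    have : 0 < N * (1 - Real.exp (-K * (3 * ε ^ 2 / 16))) := lt_of_lt_of_le (by positivity) hN
    exact pos_of_mul_pos_left this h1e.le
  have hEp := Real.exp_pos (-K * (q ^ 2 - β * s))
  have hbig : ε / 4 ≤ q → - N * (Real.exp (-K * (q ^ 2 - β * s)) - θ)
        + K * β * Real.exp (-K * (q ^ 2 - β * s)) + K * Real.exp (-K * (q ^ 2 - β * s))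
      ≤ Real.exp (-K * (q ^ 2 - β * s)) * (K * (4 * K * q ^ 2 / L - 2 * nn)) := by
    intro hq4
    generalize Real.exp (-K * (q ^ 2 - β * s)) = E at *
    have e1 : B + 2 * nn + 1 ≤ 4 * K * q ^ 2 / L := by
      rw [le_div_iff₀ (by positivity)]
      have : K * (ε / 4) ^ 2 ≤ K * q ^ 2 := by gcongr
      nlinarith
    have e2 : 0 ≤ N * (E - θ) := mul_nonneg hNp.le (by linarith)
    have e3 : 0 ≤ E * K * (4 * K * q ^ 2 / L - 2 * nn - β - 1) :=
      mul_nonneg (by positivity) (by linarith)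
    linarith
  refine ⟨?_, hbig⟩
  by_cases hq4 : ε / 4 ≤ q
  · have := hbig hq4
    have h2 : 0 < K * Real.exp (-K * (q ^ 2 - β * s)) := by positivity
    linarith
  · push Not at hq4
    have e1 : θ ≤ Real.exp (-K * (q ^ 2 - β * s)) * Real.exp (-K * (3 * ε ^ 2 / 16)) := by
      refine hθ.trans ?_
      rw [← Real.exp_add, Real.exp_le_exp]
      have a1 : q ^ 2 ≤ (ε / 4) ^ 2 := by gcongr
      have a2 : 0 ≤ β * s := by positivity
      have : K * (q ^ 2 - β * s + 3 * ε ^ 2 / 16) ≤ K * (ε ^ 2 / 4) := by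
        gcongr; linarith
      linarith
    generalize Real.exp (-K * (q ^ 2 - β * s)) = E at *
    generalize Real.exp (-K * (3 * ε ^ 2 / 16)) = F at *
    have e2 : N * (E * (1 - F)) ≤ N * (E - θ) := by gcongr; linarith
    have e3 : E * (K * (B + 2 * nn) + 1) ≤ E * (N * (1 - F)) := by gcongr
    have e4 : 0 ≤ E * (K * (4 * K * q ^ 2 / L)) := by positivity
    have e5 : K * β * E ≤ K * B * E := by gcongr
    linarith

end Boundary

noncomputable section Boundary2

variable {d : ℕ}

structure KBar (L M ε : ℝ) (k kt : SpaceTime (d + 1) → ℝ) (g : SpaceTime (d + 1) → Eucl (d + 1))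
    (H : SpaceTime (d + 1) → Matrix (Fin (d + 1)) (Fin (d + 1)) ℝ) : Prop where
  gt : GT k kt g H
  neg : ∀ x t, kt (x, t) < 0
  tr : ∀ x t, 0 ≤ lastC x → ∀ A, Ell L A → 0 ≤ (A * H (x, t)).trace
  bd : ∀ x t, ‖x‖ ≤ 3 / 4 → ∀ v : Eucl (d + 1), ‖v‖ ≤ M → kt (x, t) < ⟪v, g (x, t)⟫
  supp : ∀ x t, - (ε ^ 2 / (40 * M)) ≤ t → 0 < k (x, t) → ‖x‖ ^ 2 + 2 * lastC x < ε ^ 2 / 4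
  le1 : ∀ x t, - (ε ^ 2 / (40 * M)) ≤ t → k (x, t) ≤ 1

lemma mem_UU0 {x : Eucl (d + 1)} {t : ℝ} (hx : ‖x‖ ≤ 3 / 4) (h0 : 0 ≤ lastC x) (h1 : -1 < t)
    (h2 : t ≤ 0) : (x, t) ∈ UU d 0 := ⟨by simp only; linarith, h0, h1, h2⟩

lemma tau_small {ε M : ℝ} (hε : 0 < ε) (hε8 : ε ≤ 1 / 8) (hM : 1 ≤ M) :
    0 < ε ^ 2 / (40 * M) ∧ ε ^ 2 / (40 * M) < 1 / 2 := by
  refine ⟨by positivity, ?_⟩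
  rw [div_lt_iff₀ (by positivity)]
  nlinarith

lemma persist {lam L M ε : ℝ} (hlam : 0 < lam) (hM : 1 ≤ M) (hε : 0 < ε)
    (hε8 : ε ≤ 1 / 8)
    {Q : ℝ → Matrix (Fin (d + 1)) (Fin (d + 1)) ℝ} (hE : ∀ t, Ell L (Q t))
    {v : ℝ → Eucl (d + 1)} (hv : ∀ t, ‖v t‖ ≤ M) {u : SpaceTime (d + 1) → ℝ} (hu : VS 0 lam Q v u)
    (hu0 : ∀ p ∈ UU d 0, 0 ≤ u p) {k kt g H} (hk : KBar (d := d) L M ε k kt g H)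
    {g0 t0 t1 : ℝ} (hg0 : 0 ≤ g0) (h0 : - (ε ^ 2 / (40 * M)) ≤ t0) (h1 : t1 ≤ 0)
    (hinit : ∀ x, ‖x‖ ≤ 3 / 4 → 0 ≤ lastC x → g0 * k (x, t0) ≤ u (x, t0)) :
    ∀ x t, ‖x‖ ≤ 3 / 4 → 0 ≤ lastC x → t0 ≤ t → t ≤ t1 → g0 * k (x, t) ≤ u (x, t) := by
  intro x t hx hx0 ht ht2
  have hτ := tau_small hε hε8 hM
  refine hu.comparison (Y := {0}) (t0 := t0) (r := 3 / 4) (by norm_num) (by linarith) h1 isCompact_singleton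
    (φ := fun _ p => g0 * k p) (fun _ _ => hk.gt.smul g0)
    (continuous_const.mul (hk.gt.c1.comp continuous_snd))
    (fun _ _ x hx h => hinit x hx h) ?_ 0 rfl x t hx hx0 ht ht2
  clear ht ht2 hx hx0 x t
  intro y _ x t hx hbx ht1 ht2 hlt _
  have h2 : 0 < g0 * k (x, t) := lt_of_le_of_lt (hu0 _ (mem_UU0 hx hbx (by linarith) (by linarith))) hlt
  have hg : 0 < g0 := lt_of_le_of_ne hg0 (fun h => by rw [← h] at h2; simp at h2)
  have hkp : 0 < k (x, t) := pos_of_mul_pos_right h2 hg0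
  have hs := hk.supp x t (by linarith) hkp
  refine ⟨?_, fun _ => ?_, fun _ => ?_⟩
  · nlinarith [norm_nonneg x]
  · have e1 := hk.neg x t
    have e2 := hk.tr x t hbx _ (hE t)
    simp only [Matrix.mul_smul, Matrix.trace_smul, smul_eq_mul]
    have e3 : 0 ≤ g0 * (Q t * H (x, t)).trace := by positivity
    have e4 : lam * (g0 * kt (x, t)) < 0 := mul_neg_of_pos_of_neg hlam (mul_neg_of_pos_of_neg hg e1)
    linarith
  · rw [inner_smul_right]
    exact mul_lt_mul_of_pos_left (hk.bd x t hx _ (hv t)) hg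

lemma pyth (x y : Eucl (d + 1)) (hy : lastC y = 0) :
    ‖x - ((1 / 4 : ℝ) • eN d + y)‖ ^ 2 = ‖(x - lastC x • eN d) - y‖ ^ 2 + (lastC x - 1 / 4) ^ 2 := by
  have e : x - ((1 / 4 : ℝ) • eN d + y) = ((x - lastC x • eN d) - y) + (lastC x - 1 / 4) • eN d := by
    module
  rw [e, norm_add_sq_real, inner_smul_right, inner_eN, norm_smul, norm_eN, mul_one, Real.norm_eq_abs,
    sq_abs]
  simp only [lastC_sub, lastC_smul, lastC_eN, hy]
  ring

lemma phase1 {lam L M ε K N B σ : ℝ} (hlam : 0 < lam) (hL : 1 ≤ L) (hM : 1 ≤ M)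
    (hε : 0 < ε) (hε8 : ε ≤ 1 / 8) (hB0 : 0 ≤ B) (hσ : 0 < σ) (hBσ : B * σ = 1 / 16 - ε ^ 2 / 4)
    (hK : 4 * L * (B + 2 * (L * (d + 1)) + 1) ≤ K * ε ^ 2)
    (hN : K * (B + 2 * (L * (d + 1))) + 1 ≤ N * (1 - Real.exp (-K * (3 * ε ^ 2 / 16))))
    {Q : ℝ → Matrix (Fin (d + 1)) (Fin (d + 1)) ℝ} (hE : ∀ t, Ell L (Q t))
    {v : ℝ → Eucl (d + 1)} (hv : ∀ t, ‖v t‖ ≤ M) {u : SpaceTime (d + 1) → ℝ} (hu : VS 0 lam Q v u)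
    (hu0 : ∀ p ∈ UU d 0, 0 ≤ u p) {k kt g H} (hk : KBar (d := d) L M ε k kt g H)
    {g0 t0 : ℝ} (hg0 : 0 ≤ g0) (h0 : - (ε ^ 2 / (40 * M)) ≤ t0) (h1 : t0 + lam * σ ≤ 0)
    (hinit : ∀ x, ‖x‖ ≤ 3 / 4 → 0 ≤ lastC x → g0 * k (x, t0) ≤ u (x, t0))
    (hgood : ∀ x, ‖x - (1 / 4 : ℝ) • eN d‖ ≤ ε → 3 / 8 ≤ u (x, t0))
    (y : Eucl (d + 1)) (hy : lastC y = 0) (hy2 : ‖y‖ ≤ ε / 2) (x : Eucl (d + 1))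
    (hx : ‖x‖ ≤ 3 / 4) (hx0 : 0 ≤ lastC x) :
    hB K N B (Real.exp (-K * (ε ^ 2 / 4))) (3 / 8) t0 lam ((1 / 4 : ℝ) • eN d + y) (x, t0 + lam * σ)
      + g0 * k (x, t0 + lam * σ) ≤ u (x, t0 + lam * σ) := by
  have hL0 : 0 < L := by linarith
  have hτ := tau_small hε hε8 hM
  have hKp : 0 < K := by
    have : 0 < K * ε ^ 2 := lt_of_lt_of_le (by positivity) hK
    exact pos_of_mul_pos_left this (by positivity)
  have hP := persist hlam hM hε hε8 hE hv hu hu0 hk hg0 h0 h1 hinit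
  obtain ⟨z, hz⟩ : ∃ z, z = (1 / 4 : ℝ) • eN d + y := ⟨_, rfl⟩
  rw [← hz]
  have hzl : lastC z = 1 / 4 := by rw [hz, lastC_add, lastC_smul, lastC_eN, hy]; norm_num
  have hzn : ‖z‖ ≤ 1 / 4 + ε / 2 := by
    rw [hz]
    refine (norm_add_le _ _).trans ?_
    rw [norm_smul, norm_eN]
    norm_num
    linarith
  obtain ⟨ht, gh, Hh, hG, hprop⟩ := hB_GT (d := d) (K := K) (N := N) (β := B)
    (θ := Real.exp (-K * (ε ^ 2 / 4))) (a := 3 / 8) (t0 := t0) (lam := lam) (L := L)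
    hlam hL0 hKp (by norm_num) z
  have hlamσ : 0 < lam * σ := by positivity
  refine hu.comparison (Y := {0}) (t0 := t0) (r := 3 / 4) (by norm_num) (by linarith) h1 isCompact_singleton
    (φ := fun _ p => hB K N B (Real.exp (-K * (ε ^ 2 / 4))) (3 / 8) t0 lam z p + g0 * k p)
    (fun _ _ => hG.add (hk.gt.smul g0))
    ((hG.add (hk.gt.smul g0)).c1.comp continuous_snd)
    ?_ ?_ 0 rfl x (t0 + lam * σ) hx hx0 (by linarith) le_rfl
  · clear hx hx0 x
    intro _ _ x hx hx0
    simp only [hB, sub_self, zero_div, mul_zero, sub_zero, Real.exp_zero, mul_one]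
    by_cases hxz : ε / 2 ≤ ‖x - z‖
    · have e1 : Real.exp (-K * ‖x - z‖ ^ 2) ≤ Real.exp (-K * (ε ^ 2 / 4)) := by
        rw [Real.exp_le_exp]
        have : K * (ε / 2) ^ 2 ≤ K * ‖x - z‖ ^ 2 := by gcongr
        linarith
      have := hinit x hx hx0
      linarith
    · push Not at hxz
      have e0 : ‖x - (1 / 4 : ℝ) • eN d‖ ≤ ε := by
        have : x - (1 / 4 : ℝ) • eN d = (x - z) + y := by rw [hz]; abel
        rw [this]
        refine (norm_add_le _ _).trans (by linarith)
      have e1 := hgood x e0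
      have e2 : k (x, t0) ≤ 0 := by
        by_contra hcon
        push Not at hcon
        have a1 := hk.supp x t0 h0 hcon
        have a2 := (abs_le.1 (abs_lastC_le (x - z))).1
        rw [lastC_sub, hzl] at a2
        nlinarith [sq_nonneg ‖x‖]
      have e3 : Real.exp (-K * ‖x - z‖ ^ 2) ≤ 1 := by
        rw [Real.exp_le_one_iff]
        have : 0 ≤ K * ‖x - z‖ ^ 2 := by positivity
        linarith
      have e4 := Real.exp_pos (-K * (ε ^ 2 / 4))
      have e5 : g0 * k (x, t0) ≤ 0 := mul_nonpos_of_nonneg_of_nonpos hg0 e2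
      linarith
  · clear hx hx0 x
    intro _ _ x t hx hbx ht1 ht2 hlt _
    obtain ⟨q1, q2, q3⟩ := hprop x t
    have hp := hP x t hx hbx ht1.le ht2
    have hs0 : 0 ≤ (t - t0) / lam := div_nonneg (by linarith) hlam.le
    have hs1 : (t - t0) / lam ≤ σ := by rw [div_le_iff₀ hlam]; linarith
    have hh : 0 < hB K N B (Real.exp (-K * (ε ^ 2 / 4))) (3 / 8) t0 lam z (x, t) := by linarith
    unfold hB at hh
    simp only at hh
    have hA : 0 < (3 / 8 : ℝ) * Real.exp (-N * ((t - t0) / lam)) := by positivity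
    have hEE : Real.exp (-K * (ε ^ 2 / 4)) < Real.exp (-K * (‖x - z‖ ^ 2 - B * ((t - t0) / lam))) := by
      have := pos_of_mul_pos_right hh hA.le
      linarith
    have hxz : ‖x - z‖ ^ 2 < 1 / 16 := by
      rw [Real.exp_lt_exp] at hEE
      have a1 : K * (‖x - z‖ ^ 2 - B * ((t - t0) / lam)) < K * (ε ^ 2 / 4) := by linarith
      have a2 := lt_of_mul_lt_mul_left a1 hKp.le
      have a3 : B * ((t - t0) / lam) ≤ B * σ := by gcongr
      linarith
    have hxz2 : ‖x - z‖ < 1 / 4 := by nlinarith [norm_nonneg (x - z)]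
    have hc := (hcore hL hε hB0 le_rfl (by positivity) hK hN le_rfl hs0 (norm_nonneg (x - z)) hEE.le).1
    refine ⟨?_, fun _ => ?_, fun hx0 => ?_⟩
    · have : x = (x - z) + z := by abel
      rw [this]
      refine lt_of_le_of_lt (norm_add_le _ _) (by linarith)
    · have e1 := hk.neg x t
      have e2 := hk.tr x t hbx _ (hE t)
      have e0 := q3 _ (hE t)
      simp only [Matrix.mul_smul, Matrix.mul_add, Matrix.trace_add, Matrix.trace_smul, smul_eq_mul]
      rw [mul_add, q1]
      have e3 : 0 ≤ g0 * (Q t * H (x, t)).trace := by positivity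
      have e4 : lam * (g0 * kt (x, t)) ≤ 0 :=
        mul_nonpos_of_nonneg_of_nonpos hlam.le (mul_nonpos_of_nonneg_of_nonpos hg0 e1.le)
      have e5 := mul_lt_mul_of_pos_left hc hA
      linarith
    · exfalso
      have a2 := (abs_le.1 (abs_lastC_le (x - z))).1
      rw [lastC_sub, hzl, hx0] at a2
      linarith

end Boundary2

noncomputable section Boundary3

variable {d : ℕ}

lemma sq_q1 {a : ℝ} (h : 0 ≤ a) (h2 : a ≤ 1 / 8) : (a - 1 / 4) ^ 2 ≤ 1 / 16 := by nlinarith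

lemma sq_q2 {a : ℝ} (h : 0 ≤ a) (h2 : a ≤ 1 / 8) : (1 / 4 - a) ^ 2 ≤ 1 / 16 := by nlinarith

lemma Y_compact (ρ : ℝ) : IsCompact {y : Eucl (d + 1) | lastC y = 0 ∧ ‖y‖ ≤ ρ} := by
  refine (isCompact_closedBall (0 : Eucl (d + 1)) ρ).of_isClosed_subset ?_ ?_
  · exact (isClosed_eq lastC_continuous continuous_const).inter
      (isClosed_le continuous_norm continuous_const)
  · intro y hy
    simpa using hy.2

set_option maxHeartbeats 2000000 in
lemma phase2 {lam L M ε K N B σ a c : ℝ} (hlam : 0 < lam) (hlam1 : lam ≤ 1) (hL : 1 ≤ L) (hM : 1 ≤ M)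
    (hε : 0 < ε) (hε8 : ε ≤ 1 / 8) (hB0 : 0 ≤ B) (hσ : 0 < σ)
    (hK : 4 * L * (B + 2 * (L * (d + 1)) + 1) ≤ K * ε ^ 2)
    (hN : K * (B + 2 * (L * (d + 1))) + 1 ≤ N * (1 - Real.exp (-K * (3 * ε ^ 2 / 16))))
    (hN0 : 0 ≤ N)
    (ha : 0 < a) (hc0 : 0 < c)
    (hc : c * (2 * M) < a * Real.exp (-N * σ) * Real.exp (-K * (1 / 16)) * K)
    {Q : ℝ → Matrix (Fin (d + 1)) (Fin (d + 1)) ℝ} (hE : ∀ t, Ell L (Q t))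
    {v : ℝ → Eucl (d + 1)} (hv : ∀ t, ‖v t‖ ≤ M) (hvn : ∀ t, M⁻¹ ≤ lastC (v t))
    {u : SpaceTime (d + 1) → ℝ} (hu : VS 0 lam Q v u)
    (hu0 : ∀ p ∈ UU d 0, 0 ≤ u p) {k kt g H} (hk : KBar (d := d) L M ε k kt g H)
    {g0 t0 : ℝ} (hg0 : 0 ≤ g0) (h0 : - (ε ^ 2 / (40 * M)) ≤ t0) (h1 : t0 + lam * σ ≤ 0)
    (hinit : ∀ y, lastC y = 0 → ‖y‖ ≤ ε / 2 → ∀ x, ‖x‖ ≤ 3 / 4 → 0 ≤ lastC x →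
      hB K N 0 (Real.exp (-K * (1 / 16))) a t0 lam ((1 / 4 : ℝ) • eN d + y) (x, t0)
        + g0 * k (x, t0) ≤ u (x, t0))
    (x : Eucl (d + 1)) (hx : ‖x‖ ≤ 3 / 4) (hx0 : 0 ≤ lastC x) :
    (g0 + c * (lam * σ)) * k (x, t0 + lam * σ) ≤ u (x, t0 + lam * σ) := by
  have hL0 : 0 < L := by linarith
  have hτ := tau_small hε hε8 hM
  have hlamσ : 0 < lam * σ := by positivity
  have hKp : 0 < K := by
    have : 0 < K * ε ^ 2 := lt_of_lt_of_le (by positivity) hK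
    exact pos_of_mul_pos_left this (by positivity)
  obtain ⟨θ, hθ⟩ : ∃ θ, θ = Real.exp (-K * (1 / 16)) := ⟨_, rfl⟩
  rw [← hθ] at hc hinit
  have hθp : 0 < θ := by rw [hθ]; positivity
  have hθ2 : θ ≤ Real.exp (-K * (ε ^ 2 / 4)) := by
    rw [hθ, Real.exp_le_exp]
    have : K * (ε ^ 2 / 4) ≤ K * (1 / 16) := mul_le_mul_of_nonneg_left (by nlinarith) hKp.le
    linarith
  -- projection facts
  have hproj : ∀ x t, 0 ≤ lastC x → - (ε ^ 2 / (40 * M)) ≤ t → 0 < k (x, t) →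
      lastC (x - lastC x • eN d) = 0 ∧ ‖x - lastC x • eN d‖ ≤ ε / 2 ∧ lastC x ≤ 1 / 8 ∧ ‖x‖ < 3 / 4 := by
    intro x t hx0 ht hkp
    have hs := hk.supp x t ht hkp
    have e1 : ‖x‖ ^ 2 < (ε / 2) ^ 2 := by nlinarith
    have e2 : ‖x‖ < ε / 2 := lt_of_pow_lt_pow_left₀ 2 (by positivity) e1
    have e3 : ‖x - lastC x • eN d‖ ^ 2 = ‖x‖ ^ 2 - lastC x ^ 2 := by
      rw [norm_sub_sq_real, inner_smul_right, inner_eN, norm_smul, norm_eN, mul_one, Real.norm_eq_abs,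
        sq_abs]
      ring
    refine ⟨by rw [lastC_sub, lastC_smul, lastC_eN]; ring, ?_, by nlinarith [sq_nonneg ‖x‖], by linarith⟩
    refine (pow_le_pow_iff_left₀ (norm_nonneg _) (by positivity) (two_ne_zero)).1 ?_
    rw [e3]
    nlinarith [sq_nonneg (lastC x)]
  choose ht gh Hh hG hprop using fun y : Eucl (d + 1) => hB_GT (d := d) (K := K) (N := N) (β := 0)
    (θ := θ) (a := a) (t0 := t0) (lam := lam) (L := L) hlam hL0 hKp ha ((1 / 4 : ℝ) • eN d + y)
  have hγ : ∀ t, HasDerivAt (fun t => g0 + c * (t - t0)) c t := fun t =>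
    ((((hasDerivAt_id t).sub_const t0).const_mul c).const_add g0).congr_deriv (by ring)
  have key := hu.comparison (Y := {y : Eucl (d + 1) | lastC y = 0 ∧ ‖y‖ ≤ ε / 2}) (t0 := t0) (r := 3 / 4)
    (by norm_num) (by linarith) h1 (Y_compact _)
    (φ := fun y p => hB K N 0 θ a t0 lam ((1 / 4 : ℝ) • eN d + y) p + (g0 + c * (p.2 - t0)) * k p)
    (fun y _ => (hG y).add (hk.gt.tmul hγ continuous_const))
    (by
      have c1 := hB_cont K N 0 θ a t0 lam ((1 / 4 : ℝ) • eN d)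
      have c2 : Continuous fun q : Eucl (d + 1) × SpaceTime (d + 1) => k q.2 :=
        hk.gt.c1.comp continuous_snd
      have c3 : Continuous fun q : Eucl (d + 1) × SpaceTime (d + 1) => g0 + c * (q.2.2 - t0) := by
        fun_prop
      exact c1.add (c3.mul c2))
    ?_ ?_
  · have hnn := hu0 (x, t0 + lam * σ) (mem_UU0 hx hx0 (by linarith) h1)
    by_cases hkp : 0 < k (x, t0 + lam * σ)
    · obtain ⟨p1, p2, p3, p4⟩ := hproj x _ hx0 (by linarith) hkp
      have := key _ ⟨p1, p2⟩ x (t0 + lam * σ) hx hx0 (by linarith) le_rfl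
      have e0 : t0 + lam * σ - t0 = lam * σ := by ring
      simp only [e0] at this
      refine le_trans ?_ this
      rw [le_add_iff_nonneg_left]
      unfold hB
      simp only
      rw [pyth x _ p1, sub_self, norm_zero, hθ]
      refine mul_nonneg (by positivity) ?_
      rw [sub_nonneg, Real.exp_le_exp]
      have : K * ((lastC x - 1 / 4) ^ 2) ≤ K * (1 / 16) := mul_le_mul_of_nonneg_left (sq_q1 hx0 p3) hKp.le
      linarith
    · push Not at hkp
      refine le_trans (mul_nonpos_of_nonneg_of_nonpos (by positivity) hkp) hnn
  · intro y hy x hx hx0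
    have := hinit y hy.1 hy.2 x hx hx0
    simpa using this
  · clear hx hx0 x
    intro y hy x t hx hbx ht1 ht2 hlt hmax
    try simp only at hlt hmax
    obtain ⟨q1, q2, q3⟩ := hprop y x t
    obtain ⟨z, hz⟩ : ∃ z, z = (1 / 4 : ℝ) • eN d + y := ⟨_, rfl⟩
    have hzl : lastC z = 1 / 4 := by rw [hz, lastC_add, lastC_smul, lastC_eN, hy.1]; norm_num
    have hzn : ‖z‖ ≤ 1 / 4 + ε / 2 := by
      rw [hz]
      refine (norm_add_le _ _).trans ?_
      rw [norm_smul, norm_eN]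
      norm_num
      linarith [hy.2]
    rw [← hz] at q1 q2 q3
    have hs0 : 0 ≤ (t - t0) / lam := div_nonneg (by linarith) hlam.le
    have hs1 : (t - t0) / lam ≤ σ := by rw [div_le_iff₀ hlam]; linarith
    have hnn := hu0 (x, t) (mem_UU0 hx hbx (by linarith) (by linarith))
    have hγ0 : 0 ≤ g0 + c * (t - t0) := add_nonneg hg0 (mul_nonneg hc0.le (by linarith))
    obtain ⟨A, hA⟩ : ∃ A, A = a * Real.exp (-N * ((t - t0) / lam)) := ⟨_, rfl⟩
    have hAp : 0 < A := by rw [hA]; positivity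
    have hAc : c * (2 * M) < A * θ * K := by
      refine hc.trans_le ?_
      rw [hA]
      have : Real.exp (-N * σ) ≤ Real.exp (-N * ((t - t0) / lam)) := by
        rw [Real.exp_le_exp]
        have := mul_le_mul_of_nonneg_left hs1 hN0
        linarith
      gcongr
    rw [← hA] at q1 q2 q3
    have hkt := hk.neg x t
    have hktr := hk.tr x t hbx _ (hE t)
    have hγtr : 0 ≤ (g0 + c * (t - t0)) * (Q t * H (x, t)).trace := by positivity
    have hγkt : lam * ((g0 + c * (t - t0)) * kt (x, t)) ≤ 0 :=
        mul_nonpos_of_nonneg_of_nonpos hlam.le (mul_nonpos_of_nonneg_of_nonpos hγ0 hkt.le)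
    have hq3 := q3 _ (hE t)
    by_cases hkp : 0 < k (x, t)
    · obtain ⟨p1, p2, p3, p4⟩ := hproj x t hbx (by linarith) hkp
      have hm := hmax _ ⟨p1, p2⟩
      rw [add_le_add_iff_right] at hm
      unfold hB at hm
      simp only at hm
      rw [← hA, mul_le_mul_iff_right₀ hAp, sub_le_sub_iff_right, Real.exp_le_exp, pyth x _ p1,
        pyth x y hy.1, sub_self, norm_zero] at hm
      have hm2 : K * ‖(x - lastC x • eN d) - y‖ ^ 2 ≤ 0 := by linarith
      have hm3 : ‖(x - lastC x • eN d) - y‖ ^ 2 ≤ 0 := by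
        by_contra hcon
        push Not at hcon
        have := mul_pos hKp hcon
        linarith
      have hm4 : (x - lastC x • eN d) - y = 0 := by
        rw [← norm_eq_zero]
        exact pow_eq_zero_iff (two_ne_zero) |>.1 (le_antisymm hm3 (by positivity))
      have hxz : x - z = (lastC x - 1 / 4) • eN d := by
        rw [hz, ← sub_eq_zero, ← hm4]; module
      have hq : ‖x - z‖ = 1 / 4 - lastC x := by
        rw [hxz, norm_smul, norm_eN, mul_one, Real.norm_eq_abs, abs_of_nonpos (by linarith)]; ring
      have hEE : θ ≤ Real.exp (-K * (‖x - z‖ ^ 2 - 0 * ((t - t0) / lam))) := by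
        rw [hθ, Real.exp_le_exp, hq]
        have : K * ((1 / 4 - lastC x) ^ 2) ≤ K * (1 / 16) := mul_le_mul_of_nonneg_left (sq_q2 hbx p3) hKp.le
        linarith
      have hcc := (hcore hL hε le_rfl hB0 (by positivity) hK hN hθ2 hs0 (norm_nonneg (x - z)) hEE).2
        (by rw [hq]; linarith)
      have hk1 := hk.le1 x t (by linarith)
      refine ⟨p4, fun _ => ?_, fun hx0 => ?_⟩
      · simp only [Matrix.mul_smul, Matrix.mul_add, Matrix.trace_add, Matrix.trace_smul, smul_eq_mul]
        rw [mul_add, q1, mul_add]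
        have e5 := mul_le_mul_of_nonneg_left hcc hAp.le
        have e6 : lam * (c * k (x, t)) ≤ 1 * (c * 1) := by gcongr
        have e7 : c < A * θ * K := lt_of_le_of_lt (le_mul_of_one_le_right hc0.le (by linarith only [hM])) hAc
        have e8 : A * θ * K ≤ A * Real.exp (-K * (‖x - z‖ ^ 2 - 0 * ((t - t0) / lam))) * K := by gcongr
        linarith only [e5, e6, e7, e8, hγtr, hγkt, hq3]
      · have hEeq : Real.exp (-K * (‖x - z‖ ^ 2 - 0 * ((t - t0) / lam))) = θ := by
          rw [hq, hx0, hθ]; congr 1; ring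
        rw [hEeq] at q1 q2
        have hht : ht y (x, t) = 0 := by
          have : lam * ht y (x, t) = 0 := by rw [q1]; ring
          exact (mul_eq_zero.1 this).resolve_left hlam.ne'
        simp only [hht]
        rw [inner_add_right, q2, hxz, hx0, inner_smul_right, inner_smul_right, inner_smul_right, inner_eN]
        have hb := hk.bd x t hx _ (hv t)
        have hb2 : (g0 + c * (t - t0)) * kt (x, t) ≤ (g0 + c * (t - t0)) * ⟪v t, g (x, t)⟫ := by
          gcongr
        have e1 : c * k (x, t) ≤ c * 1 := by gcongr
        have e2 : c < A * θ * K / 2 * lastC (v t) := by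
          have a1 : A * θ * K / 2 * M⁻¹ ≤ A * θ * K / 2 * lastC (v t) := by
            have := hvn t
            gcongr
          refine lt_of_lt_of_le ?_ a1
          rw [← div_eq_mul_inv, lt_div_iff₀ (by positivity)]
          linarith
        linarith only [hb2, e1, e2]
    · push Not at hkp
      have hγk : (g0 + c * (t - t0)) * k (x, t) ≤ 0 := mul_nonpos_of_nonneg_of_nonpos hγ0 hkp
      have hh : 0 < hB K N 0 θ a t0 lam ((1 / 4 : ℝ) • eN d + y) (x, t) := by linarith
      unfold hB at hh
      simp only at hh
      rw [← hA, ← hz] at hh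
      have hEE : θ < Real.exp (-K * (‖x - z‖ ^ 2 - 0 * ((t - t0) / lam))) := by
        have := pos_of_mul_pos_right hh hAp.le
        linarith
      have hxz : ‖x - z‖ ^ 2 < 1 / 16 := by
        rw [hθ, Real.exp_lt_exp] at hEE
        have a1 : K * (‖x - z‖ ^ 2) < K * (1 / 16) := by linarith
        exact lt_of_mul_lt_mul_left a1 hKp.le
      have hxz2 : ‖x - z‖ < 1 / 4 := lt_of_pow_lt_pow_left₀ 2 (by norm_num) (hxz.trans_eq (by norm_num))
      have hcc := (hcore hL hε le_rfl hB0 (by positivity) hK hN hθ2 hs0 (norm_nonneg (x - z)) hEE.le).1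
      refine ⟨?_, fun _ => ?_, fun hx0 => ?_⟩
      · have : x = (x - z) + z := by abel
        rw [this]
        refine lt_of_le_of_lt (norm_add_le _ _) (by linarith)
      · simp only [Matrix.mul_smul, Matrix.mul_add, Matrix.trace_add, Matrix.trace_smul, smul_eq_mul]
        rw [mul_add, q1, mul_add]
        have e5 := mul_lt_mul_of_pos_left hcc hAp
        have e6 : lam * (c * k (x, t)) ≤ 0 :=
          mul_nonpos_of_nonneg_of_nonpos hlam.le (mul_nonpos_of_nonneg_of_nonpos hc0.le hkp)
        linarith only [e5, e6, hγtr, hγkt, hq3]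
      · exfalso
        have a2 := (abs_le.1 (abs_lastC_le (x - z))).1
        rw [lastC_sub, hzl, hx0] at a2
        linarith

end Boundary3

noncomputable section Boundary4

variable {d : ℕ}

lemma VS.add_const {b lam : ℝ} {Q : ℝ → Matrix (Fin (d + 1)) (Fin (d + 1)) ℝ}
    {v : ℝ → Eucl (d + 1)} {u : SpaceTime (d + 1) → ℝ} (h : VS b lam Q v u) {c : ℝ} (hc : 0 < c)
    (c0 : ℝ) : VS b lam Q v (fun p => c * u p + c0) := by
  have := h.transfer (b' := b) (R := 1) (μ := 1) (c := c) one_pos one_pos hc c0 0 0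
    (by simp [lastC]) (fun p hp => by simpa using hp)
  simpa using this

lemma step {lam L M ε K N B σ c : ℝ} (hlam : 0 < lam) (hlam1 : lam ≤ 1) (hL : 1 ≤ L) (hM : 1 ≤ M)
    (hε : 0 < ε) (hε8 : ε ≤ 1 / 8) (hB0 : 0 ≤ B) (hσ : 0 < σ) (hBσ : B * σ = 1 / 16 - ε ^ 2 / 4)
    (hK : 4 * L * (B + 2 * (L * (d + 1)) + 1) ≤ K * ε ^ 2)
    (hN : K * (B + 2 * (L * (d + 1))) + 1 ≤ N * (1 - Real.exp (-K * (3 * ε ^ 2 / 16))))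
    (hN0 : 0 ≤ N) (hc0 : 0 < c)
    (hc : c * (2 * M) < (3 / 8 * Real.exp (-N * σ + K * (B * σ))) * Real.exp (-N * σ)
      * Real.exp (-K * (1 / 16)) * K)
    {Q : ℝ → Matrix (Fin (d + 1)) (Fin (d + 1)) ℝ} (hE : ∀ t, Ell L (Q t))
    {v : ℝ → Eucl (d + 1)} (hv : ∀ t, ‖v t‖ ≤ M) (hvn : ∀ t, M⁻¹ ≤ lastC (v t))
    {u : SpaceTime (d + 1) → ℝ} (hu : VS 0 lam Q v u)
    (hu0 : ∀ p ∈ UU d 0, 0 ≤ u p) {k kt g H} (hk : KBar (d := d) L M ε k kt g H)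
    {g0 t0 : ℝ} (hg0 : 0 ≤ g0) (h0 : - (ε ^ 2 / (40 * M)) ≤ t0) (h1 : t0 + 2 * (lam * σ) ≤ 0)
    (hinit : ∀ x, ‖x‖ ≤ 3 / 4 → 0 ≤ lastC x → g0 * k (x, t0) ≤ u (x, t0))
    (hgood : ∀ x, ‖x - (1 / 4 : ℝ) • eN d‖ ≤ ε → 3 / 8 ≤ u (x, t0))
    (x : Eucl (d + 1)) (hx : ‖x‖ ≤ 3 / 4) (hx0 : 0 ≤ lastC x) :
    (g0 + c * (lam * σ)) * k (x, t0 + 2 * (lam * σ)) ≤ u (x, t0 + 2 * (lam * σ)) := by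
  have hlamσ : 0 < lam * σ := by positivity
  have p1 := phase1 hlam hL hM hε hε8 hB0 hσ hBσ hK hN hE hv hu hu0 hk hg0 h0 (by linarith) hinit hgood
  have p2 := phase2 (t0 := t0 + lam * σ) hlam hlam1 hL hM hε hε8 hB0 hσ hK hN hN0 (by positivity) hc0 hc hE hv hvn hu hu0 hk hg0
    (by linarith) (by linarith) (fun y hy hy2 x hx hx0 => by
      have := p1 y hy hy2 x hx hx0
      convert this using 2
      unfold hB
      have e1 : (t0 + lam * σ - t0) / lam = σ := by field_simp; ring
      simp only [e1, sub_self, zero_div, mul_zero, sub_zero, Real.exp_zero, mul_one]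
      have e2 : -K * (‖x - ((1 / 4 : ℝ) • eN d + y)‖ ^ 2 - B * σ) =
        K * (B * σ) + -K * ‖x - ((1 / 4 : ℝ) • eN d + y)‖ ^ 2 := by ring
      have e3 : -K * (ε ^ 2 / 4) = K * (B * σ) + -K * (1 / 16) := by rw [hBσ]; ring
      rw [e2, e3, Real.exp_add, Real.exp_add, Real.exp_add]
      ring) x hx hx0
  have e : t0 + lam * σ + lam * σ = t0 + 2 * (lam * σ) := by ring
  rw [e] at p2
  exact p2

/-- all the constants -/
lemma exists_consts (d : ℕ) {L M ε : ℝ} (hL : 1 ≤ L) (hM : 1 ≤ M) (hε : 0 < ε) (hε8 : ε ≤ 1 / 8) :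
    ∃ K N B σ c : ℝ, 0 ≤ B ∧ σ = ε ^ 2 / (40 * M) / 4 ∧ B * σ = 1 / 16 - ε ^ 2 / 4 ∧
    4 * L * (B + 2 * (L * (d + 1)) + 1) ≤ K * ε ^ 2 ∧
    K * (B + 2 * (L * (d + 1))) + 1 ≤ N * (1 - Real.exp (-K * (3 * ε ^ 2 / 16))) ∧
    0 ≤ N ∧ 0 < c ∧ c * (2 * M) < (3 / 8 * Real.exp (-N * σ + K * (B * σ))) * Real.exp (-N * σ)
      * Real.exp (-K * (1 / 16)) * K ∧ L * (L * (d + 1)) ≤ 2 * K := by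
  obtain ⟨σ, hσ⟩ : ∃ σ, σ = ε ^ 2 / (40 * M) / 4 := ⟨_, rfl⟩
  have hσp : 0 < σ := by rw [hσ]; positivity
  obtain ⟨B, hB⟩ : ∃ B, B = (1 / 16 - ε ^ 2 / 4) / σ := ⟨_, rfl⟩
  have hB0 : 0 ≤ B := by rw [hB]; exact div_nonneg (by nlinarith) hσp.le
  obtain ⟨K, hK⟩ : ∃ K, K = 4 * L * (B + 2 * (L * (d + 1)) + 1) / ε ^ 2 := ⟨_, rfl⟩
  have hKp : 0 < K := by rw [hK]; positivity
  have hKε : K * ε ^ 2 = 4 * L * (B + 2 * (L * (d + 1)) + 1) := by rw [hK]; field_simp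
  have h1e : 0 < 1 - Real.exp (-K * (3 * ε ^ 2 / 16)) := by
    rw [sub_pos, Real.exp_lt_one_iff]
    have : 0 < K * (3 * ε ^ 2 / 16) := by positivity
    linarith
  obtain ⟨N, hN⟩ : ∃ N, N = (K * (B + 2 * (L * (d + 1))) + 1) / (1 - Real.exp (-K * (3 * ε ^ 2 / 16))) :=
    ⟨_, rfl⟩
  obtain ⟨G, hG⟩ : ∃ G, G = (3 / 8 * Real.exp (-N * σ + K * (B * σ))) * Real.exp (-N * σ)
      * Real.exp (-K * (1 / 16)) * K := ⟨_, rfl⟩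
  have hGp : 0 < G := by rw [hG]; positivity
  refine ⟨K, N, B, σ, G / (4 * M), hB0, hσ, ?_, hKε.ge, ?_, ?_, by positivity, ?_, ?_⟩
  · rw [hB]; field_simp
  · rw [hN, div_mul_cancel₀ _ h1e.ne']
  · rw [hN]; exact div_nonneg (by positivity) h1e.le
  · rw [← hG]
    have : G / (4 * M) * (2 * M) = G / 2 := by field_simp; ring
    rw [this]; linarith
  · have h1 : K * ε ^ 2 ≤ K * 1 := mul_le_mul_of_nonneg_left (by nlinarith) hKp.le
    have h2 : 0 ≤ L * B := by positivity
    have h3 : 0 ≤ L * (L * (d + 1)) := by positivity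
    nlinarith

open Classical in
lemma counting {lam L M ε K N B σ c : ℝ} (hlam : 0 < lam) (hlam1 : lam ≤ 1) (hL : 1 ≤ L) (hM : 1 ≤ M)
    (hε : 0 < ε) (hε8 : ε ≤ 1 / 8) (hB0 : 0 ≤ B) (hσ : 0 < σ) (hBσ : B * σ = 1 / 16 - ε ^ 2 / 4)
    (hK : 4 * L * (B + 2 * (L * (d + 1)) + 1) ≤ K * ε ^ 2)
    (hN : K * (B + 2 * (L * (d + 1))) + 1 ≤ N * (1 - Real.exp (-K * (3 * ε ^ 2 / 16))))
    (hN0 : 0 ≤ N) (hc0 : 0 < c)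
    (hc : c * (2 * M) < (3 / 8 * Real.exp (-N * σ + K * (B * σ))) * Real.exp (-N * σ)
      * Real.exp (-K * (1 / 16)) * K)
    {Q : ℝ → Matrix (Fin (d + 1)) (Fin (d + 1)) ℝ} (hE : ∀ t, Ell L (Q t))
    {v : ℝ → Eucl (d + 1)} (hv : ∀ t, ‖v t‖ ≤ M) (hvn : ∀ t, M⁻¹ ≤ lastC (v t))
    {u : SpaceTime (d + 1) → ℝ} (hu : VS 0 lam Q v u)
    (hu0 : ∀ p ∈ UU d 0, 0 ≤ u p) {k kt g H} (hk : KBar (d := d) L M ε k kt g H)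
    {t0 : ℝ} (h0 : - (ε ^ 2 / (40 * M)) ≤ t0) (good : ℕ → Prop)
    (hgood : ∀ j : ℕ, t0 + (j + 1) * (2 * (lam * σ)) ≤ 0 → good j →
      ∀ x, ‖x - (1 / 4 : ℝ) • eN d‖ ≤ ε → 3 / 8 ≤ u (x, t0 + j * (2 * (lam * σ)))) (J : ℕ)
    (hJ : t0 + J * (2 * (lam * σ)) ≤ 0)
    (x : Eucl (d + 1)) (hx : ‖x‖ ≤ 3 / 4) (hx0 : 0 ≤ lastC x) :
    ((∑ i ∈ Finset.range J, if good i then (1 : ℝ) else 0) * (c * (lam * σ))) *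
      k (x, t0 + J * (2 * (lam * σ))) ≤ u (x, t0 + J * (2 * (lam * σ))) := by
  have hτ := tau_small hε hε8 hM
  have hlamσ : 0 < lam * σ := by positivity
  induction J generalizing x with
  | zero =>
    simp only [Finset.range_zero, Finset.sum_empty, zero_mul]
    simp only [Nat.cast_zero, zero_mul, add_zero] at hJ ⊢
    exact hu0 _ (mem_UU0 hx hx0 (by linarith) hJ)
  | succ J ih =>
    push_cast at hJ
    have hJ' : t0 + J * (2 * (lam * σ)) ≤ 0 := by linarith
    have ih' := fun x hx hx0 => ih hJ' x hx hx0
    have hsum : (0 : ℝ) ≤ ∑ i ∈ Finset.range J, if good i then (1 : ℝ) else 0 :=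
      Finset.sum_nonneg fun i _ => by split_ifs <;> norm_num
    have hJ0 : (0 : ℝ) ≤ J * (2 * (lam * σ)) := by positivity
    have e : t0 + ((J + 1 : ℕ) : ℝ) * (2 * (lam * σ)) = t0 + J * (2 * (lam * σ)) + 2 * (lam * σ) := by
      push_cast; ring
    rw [e, Finset.sum_range_succ]
    by_cases hg : good J
    · have := step hlam hlam1 hL hM hε hε8 hB0 hσ hBσ hK hN hN0 hc0 hc hE hv hvn hu hu0 hk
        (g0 := (∑ i ∈ Finset.range J, if good i then (1 : ℝ) else 0) * (c * (lam * σ)))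
        (by positivity) (t0 := t0 + J * (2 * (lam * σ))) (by linarith) (by linarith) ih'
        (hgood J hJ hg) x hx hx0
      rw [if_pos hg, add_mul, one_mul]
      exact this
    · have := persist hlam hM hε hε8 hE hv hu hu0 hk
        (g0 := (∑ i ∈ Finset.range J, if good i then (1 : ℝ) else 0) * (c * (lam * σ)))
        (by positivity) (t0 := t0 + J * (2 * (lam * σ))) (t1 := 0) (by linarith) le_rfl ih'
        x (t0 + J * (2 * (lam * σ)) + 2 * (lam * σ)) hx hx0 (by linarith) (by linarith)
      rw [if_neg hg, add_zero]
      exact this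

lemma near_e (d : ℕ) (L : ℝ) (hL : 1 ≤ L) : ∃ ε : ℝ, 0 < ε ∧ ε ≤ 1 / 8 ∧ ∀ lam : ℝ, 0 < lam → lam ≤ 1 →
    ∀ (Q : ℝ → Matrix (Fin (d + 1)) (Fin (d + 1)) ℝ), Continuous Q → (∀ t, Ell L (Q t)) →
    ∀ (v : ℝ → Eucl (d + 1)) (u : SpaceTime (d + 1) → ℝ), VS 0 lam Q v u →
    VS 0 lam Q v (fun p => - u p) → (∀ p ∈ UU d 0, |u p| ≤ 1) →
    ∀ t, -(1 / 2) ≤ t → t ≤ 0 → ∀ x, ‖x - (1 / 4 : ℝ) • eN d‖ ≤ ε →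
      |u (x, t) - u ((1 / 4 : ℝ) • eN d, t)| ≤ 1 / 8 := by
  obtain ⟨C, hC, hint⟩ := interior_est d L hL
  obtain ⟨s, hs⟩ : ∃ s, s = 1 / (8 * C + 2) := ⟨_, rfl⟩
  have hsp : 0 < s := by rw [hs]; positivity
  have hs2 : s ≤ 1 / 2 := by
    rw [hs, div_le_div_iff₀ (by positivity) (by positivity)]; linarith
  have hCs : C * s ≤ 1 / 8 := by
    rw [hs, mul_one_div, div_le_div_iff₀ (by positivity) (by positivity)]; linarith
  have hs4 : s ^ 4 ≤ 1 / 16 := by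
    calc s ^ 4 ≤ (1 / 2) ^ 4 := by gcongr
      _ = 1 / 16 := by norm_num
  refine ⟨s ^ 4 / 4, by positivity, by linarith, ?_⟩
  intro lam hlam hlam1 Q hQ hE v u hu hu' hu1 t ht ht0 x hx
  have hUU : ∀ p ∈ UU d (-1), ((1 / 4 : ℝ) • p.1 + (1 / 4 : ℝ) • eN d, lam / 16 * p.2 + t) ∈ UU d 0 := by
    intro p hp
    obtain ⟨h1, h2, h3, h4⟩ := hp
    refine ⟨?_, ?_, ?_, ?_⟩
    · refine lt_of_le_of_lt (norm_add_le _ _) ?_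
      rw [norm_smul, norm_smul, norm_eN]; norm_num; linarith
    · simp only [lastC_add, lastC_smul, lastC_eN]; linarith
    · simp only; nlinarith
    · simp only; nlinarith
  have hb2 : 1 / 4 * (-1) + lastC ((1 / 4 : ℝ) • eN d) = 0 := by
    rw [lastC_smul, lastC_eN]; norm_num
  have e0 : lam * (1 / 4) ^ 2 / (lam / 16) = 1 := by field_simp; norm_num
  have t1 := hu.transfer (b' := -1) (R := 1 / 4) (μ := lam / 16) (c := 1) (by norm_num) (by positivity)
    (by norm_num) 0 _ t hb2 hUU
  have t2 := hu'.transfer (b' := -1) (R := 1 / 4) (μ := lam / 16) (c := 1) (by norm_num) (by positivity)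
    (by norm_num) 0 _ t hb2 hUU
  rw [e0] at t1 t2
  simp only [add_zero, one_mul] at t1 t2
  have := hint (-1) le_rfl _ (hQ.comp (by fun_prop)) (fun τ => hE _) _ _ t1 t2
      (fun p hp => hu1 _ (hUU p hp)) s hsp hs2 ((4 : ℝ) • (x - (1 / 4 : ℝ) • eN d)) 0 (by
        rw [norm_smul]; norm_num; linarith) (by simp; positivity) le_rfl
  simp only [smul_smul, mul_zero, zero_add, smul_zero] at this
  norm_num at this
  norm_num
  refine this.trans ?_
  nlinarith

end Boundary4

noncomputable section Boundary5

variable {d : ℕ}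

set_option maxHeartbeats 1000000 in
lemma boundary_lemma (d : ℕ) (L M : ℝ) (hL : 1 ≤ L) (hM : 1 ≤ M) : ∃ ρ c : ℝ, 0 < ρ ∧ ρ ≤ 1 / 2 ∧
    0 < c ∧ c ≤ 1 / 2 ∧ ∀ lam : ℝ, 0 < lam → lam ≤ 1 →
    ∀ (Q : ℝ → Matrix (Fin (d + 1)) (Fin (d + 1)) ℝ), Continuous Q → (∀ t, Ell L (Q t)) →
    ∀ (v : ℝ → Eucl (d + 1)), (∀ t, ‖v t‖ ≤ M) → (∀ t, M⁻¹ ≤ lastC (v t)) →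
    ∀ (u : SpaceTime (d + 1) → ℝ), VS 0 lam Q v u →
    VS 0 lam Q v (fun p => - u p) → (∀ p ∈ UU d 0, 0 ≤ u p) → (∀ p ∈ UU d 0, u p ≤ 1) →
    (∀ x t, ‖x‖ ≤ ρ → 0 ≤ lastC x → -ρ ≤ t → t ≤ 0 → c ≤ u (x, t)) ∨
    (∀ x t, ‖x‖ ≤ ρ → 0 ≤ lastC x → -ρ ≤ t → t ≤ 0 → u (x, t) ≤ 1 - c) := by
  classical
  obtain ⟨ε, hε, hε8, hnear⟩ := near_e d L hL
  obtain ⟨K, N, B, σ, c, hB0, hσe, hBσ, hK, hN, hN0, hc0, hc, hK2⟩ := exists_consts d hL hM hε hε8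
  obtain ⟨k, kt, g, H, k1, k2, k3, k4, k5, k6, κ, hκ, hkκ⟩ := kbar (d := d) hL hM hε hε8 hK2
  have hk : KBar (d := d) L M ε k kt g H := ⟨k1, k2, k3, k4, k5, k6⟩
  have hτs := tau_small hε hε8 hM
  obtain ⟨τ, hτ⟩ : ∃ τ, τ = ε ^ 2 / (40 * M) := ⟨_, rfl⟩
  have hτ0 := hτs.1
  have hτ1 := hτs.2
  rw [← hτ] at hτ0 hτ1 hσe
  have hσ : 0 < σ := by rw [hσe]; positivity
  have hε2 : ε ^ 2 / 48 ≤ 3 / 4 := by nlinarith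
  refine ⟨min (ε ^ 2 / 48) (τ / 2), min (1 / 2) (c * σ * κ / 4), by positivity,
    (min_le_right _ _).trans (by linarith), by positivity, min_le_left _ _, ?_⟩
  intro lam hlam hlam1 Q hQ hE v hv hvn u hu hu' hu0 hu1
  obtain ⟨J, hJ⟩ : ∃ J, J = ⌊1 / lam⌋₊ := ⟨_, rfl⟩
  have hJle : (J : ℝ) * lam ≤ 1 := by
    rw [hJ, ← le_div_iff₀ hlam]; exact Nat.floor_le (by positivity)
  have hJ1 : (1 : ℝ) ≤ J := by
    rw [hJ]; exact_mod_cast Nat.one_le_floor_iff _ |>.2 ((one_le_div hlam).2 hlam1)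
  have hJge : 1 / 2 ≤ (J : ℝ) * lam := by
    have : 1 / lam < J + 1 := by rw [hJ]; exact Nat.lt_floor_add_one _
    rw [div_lt_iff₀ hlam] at this
    nlinarith
  have hT : -τ + J * (2 * (lam * σ)) ≤ -(τ / 2) := by
    rw [hσe]; nlinarith
  have half : ∀ (w : SpaceTime (d + 1) → ℝ), VS 0 lam Q v w → (∀ p ∈ UU d 0, 0 ≤ w p) →
      ∀ good : ℕ → Prop, (∀ j : ℕ, -τ + (j + 1) * (2 * (lam * σ)) ≤ 0 → good j →
      ∀ x, ‖x - (1 / 4 : ℝ) • eN d‖ ≤ ε → 3 / 8 ≤ w (x, -τ + j * (2 * (lam * σ)))) →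
      (J : ℝ) / 2 ≤ (∑ i ∈ Finset.range J, if good i then (1 : ℝ) else 0) →
      ∀ x t, ‖x‖ ≤ ε ^ 2 / 48 → 0 ≤ lastC x → -(τ / 2) ≤ t → t ≤ 0 → c * σ * κ / 4 ≤ w (x, t) := by
    intro w hw hw0 good hgood hsum x t hx hx0 ht ht0
    have h1 := counting hlam hlam1 hL hM hε hε8 hB0 hσ hBσ hK hN hN0 hc0 hc hE hv hvn hw hw0 hk
      (t0 := -τ) (by rw [hτ]) good hgood J (by linarith)
    obtain ⟨s, hs⟩ : ∃ s, s = ∑ i ∈ Finset.range J, if good i then (1 : ℝ) else 0 := ⟨_, rfl⟩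
    rw [← hs] at h1 hsum
    have hs0 : 0 ≤ s := by linarith
    have hJσ : 0 ≤ J * (2 * (lam * σ)) := by positivity
    have h2 := persist hlam hM hε hε8 hE hv hw hw0 hk (g0 := s * (c * (lam * σ))) (by positivity)
      (t0 := -τ + J * (2 * (lam * σ))) (t1 := 0) (by rw [← hτ]; linarith) le_rfl h1 x t
      (by linarith) hx0 (by linarith) ht0
    have h3 := hkκ x t hx ht0
    have h4 : 1 / 4 ≤ s * lam := by nlinarith
    calc c * σ * κ / 4 = (1 / 4) * (c * σ * κ) := by ring
      _ ≤ (s * lam) * (c * σ * κ) := mul_le_mul_of_nonneg_right h4 (by positivity)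
      _ = s * (c * (lam * σ)) * κ := by ring
      _ ≤ s * (c * (lam * σ)) * k (x, t) := mul_le_mul_of_nonneg_left h3 (by positivity)
      _ ≤ _ := h2
  have hnear' := hnear lam hlam hlam1 Q hQ hE v u hu hu' (fun p hp => by
    rw [abs_le]; constructor <;> linarith [hu0 p hp, hu1 p hp])
  have htime : ∀ j : ℕ, -τ + (j + 1) * (2 * (lam * σ)) ≤ 0 →
      -(1 / 2) ≤ -τ + j * (2 * (lam * σ)) ∧ -τ + j * (2 * (lam * σ)) ≤ 0 := by
    intro j hj
    have : 0 ≤ j * (2 * (lam * σ)) := by positivity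
    have : 0 < lam * σ := by positivity
    constructor <;> nlinarith
  have hsums : (∑ i ∈ Finset.range J, if (1 / 2 ≤ u ((1 / 4 : ℝ) • eN d, -τ + i * (2 * (lam * σ))))
      then (1 : ℝ) else 0) + (∑ i ∈ Finset.range J,
      if ¬ (1 / 2 ≤ u ((1 / 4 : ℝ) • eN d, -τ + i * (2 * (lam * σ)))) then (1 : ℝ) else 0) = J := by
    rw [← Finset.sum_add_distrib]
    rw [Finset.sum_congr rfl (g := fun _ => (1 : ℝ))]
    · simp
    · intro i _
      by_cases h : 1 / 2 ≤ u ((1 / 4 : ℝ) • eN d, -τ + i * (2 * (lam * σ)))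
      · rw [if_pos h, if_neg (not_not.2 h), add_zero]
      · rw [if_neg h, if_pos h, zero_add]
  by_cases hcase : (J : ℝ) / 2 ≤ (∑ i ∈ Finset.range J,
      if (1 / 2 ≤ u ((1 / 4 : ℝ) • eN d, -τ + i * (2 * (lam * σ)))) then (1 : ℝ) else 0)
  · left
    intro x t hx hx0 ht ht0
    refine (min_le_right _ _).trans (half u hu hu0
      (fun i => 1 / 2 ≤ u ((1 / 4 : ℝ) • eN d, -τ + i * (2 * (lam * σ)))) ?_ hcase x t
      (hx.trans (min_le_left _ _)) hx0 ?_ ht0)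
    · intro j hj hg y hy
      have := abs_le.1 (hnear' _ (htime j hj).1 (htime j hj).2 y hy)
      linarith [this.1]
    · linarith [min_le_right (ε ^ 2 / 48) (τ / 2)]
  · right
    intro x t hx hx0 ht ht0
    have hB : (J : ℝ) / 2 ≤ (∑ i ∈ Finset.range J,
        if ¬ (1 / 2 ≤ u ((1 / 4 : ℝ) • eN d, -τ + i * (2 * (lam * σ)))) then (1 : ℝ) else 0) := by
      rw [not_le] at hcase
      generalize (∑ i ∈ Finset.range J,
        if ¬ (1 / 2 ≤ u ((1 / 4 : ℝ) • eN d, -τ + i * (2 * (lam * σ)))) then (1 : ℝ) else 0) = b at *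
      linarith only [hsums, hcase]
    have hw : VS 0 lam Q v (fun p => 1 * (- u p) + 1) := hu'.add_const one_pos 1
    have := half _ hw (fun p hp => by linarith [hu1 p hp])
      (fun i => ¬ 1 / 2 ≤ u ((1 / 4 : ℝ) • eN d, -τ + i * (2 * (lam * σ)))) ?_
      (by convert hB) x t (hx.trans (min_le_left _ _)) hx0 ?_ ht0
    · linarith [min_le_right (1 / 2) (c * σ * κ / 4)]
    · intro j hj hg y hy
      have := abs_le.1 (hnear' _ (htime j hj).1 (htime j hj).2 y hy)
      linarith [this.2]
    · linarith [min_le_right (ε ^ 2 / 48) (τ / 2)]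

end Boundary5

noncomputable section Iter

variable {d : ℕ}

lemma VS.scale {lam : ℝ} {Q : ℝ → Matrix (Fin (d + 1)) (Fin (d + 1)) ℝ}
    {v : ℝ → Eucl (d + 1)} {u : SpaceTime (d + 1) → ℝ} (h : VS 0 lam Q v u) {c R : ℝ} (hc : 0 < c)
    (hR : 0 < R) (c0 : ℝ) (x0 : Eucl (d + 1)) (t0 : ℝ) (hx0 : lastC x0 = 0) (hn : ‖x0‖ + R ≤ 1)
    (ht0 : t0 ≤ 0) (htR : -1 ≤ t0 - R) :
    VS 0 (lam * R) (fun t => Q (R * t + t0)) (fun t => v (R * t + t0))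
      (fun p => c * u (R • p.1 + x0, R * p.2 + t0) + c0) := by
  have := h.transfer (b' := 0) hR hR hc c0 x0 t0 (by simp [hx0]) ?_
  · have e1 : lam * R ^ 2 / R = lam * R := by field_simp
    have e2 : R / R = 1 := div_self hR.ne'
    simpa only [e1, e2, one_smul] using this
  · rintro ⟨x, t⟩ ⟨h1, h2, h3, h4⟩
    simp only at h1 h2 h3 h4
    refine ⟨?_, ?_, ?_, ?_⟩ <;> simp only
    · calc ‖R • x + x0‖ ≤ ‖R • x‖ + ‖x0‖ := norm_add_le _ _
        _ = R * ‖x‖ + ‖x0‖ := by rw [norm_smul, Real.norm_of_nonneg hR.le]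
        _ < R * 1 + ‖x0‖ := by gcongr
        _ ≤ 1 := by linarith
    · rw [lastC_add, lastC_smul, hx0]; positivity
    · nlinarith
    · nlinarith

lemma VS.neg_congr {b lam : ℝ} {Q : ℝ → Matrix (Fin (d + 1)) (Fin (d + 1)) ℝ}
    {v : ℝ → Eucl (d + 1)} {w : SpaceTime (d + 1) → ℝ} {c c0 : ℝ}
    (h : VS b lam Q v (fun p => c * -w p + -c0)) : VS b lam Q v (fun p => -(c * w p + c0)) := by
  have e : (fun p => c * -w p + -c0) = fun p => -(c * w p + c0) := by funext p; ring
  rwa [e] at h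

lemma iterate (d : ℕ) (L M : ℝ) (hL : 1 ≤ L) (hM : 1 ≤ M) : ∃ ρ c : ℝ, 0 < ρ ∧ ρ ≤ 1 / 2 ∧
    0 < c ∧ c ≤ 1 / 2 ∧ ∀ k : ℕ, ∀ lam : ℝ, 0 < lam → lam ≤ 1 →
    ∀ (Q : ℝ → Matrix (Fin (d + 1)) (Fin (d + 1)) ℝ), Continuous Q → (∀ t, Ell L (Q t)) →
    ∀ (v : ℝ → Eucl (d + 1)), (∀ t, ‖v t‖ ≤ M) → (∀ t, M⁻¹ ≤ lastC (v t)) →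
    ∀ (u : SpaceTime (d + 1) → ℝ), VS 0 lam Q v u →
    VS 0 lam Q v (fun p => - u p) → (∀ p ∈ UU d 0, 0 ≤ u p) → (∀ p ∈ UU d 0, u p ≤ 1) →
    ∃ m : ℝ, ∀ x t, ‖x‖ < ρ ^ k → 0 ≤ lastC x → -ρ ^ k < t → t ≤ 0 →
      m ≤ u (x, t) ∧ u (x, t) ≤ m + (1 - c) ^ k := by
  obtain ⟨ρ, c, hρ, hρ2, hc, hc2, hBL⟩ := boundary_lemma d L M hL hM
  refine ⟨ρ, c, hρ, hρ2, hc, hc2, ?_⟩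
  intro k
  induction k with
  | zero =>
    intro lam hlam hlam1 Q hQ hE v hv hvn u hu hu' hu0 hu1
    refine ⟨0, fun x t hx hx0 ht ht0 => ?_⟩
    rw [pow_zero] at hx ht
    have : (x, t) ∈ UU d 0 := ⟨hx, hx0, ht, ht0⟩
    exact ⟨hu0 _ this, by simpa using hu1 _ this⟩
  | succ k ih =>
    intro lam hlam hlam1 Q hQ hE v hv hvn u hu hu' hu0 hu1
    obtain ⟨a, ha⟩ : ∃ a : ℝ, ∀ x t, ‖x‖ ≤ ρ → 0 ≤ lastC x → -ρ ≤ t → t ≤ 0 →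
        a ≤ u (x, t) ∧ u (x, t) ≤ a + (1 - c) := by
      have hm : ∀ x t, ‖x‖ ≤ ρ → 0 ≤ lastC x → -ρ ≤ t → t ≤ 0 → (x, t) ∈ UU d 0 := 
        fun x t h1 h2 h3 h4 => ⟨by simp only; linarith, h2, by simp only; linarith, h4⟩
      rcases hBL lam hlam hlam1 Q hQ hE v hv hvn u hu hu' hu0 hu1 with h | h
      · exact ⟨c, fun x t h1 h2 h3 h4 => ⟨h x t h1 h2 h3 h4, by linarith [hu1 _ (hm x t h1 h2 h3 h4)]⟩⟩
      · exact ⟨0, fun x t h1 h2 h3 h4 => ⟨hu0 _ (hm x t h1 h2 h3 h4), by linarith [h x t h1 h2 h3 h4]⟩⟩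
    have h1c : 0 < 1 - c := by linarith
    have hin : ∀ p ∈ UU d 0, a ≤ u (ρ • p.1 + 0, ρ * p.2 + 0) ∧
        u (ρ • p.1 + 0, ρ * p.2 + 0) ≤ a + (1 - c) := by
      rintro ⟨x, t⟩ ⟨h1, h2, h3, h4⟩
      simp only at h1 h2 h3 h4
      apply ha
      · rw [add_zero, norm_smul, Real.norm_of_nonneg hρ.le]; nlinarith
      · rw [add_zero, lastC_smul]; positivity
      · simp only; nlinarith
      · simp only; nlinarith
    have hs1 := hu.scale (c := (1 - c)⁻¹) (R := ρ) (by positivity) hρ (-((1 - c)⁻¹ * a)) 0 0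
      (by simp [lastC]) (by rw [norm_zero]; linarith) le_rfl (by linarith)
    have hs2 := hu'.scale (c := (1 - c)⁻¹) (R := ρ) (by positivity) hρ (- -((1 - c)⁻¹ * a)) 0 0
      (by simp [lastC]) (by rw [norm_zero]; linarith) le_rfl (by linarith)
    obtain ⟨m, hm⟩ := ih (lam * ρ) (by positivity) (by nlinarith) (fun t => Q (ρ * t + 0))
      (hQ.comp (by fun_prop : Continuous fun t : ℝ => ρ * t + 0)) (fun t => hE _) _ (fun t => hv _) (fun t => hvn _) _ hs1
      (VS.neg_congr (w := fun p => u (ρ • p.1 + 0, ρ * p.2 + 0)) hs2)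
      (fun p hp => by
        have := (hin p hp).1
        have h2 : 0 < (1 - c)⁻¹ := by positivity
        nlinarith)
      (fun p hp => by
        have := (hin p hp).2
        have h2 : 0 < (1 - c)⁻¹ := by positivity
        have h3 : (1 - c)⁻¹ * (1 - c) = 1 := inv_mul_cancel₀ h1c.ne'
        nlinarith)
    refine ⟨a + (1 - c) * m, fun x t hx hx0 ht ht0 => ?_⟩
    have := hm (ρ⁻¹ • x) (ρ⁻¹ * t) ?_ ?_ ?_ ?_
    · simp only [smul_smul, mul_inv_cancel₀ hρ.ne', one_smul, add_zero, ← mul_assoc, one_mul] at this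
      have e : u (x, t) = a + (1 - c) * ((1 - c)⁻¹ * u (x, t) + -((1 - c)⁻¹ * a)) := by
        field_simp; ring
      rw [e, pow_succ]
      obtain ⟨q1, q2⟩ := this
      constructor <;> nlinarith
    · rw [norm_smul, Real.norm_of_nonneg (by positivity), inv_mul_lt_iff₀ hρ, ← pow_succ']
      exact hx
    · rw [lastC_smul]; positivity
    · rw [← div_eq_inv_mul, lt_div_iff₀ hρ]
      rw [pow_succ] at ht
      linarith
    · exact mul_nonpos_of_nonneg_of_nonpos (by positivity) ht0

lemma bdry_osc (d : ℕ) (L M : ℝ) (hL : 1 ≤ L) (hM : 1 ≤ M) : ∃ α C : ℝ, 0 < α ∧ α ≤ 1 / 2 ∧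
    1 ≤ C ∧ ∀ lam : ℝ, 0 < lam → lam ≤ 1 →
    ∀ (Q : ℝ → Matrix (Fin (d + 1)) (Fin (d + 1)) ℝ), Continuous Q → (∀ t, Ell L (Q t)) →
    ∀ (v : ℝ → Eucl (d + 1)), (∀ t, ‖v t‖ ≤ M) → (∀ t, M⁻¹ ≤ lastC (v t)) →
    ∀ (u : SpaceTime (d + 1) → ℝ), VS 0 lam Q v u →
    VS 0 lam Q v (fun p => - u p) → (∀ p ∈ UU d 0, 0 ≤ u p) → (∀ p ∈ UU d 0, u p ≤ 1) →
    ∀ r, 0 < r → r ≤ 1 → ∀ x t y s, ‖x‖ < r → 0 ≤ lastC x → -r < t → t ≤ 0 →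
      ‖y‖ < r → 0 ≤ lastC y → -r < s → s ≤ 0 → |u (x, t) - u (y, s)| ≤ C * r ^ α := by
  obtain ⟨ρ, c, hρ, hρ2, hc, hc2, hI⟩ := iterate d L M hL hM
  have hlρ : Real.log ρ < 0 := Real.log_neg hρ (by linarith)
  have hlc : Real.log (1 - c) < 0 := Real.log_neg (by linarith) (by linarith)
  have hαp : 0 < min (1 / 2) (Real.log (1 - c) / Real.log ρ) :=
    lt_min (by norm_num) (div_pos_of_neg_of_neg hlc hlρ)
  have hα2 : min (1 / 2) (Real.log (1 - c) / Real.log ρ) ≤ 1 / 2 := min_le_left _ _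
  have hα3 : 1 - c ≤ ρ ^ (min (1 / 2) (Real.log (1 - c) / Real.log ρ)) := by
    rw [← Real.log_le_log_iff (by linarith) (by positivity), Real.log_rpow hρ]
    have := min_le_right (1 / 2) (Real.log (1 - c) / Real.log ρ)
    calc Real.log (1 - c) = Real.log (1 - c) / Real.log ρ * Real.log ρ :=
          (div_mul_cancel₀ _ hlρ.ne).symm
      _ ≤ _ := mul_le_mul_of_nonpos_right this hlρ.le
  generalize min (1 / 2) (Real.log (1 - c) / Real.log ρ) = α at *
  refine ⟨α, (ρ⁻¹) ^ α, hαp, hα2, Real.one_le_rpow ((one_le_inv₀ hρ).2 (by linarith)) hαp.le, ?_⟩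
  intro lam hlam hlam1 Q hQ hE v hv hvn u hu hu' hu0 hu1 r hr hr1 x t y s hx hx0 ht ht0 hy hy0 hs hs0
  obtain ⟨k, hk1, hk2⟩ := exists_nat_pow_near_of_lt_one hr hr1 hρ (by linarith)
  obtain ⟨m, hm⟩ := hI k lam hlam hlam1 Q hQ hE v hv hvn u hu hu' hu0 hu1
  have a1 := hm x t (by linarith) hx0 (by linarith) ht0
  have a2 := hm y s (by linarith) hy0 (by linarith) hs0
  have a3 : |u (x, t) - u (y, s)| ≤ (1 - c) ^ k := by
    rw [abs_le]; constructor <;> linarith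
  refine a3.trans ?_
  calc (1 - c) ^ k ≤ (ρ ^ α) ^ k := pow_le_pow_left₀ (by linarith) hα3 k
    _ = (ρ ^ k) ^ α := by rw [← Real.rpow_natCast, ← Real.rpow_natCast, ← Real.rpow_mul hρ.le, ← Real.rpow_mul hρ.le, mul_comm]
    _ ≤ (ρ⁻¹ * r) ^ α := by
      apply Real.rpow_le_rpow (by positivity) _ hαp.le
      rw [← div_eq_inv_mul, le_div_iff₀ hρ, ← pow_succ]
      exact hk1.le
    _ = _ := Real.mul_rpow (by positivity) hr.le

end Iter

noncomputable section Fin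

variable {d : ℕ}

lemma pow_scale {k q α : ℝ} (hk : 1 ≤ k) (hq : 0 ≤ q) (hα1 : α ≤ 1) :
    (k * q) ^ α ≤ k * q ^ α := by
  rw [Real.mul_rpow (by linarith) hq]
  apply mul_le_mul_of_nonneg_right _ (Real.rpow_nonneg hq _)
  calc k ^ α ≤ k ^ (1 : ℝ) := Real.rpow_le_rpow_of_exponent_le hk hα1
    _ = k := Real.rpow_one k

lemma norm_le_prime (x y : Eucl (d + 1)) : ‖x - y‖ ≤ primeDist x y + |lastC x - lastC y| := by
  have h1 : ‖x - y‖ ^ 2 = primeDist x y ^ 2 + |lastC x - lastC y| ^ 2 := by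
    rw [EuclideanSpace.norm_sq_eq, Fin.sum_univ_castSucc, primeDist, Real.sq_sqrt
      (Finset.sum_nonneg fun i _ => sq_nonneg _)]
    simp [lastC, sq_abs]
  have h2 : 0 ≤ primeDist x y := Real.sqrt_nonneg _
  have h3 := abs_nonneg (lastC x - lastC y)
  apply le_of_sq_le_sq _ (by positivity)
  rw [h1]; nlinarith

lemma primeDist_smul {l : ℝ} (hl : 0 < l) (x y : Eucl (d + 1)) :
    primeDist (l • x) (l • y) = l * primeDist x y := by
  unfold primeDist
  rw [← Real.sqrt_sq hl.le, ← Real.sqrt_mul (sq_nonneg _), Real.sqrt_sq hl.le, Finset.mul_sum]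
  congr 1
  refine Finset.sum_congr rfl fun i _ => ?_
  simp; ring

lemma pdistL_eq {l : ℝ} (hl : 0 < l) (X Y : SpaceTime (d + 1)) :
    pdistL l X Y = primeDist X.1 Y.1 + min (|lastC X.1| + |lastC Y.1| + |X.2 - Y.2|)
      (|lastC X.1 - lastC Y.1| + Real.sqrt (|X.2 - Y.2| / l)) := by
  unfold pdistL pdist
  simp only [lastC_smul, primeDist_smul hl, ← mul_sub, abs_mul, abs_of_pos hl]
  have e : Real.sqrt (l * |X.2 - Y.2|) = l * Real.sqrt (|X.2 - Y.2| / l) := by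
    rw [← Real.sqrt_sq hl.le, ← Real.sqrt_mul (sq_nonneg _), Real.sqrt_sq hl.le]
    congr 1; field_simp
  rw [e, ← mul_add, ← mul_add, ← mul_add, ← mul_min_of_nonneg _ _ hl.le, ← mul_add, inv_mul_cancel_left₀ hl.ne']

lemma primeDist_comm (x y : Eucl (d + 1)) : primeDist x y = primeDist y x := by
  unfold primeDist
  congr 1
  exact Finset.sum_congr rfl fun i _ => by ring

lemma pdistL_comm {l : ℝ} (hl : 0 < l) (X Y : SpaceTime (d + 1)) : pdistL l X Y = pdistL l Y X := by
  rw [pdistL_eq hl, pdistL_eq hl, primeDist_comm, abs_sub_comm X.2, abs_sub_comm (lastC X.1),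
    add_comm |lastC X.1|]

lemma pdistL_lower {l : ℝ} (hl : 0 < l) (x y : Eucl (d + 1)) (t s : ℝ) (hx : 0 ≤ lastC x)
    (hy : 0 ≤ lastC y) (hst : s ≤ t) :
    (‖x - y‖ + (t - s) ≤ pdistL l (x, t) (y, s) ∧ lastC x ≤ pdistL l (x, t) (y, s)) ∨
    (‖x - y‖ + Real.sqrt ((t - s) / l) ≤ pdistL l (x, t) (y, s)) := by
  rw [pdistL_eq hl]
  simp only [abs_of_nonneg hx, abs_of_nonneg hy, abs_of_nonneg (sub_nonneg.2 hst)]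
  have h1 := norm_le_prime x y
  have h2 : 0 ≤ primeDist x y := Real.sqrt_nonneg _
  rcases min_choice (lastC x + lastC y + (t - s)) (|lastC x - lastC y| + Real.sqrt ((t - s) / l)) with h | h
  · left
    rw [h]
    have : |lastC x - lastC y| ≤ lastC x + lastC y := by
      rw [abs_le]; constructor <;> linarith
    constructor <;> linarith
  · right
    rw [h]; linarith

end Fin

noncomputable section Core

variable {d : ℕ}

/-- boundary oscillation around a point -/
lemma bdry_est (d : ℕ) (L M : ℝ) (hL : 1 ≤ L) (hM : 1 ≤ M) : ∃ α C : ℝ, 0 < α ∧ α ≤ 1 / 2 ∧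
    1 ≤ C ∧ ∀ lam : ℝ, 0 < lam → lam ≤ 1 →
    ∀ (Q : ℝ → Matrix (Fin (d + 1)) (Fin (d + 1)) ℝ), Continuous Q → (∀ t, Ell L (Q t)) →
    ∀ (v : ℝ → Eucl (d + 1)), (∀ t, ‖v t‖ ≤ M) → (∀ t, M⁻¹ ≤ lastC (v t)) →
    ∀ (u : SpaceTime (d + 1) → ℝ), VS 0 lam Q v u →
    VS 0 lam Q v (fun p => - u p) → (∀ p ∈ UU d 0, 0 ≤ u p) → (∀ p ∈ UU d 0, u p ≤ 1) →
    ∀ x0 t0, lastC x0 = 0 → ‖x0‖ ≤ 1 / 2 → -(1 / 2) ≤ t0 → t0 ≤ 0 →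
    ∀ r, 0 < r → ∀ x t y s, (x, t) ∈ UU d 0 → (y, s) ∈ UU d 0 →
      ‖x - x0‖ < r → t0 - r < t → t ≤ t0 →
      ‖y - x0‖ < r → t0 - r < s → s ≤ t0 → |u (x, t) - u (y, s)| ≤ C * (2 * r) ^ α := by
  obtain ⟨α, C, hα, hα2, hC, hosc⟩ := bdry_osc d L M hL hM
  refine ⟨α, C, hα, hα2, hC, ?_⟩
  intro lam hlam hlam1 Q hQ hE v hv hvn u hu hu' hu0 hu1 x0 t0 hx0 hxn ht0 ht0' r hr x t y s hX hY
    hx ht ht' hy hs hs'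
  by_cases hr1 : 2 * r ≤ 1
  · have hs1 := hu.scale (c := 1) (R := 1 / 2) one_pos (by norm_num) 0 x0 t0 hx0 (by linarith) ht0' (by linarith)
    have hs2 := hu'.scale (c := 1) (R := 1 / 2) one_pos (by norm_num) (-0) x0 t0 hx0 (by linarith) ht0' (by linarith)
    have hin : ∀ p ∈ UU d 0, ((1 / 2 : ℝ) • p.1 + x0, (1 / 2 : ℝ) * p.2 + t0) ∈ UU d 0 := by
      rintro ⟨z, w⟩ ⟨h1, h2, h3, h4⟩
      simp only at h1 h2 h3 h4
      refine ⟨?_, ?_, ?_, ?_⟩ <;> simp only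
      · refine (norm_add_le _ _).trans_lt ?_
        rw [norm_smul, Real.norm_of_nonneg (by norm_num)]
        linarith
      · rw [lastC_add, lastC_smul, hx0]; linarith
      · linarith
      · linarith
    have key := hosc (lam * (1 / 2)) (by positivity) (by linarith) (fun t => Q (1 / 2 * t + t0))
      (hQ.comp (by fun_prop : Continuous fun t : ℝ => 1 / 2 * t + t0)) (fun t => hE _) _ (fun t => hv _)
      (fun t => hvn _) _ hs1
      (VS.neg_congr (w := fun p => u ((1 / 2 : ℝ) • p.1 + x0, (1 / 2 : ℝ) * p.2 + t0)) hs2)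
      (fun p hp => by rw [one_mul, add_zero]; exact hu0 _ (hin p hp))
      (fun p hp => by rw [one_mul, add_zero]; exact hu1 _ (hin p hp))
      (2 * r) (by positivity) hr1 ((2 : ℝ) • (x - x0)) (2 * (t - t0)) ((2 : ℝ) • (y - x0)) (2 * (s - t0))
      (by rw [norm_smul, Real.norm_of_nonneg (by norm_num)]; linarith)
      (by rw [lastC_smul, lastC_sub, hx0]; have := hX.2.1; simp only at this; linarith)
      (by linarith) (by linarith)
      (by rw [norm_smul, Real.norm_of_nonneg (by norm_num)]; linarith)
      (by rw [lastC_smul, lastC_sub, hx0]; have := hY.2.1; simp only at this; linarith)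
      (by linarith) (by linarith)
    have e1 : ∀ z : Eucl (d + 1), (1 / 2 : ℝ) • (2 : ℝ) • (z - x0) + x0 = z := by
      intro z; module
    have e2 : ∀ z : ℝ, (1 / 2 : ℝ) * (2 * (z - t0)) + t0 = z := by
      intro z; ring
    simpa only [e1, e2, one_mul, add_zero] using key
  · push Not at hr1
    have h1 : (1 : ℝ) ≤ (2 * r) ^ α := Real.one_le_rpow hr1.le hα.le
    have h2 : |u (x, t) - u (y, s)| ≤ 1 := by
      rw [abs_le]; constructor <;> linarith [hu0 _ hX, hu0 _ hY, hu1 _ hX, hu1 _ hY]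
    nlinarith

set_option maxHeartbeats 4000000 in
lemma core (d : ℕ) (L M : ℝ) (hL : 1 ≤ L) (hM : 1 ≤ M) : ∃ α C : ℝ, 0 < α ∧ α ≤ 1 / 2 ∧
    1 ≤ C ∧ ∀ lam : ℝ, 0 < lam → lam ≤ 1 →
    ∀ (Q : ℝ → Matrix (Fin (d + 1)) (Fin (d + 1)) ℝ), Continuous Q → (∀ t, Ell L (Q t)) →
    ∀ (v : ℝ → Eucl (d + 1)), (∀ t, ‖v t‖ ≤ M) → (∀ t, M⁻¹ ≤ lastC (v t)) →
    ∀ (u : SpaceTime (d + 1) → ℝ), VS 0 lam Q v u →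
    VS 0 lam Q v (fun p => - u p) → (∀ p ∈ UU d 0, 0 ≤ u p) → (∀ p ∈ UU d 0, u p ≤ 1) →
    ∀ x t y s, ‖x‖ < 1 / 2 → 0 ≤ lastC x → -(1 / 2) < t → t ≤ 0 →
      ‖y‖ < 1 / 2 → 0 ≤ lastC y → -(1 / 2) < s → s ≤ t →
      |u (x, t) - u (y, s)| ≤ C * pdistL lam (x, t) (y, s) ^ α := by
  obtain ⟨α, C1, hα, hα2, hC1, hbd⟩ := bdry_est d L M hL hM
  obtain ⟨C2, hC2, hint⟩ := interior_est d L hL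
  refine ⟨α, 36 * C1 + 4 * C1 * C2, hα, hα2, by nlinarith, ?_⟩
  intro lam hlam hlam1 Q hQ hE v hv hvn u hu hu' hu0 hu1 x t y s hx hx0 ht ht0 hy hy0 hs hst
  have hX : (x, t) ∈ UU d 0 := ⟨by simp only; linarith, hx0, by simp only; linarith, ht0⟩
  have hY : (y, s) ∈ UU d 0 := ⟨by simp only; linarith, hy0, by simp only; linarith, hst.trans ht0⟩
  have hu2 : |u (x, t) - u (y, s)| ≤ 1 := by
    rw [abs_le]; constructor <;> linarith [hu0 _ hX, hu0 _ hY, hu1 _ hX, hu1 _ hY]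
  obtain ⟨h, hh⟩ : ∃ h, h = lastC x := ⟨_, rfl⟩
  obtain ⟨x0, hx0d⟩ : ∃ x0, x0 = x - h • eN d := ⟨_, rfl⟩
  have hx0l : lastC x0 = 0 := by rw [hx0d, lastC_sub, lastC_smul, lastC_eN, hh]; ring
  have hxx0 : ‖x - x0‖ = h := by
    rw [hx0d, sub_sub_cancel, norm_smul, norm_eN, mul_one, Real.norm_of_nonneg (hh ▸ hx0)]
  have hx0n : ‖x0‖ ≤ 1 / 2 := by
    have e : x = x0 + h • eN d := by rw [hx0d]; abel
    have : ‖x‖ ^ 2 = ‖x0‖ ^ 2 + h ^ 2 := by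
      rw [e, norm_add_sq_real, inner_smul_right, inner_eN, norm_smul, norm_eN, hx0l, mul_one,
        Real.norm_eq_abs, sq_abs]
      ring
    have h2 : ‖x0‖ ^ 2 ≤ ‖x‖ ^ 2 := by linarith only [this, sq_nonneg h]
    have := le_of_sq_le_sq h2 (norm_nonneg _)
    linarith
  rw [← hh] at hx0
  have hh2 : h < 1 / 2 := by
    have := abs_lastC_le x
    rw [← hh, abs_of_nonneg hx0] at this
    linarith
  have BE := hbd lam hlam hlam1 Q hQ hE v hv hvn u hu hu' hu0 hu1 x0 t hx0l hx0n ht.le ht0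
  have hyx0 : ‖y - x0‖ ≤ ‖x - y‖ + h := by
    have : y - x0 = (x - x0) - (x - y) := by abel
    rw [this]
    refine (norm_sub_le _ _).trans ?_
    rw [hxx0]; linarith
  have hxy0 := norm_nonneg (x - y)
  -- key reduction
  have red : ∀ q, 0 < q → h ≤ 16 * q → ‖x - y‖ ≤ q → t - s ≤ q →
      |u (x, t) - u (y, s)| ≤ 36 * C1 * q ^ α := by
    intro q hq h1 h2 h3
    have := BE (18 * q) (by positivity) x t y s hX hY (by linarith) (by linarith) le_rfl
      (by linarith) (by linarith) hst
    refine this.trans ?_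
    have e : 2 * (18 * q) = 36 * q := by ring
    rw [e]
    have := pow_scale (k := 36) (by norm_num) hq.le (by linarith : α ≤ 1)
    have := mul_le_mul_of_nonneg_left this (by linarith : 0 ≤ C1)
    linarith only [this]
  obtain ⟨D, hD⟩ : ∃ D, D = pdistL lam (x, t) (y, s) := ⟨_, rfl⟩
  have hlow := pdistL_lower hlam x y t s (hh ▸ hx0) hy0 hst
  rw [← hD, ← hh] at hlow
  rw [← hD]
  have hCC : 0 ≤ C1 * C2 := by positivity
  have triv : x = y → s = t → |u (x, t) - u (y, s)| ≤ (36 * C1 + 4 * C1 * C2) * D ^ α := by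
    intro h1 h2
    subst h1; subst h2
    rw [sub_self, abs_zero]
    have hD0 : 0 ≤ D := by
      rcases hlow with h | h
      · linarith
      · exact le_trans (add_nonneg hxy0 (Real.sqrt_nonneg _)) h
    have := Real.rpow_nonneg hD0 α
    exact mul_nonneg (by linarith only [hCC, hC1]) this
  rcases hlow with ⟨ha, hb⟩ | ha
  · by_cases hD0 : 0 < D
    · have := red D hD0 (by linarith) (by linarith) (by linarith)
      have h2 := Real.rpow_nonneg hD0.le α
      exact this.trans (mul_le_mul_of_nonneg_right (by linarith only [hCC]) h2)
    · exact triv (by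
        have : ‖x - y‖ = 0 := by linarith
        exact sub_eq_zero.1 (norm_eq_zero.1 this)) (by linarith)
  · obtain ⟨p, hp⟩ : ∃ p, p = Real.sqrt ((t - s) / lam) := ⟨_, rfl⟩
    rw [← hp] at ha
    have hp0 : 0 ≤ p := by rw [hp]; exact Real.sqrt_nonneg _
    have hp2 : p ^ 2 = (t - s) / lam := by
      rw [hp, Real.sq_sqrt (div_nonneg (by linarith) hlam.le)]
    have hts : t - s = lam * p ^ 2 := by rw [hp2]; field_simp
    have hts2 : t - s ≤ p ^ 2 := by
      rw [hts]; exact mul_le_of_le_one_left (sq_nonneg p) hlam1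
    by_cases hp1 : 1 ≤ p
    · have h1 : 1 ≤ D ^ α := Real.one_le_rpow (by linarith) hα.le
      exact hu2.trans (one_le_mul_of_one_le_of_one_le (by linarith only [hCC, hC1]) h1)
    push Not at hp1
    have hts3 : t - s ≤ p := by
      have : p * p ≤ p * 1 := mul_le_mul_of_nonneg_left hp1.le hp0
      linarith only [this, hts2]
    obtain ⟨q, hq⟩ : ∃ q, q = ‖x - y‖ + p := ⟨_, rfl⟩
    by_cases hq0 : q = 0
    · exact triv (by
        have : ‖x - y‖ = 0 := by linarith
        exact sub_eq_zero.1 (norm_eq_zero.1 this)) (by linarith)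
    have hqp : 0 < q := lt_of_le_of_ne (by linarith) (Ne.symm hq0)
    have hqD : q ^ α ≤ D ^ α := Real.rpow_le_rpow hqp.le (by linarith) hα.le
    have hqn := Real.rpow_nonneg hqp.le α
    by_cases hhq : h ≤ 16 * q
    · have := red q hqp hhq (by linarith) (by linarith)
      exact this.trans (mul_le_mul (by linarith only [hCC]) hqD hqn (by linarith only [hCC, hC1]))
    push Not at hhq
    -- interior case
    have hhp : 0 < h := by linarith
    obtain ⟨W, hW⟩ : ∃ W, W = C1 * (2 * (2 * h)) ^ α := ⟨_, rfl⟩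
    have hWp : 0 < W := by rw [hW]; positivity
    have g1 : 0 < lam * h ^ 2 := by positivity
    have g2 : lam * h ^ 2 ≤ h := by
      have a1 : lam * h ^ 2 ≤ 1 * h ^ 2 := mul_le_mul_of_nonneg_right hlam1 (sq_nonneg h)
      have a2 : h * h ≤ h * 1 := mul_le_mul_of_nonneg_left (by linarith only [hh2]) hhp.le
      linarith only [a1, a2]
    have hin : ∀ p ∈ UU d (-1), (h • p.1 + x, lam * h ^ 2 * p.2 + t) ∈ UU d 0 := by
      rintro ⟨z, w⟩ ⟨h1, h2, h3, h4⟩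
      simp only at h1 h2 h3 h4
      have i1 := mul_lt_mul_of_pos_left h1 hhp
      have i2 := mul_le_mul_of_nonneg_left h2 hhp.le
      have i3 := mul_lt_mul_of_pos_left h3 g1
      have i4 := mul_nonpos_of_nonneg_of_nonpos g1.le h4
      refine ⟨?_, ?_, ?_, ?_⟩ <;> simp only
      · refine (norm_add_le _ _).trans_lt ?_
        rw [norm_smul, Real.norm_of_nonneg hhp.le]
        linarith only [i1, i2, i3, i4, g2, hh2, hx, ht, ht0, hhp]
      · rw [lastC_add, lastC_smul, ← hh]; linarith only [i1, i2, i3, i4, g2, hh2, hx, ht, ht0, hhp]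
      · linarith only [i1, i2, i3, i4, g2, hh2, hx, ht, ht0, hhp]
      · linarith only [i1, i2, i3, i4, g2, hh2, hx, ht, ht0, hhp]
    have hest : ∀ p ∈ UU d (-1), |u (h • p.1 + x, lam * h ^ 2 * p.2 + t) - u (x, t)| ≤ W := by
      intro p hp
      have hm := hin p hp
      obtain ⟨z, w⟩ := p
      obtain ⟨h1, h2, h3, h4⟩ := hp
      simp only at h1 h2 h3 h4
      have i1 := mul_lt_mul_of_pos_left h1 hhp
      have i2 := mul_le_mul_of_nonneg_left h2 hhp.le
      have i3 := mul_lt_mul_of_pos_left h3 g1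
      have i4 := mul_nonpos_of_nonneg_of_nonpos g1.le h4
      rw [hW]
      refine BE (2 * h) (by positivity) _ _ x t hm hX ?_ ?_ ?_ (by linarith) (by linarith) le_rfl
      · have : h • z + x - x0 = h • z + (x - x0) := by abel
        simp only
        rw [this]
        refine (norm_add_le _ _).trans_lt ?_
        rw [norm_smul, Real.norm_of_nonneg hhp.le, hxx0]
        linarith only [i1, i2, i3, i4, g2, hh2, hx, ht, ht0, hhp]
      · simp only; linarith only [i1, i2, i3, i4, g2, hh2, hx, ht, ht0, hhp]
      · simp only; linarith only [i1, i2, i3, i4, g2, hh2, hx, ht, ht0, hhp]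
    have hr : lam * h ^ 2 / (lam * h ^ 2) = 1 := div_self (by positivity)
    have t1 := hu.transfer (b' := -1) (R := h) (μ := lam * h ^ 2) (c := W⁻¹) hhp (by positivity) (by positivity)
      (-(W⁻¹ * u (x, t))) x t (by rw [← hh]; ring) hin
    have t2 := hu'.transfer (b' := -1) (R := h) (μ := lam * h ^ 2) (c := W⁻¹) hhp (by positivity) (by positivity)
      (- -(W⁻¹ * u (x, t))) x t (by rw [← hh]; ring) hin
    rw [hr] at t1 t2
    have hqh : q / h ≤ 1 / 16 := by rw [div_le_iff₀ hhp]; linarith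
    have hqh0 : 0 < q / h := by positivity
    obtain ⟨σ, hσ⟩ : ∃ σ, σ = (q / h) ^ (1 / 4 : ℝ) := ⟨_, rfl⟩
    have hσ0 : 0 < σ := by rw [hσ]; positivity
    have hσ4 : σ ^ 4 = q / h := by
      rw [hσ, ← Real.rpow_natCast, ← Real.rpow_mul hqh0.le]; norm_num
    have hσ2 : σ ^ 2 ≤ (q / h) ^ α := by
      rw [hσ, ← Real.rpow_natCast, ← Real.rpow_mul hqh0.le]
      apply Real.rpow_le_rpow_of_exponent_ge hqh0 (by linarith)
      norm_num
      linarith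
    have hσh : σ ≤ 1 / 2 := by
      by_contra hcon
      push Not at hcon
      have : (1 / 2 : ℝ) ^ 4 < σ ^ 4 := by gcongr
      rw [hσ4] at this
      norm_num at this
      linarith
    have key := hint (-1) le_rfl (fun τ => Q (lam * h ^ 2 * τ + t))
      (hQ.comp (by fun_prop : Continuous fun τ : ℝ => lam * h ^ 2 * τ + t)) (fun t => hE _) _ _ t1
      (VS.neg_congr (w := fun p => u (h • p.1 + x, lam * h ^ 2 * p.2 + t)) t2)
      (fun p hp => by
        have := hest p hp
        have e : W⁻¹ * u (h • p.1 + x, lam * h ^ 2 * p.2 + t) + -(W⁻¹ * u (x, t)) =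
          W⁻¹ * (u (h • p.1 + x, lam * h ^ 2 * p.2 + t) - u (x, t)) := by ring
        rw [e, abs_mul, abs_of_pos (by positivity : 0 < W⁻¹), inv_mul_le_iff₀ hWp]
        linarith)
      σ hσ0 hσh (h⁻¹ • (y - x)) ((lam * h ^ 2)⁻¹ * (s - t))
      (by
        rw [norm_smul, Real.norm_of_nonneg (by positivity), norm_sub_rev, hσ4, div_eq_inv_mul]
        apply mul_le_mul_of_nonneg_left _ (by positivity)
        linarith)
      (by
        have e1 : (lam * h ^ 2)⁻¹ * (s - t) = - (p / h) ^ 2 := by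
          have : s - t = - (lam * p ^ 2) := by linarith
          rw [this]; field_simp
        have e2 : σ ^ 8 = (q / h) ^ 2 := by rw [← hσ4]; ring
        rw [e1, e2]
        apply neg_le_neg
        gcongr
        linarith)
      (mul_nonpos_of_nonneg_of_nonpos (by positivity) (by linarith))
    have e1 : h • h⁻¹ • (y - x) + x = y := by
      rw [smul_smul, mul_inv_cancel₀ hhp.ne', one_smul]; abel
    have e2 : lam * h ^ 2 * ((lam * h ^ 2)⁻¹ * (s - t)) + t = s := by
      rw [mul_inv_cancel_left₀ (by positivity)]; ring
    simp only [e1, e2, smul_zero, mul_zero, zero_add] at key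
    have e3 : W⁻¹ * u (y, s) + -(W⁻¹ * u (x, t)) - (W⁻¹ * u (x, t) + -(W⁻¹ * u (x, t))) =
      W⁻¹ * (u (y, s) - u (x, t)) := by ring
    rw [e3, abs_mul, abs_of_pos (by positivity : 0 < W⁻¹), inv_mul_le_iff₀ hWp, abs_sub_comm] at key
    have e4 : W * (q / h) ^ α = C1 * (4 * q) ^ α := by
      rw [hW, mul_assoc, ← Real.mul_rpow (by positivity) (by positivity)]
      congr 2
      field_simp; ring
    have f1 := pow_scale (k := 4) (by norm_num) hqp.le (by linarith : α ≤ 1)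
    calc |u (x, t) - u (y, s)| ≤ W * (C2 * σ ^ 2) := key
      _ ≤ W * (C2 * (q / h) ^ α) := mul_le_mul_of_nonneg_left (mul_le_mul_of_nonneg_left hσ2 hC2.le) hWp.le
      _ = C2 * (W * (q / h) ^ α) := by ring
      _ = C1 * C2 * (4 * q) ^ α := by rw [e4]; ring
      _ ≤ C1 * C2 * (4 * q ^ α) := mul_le_mul_of_nonneg_left f1 hCC
      _ = (4 * C1 * C2) * q ^ α := by ring
      _ ≤ (4 * C1 * C2) * D ^ α := mul_le_mul_of_nonneg_left hqD (by positivity)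
      _ ≤ _ := by
        apply mul_le_mul_of_nonneg_right _ (hqn.trans hqD)
        linarith

end Core

/-- **Interior Hölder estimate.** There are a universal `α ∈ (0,1)` and `C > 0`, depending
only on `n, Λ, M, C₀`, such that every bounded nonnegative viscosity solution `η` of the
linearized oblique problem on `K₁⁺` satisfies
`‖η‖_{C^{0,α}_{x,t}(K⁺_{1/2})} ≤ C · sup_{K₁⁺} |η|`. -/
theorem interior_holder_estimate (d : ℕ) (hd : 1 ≤ d) (Λ M C₀ : ℝ)
    (hΛ : 1 ≤ Λ) (hM : 1 ≤ M) (hC₀ : 0 < C₀) :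
    ∃ α C : ℝ, 0 < α ∧ α < 1 ∧ 0 < C ∧
      ∀ (lam : ℝ) (Q Q' : ℝ → Matrix (Fin (d + 1)) (Fin (d + 1)) ℝ)
        (v v' : ℝ → Eucl (d + 1)) (η : SpaceTime (d + 1) → ℝ),
        ObliqueData d lam Λ M C₀ Q Q' v v' →
        ObliqueSolution d lam Q v η →
        (∀ p ∈ KcP d 1, 0 ≤ η p) →
        ∀ S : ℝ, (∀ p ∈ KcP d 1, |η p| ≤ S) →
          (∀ X ∈ KcP d (1 / 2), |η X| ≤ C * S) ∧
          (∀ X ∈ KcP d (1 / 2), ∀ Y ∈ KcP d (1 / 2),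
            |η X - η Y| ≤ C * S * pdistL lam X Y ^ α) := by
  have hL : 1 ≤ Λ * M ^ 2 := one_le_mul_of_one_le_of_one_le hΛ (one_le_pow₀ hM)
  obtain ⟨α, C, hα, hα2, hC, hcore⟩ := core d (Λ * M ^ 2) M hL hM
  refine ⟨α, C, hα, by linarith, by linarith, ?_⟩
  intro lam Q Q' v v' η hdata hsol hpos S hS
  have hsub : ∀ X ∈ KcP d (1 / 2), ‖X.1‖ < 1 / 2 ∧ 0 ≤ lastC X.1 ∧ -(1 / 2) < X.2 ∧ X.2 ≤ 0 := by
    rintro X (⟨h1, h2, h3, h4⟩ | ⟨h1, h2, h3, h4⟩)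
    · exact ⟨by simpa using h1, h2.le, h3, h4⟩
    · exact ⟨by simpa using h1, h2.ge, h3, h4⟩
  have hsub2 : ∀ X ∈ KcP d (1 / 2), X ∈ KcP d 1 := by
    intro X hX
    obtain ⟨h1, h2, h3, h4⟩ := hsub X hX
    rw [KcP_eq]
    exact ⟨by linarith, h2, by linarith, h4⟩
  have hS0 : 0 ≤ S := by
    have : (0, 0) ∈ KcP d 1 := by
      rw [KcP_eq]; exact ⟨by simp, by simp [lastC], by simp, by simp⟩
    exact (abs_nonneg _).trans (hS _ this)
  refine ⟨fun X hX => ?_, ?_⟩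
  · have := hS X (hsub2 X hX)
    nlinarith
  rcases hS0.eq_or_lt with hSz | hSp
  · intro X hX Y hY
    have h1 := hS X (hsub2 X hX)
    have h2 := hS Y (hsub2 Y hY)
    rw [← hSz] at h1 h2 ⊢
    rw [abs_nonpos_iff.1 h1, abs_nonpos_iff.1 h2]
    simp
  have hlam := hdata.lam_pos
  obtain ⟨pr, hpr⟩ : ∃ pr : ℝ → ℝ, pr = fun t => max (-1) (min t 0) := ⟨_, rfl⟩
  have hprc : Continuous pr := by rw [hpr]; fun_prop
  have hprm : ∀ t, pr t ∈ Icc (-1 : ℝ) 0 := by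
    intro t; rw [hpr]
    exact ⟨le_max_left _ _, max_le (by norm_num) (min_le_right _ _)⟩
  have hpre : ∀ t, -1 < t → t ≤ 0 → pr t = t := by
    intro t h1 h2; rw [hpr]; simp only
    rw [min_eq_left h2, max_eq_right h1.le]
  have hQc : Continuous fun t => Q (pr t) := by
    refine continuous_matrix fun i j => ?_
    have : ContinuousOn (fun t => Q t i j) (Icc (-1 : ℝ) 0) :=
      fun t ht => (hdata.Qderiv t ht i j).continuousWithinAt
    exact this.comp_continuous hprc hprm
  have hE : ∀ t, Ell (Λ * M ^ 2) (Q (pr t)) := fun t => ⟨hdata.Qlower _ (hprm t), hdata.Qupper _ (hprm t)⟩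
  have hu1 : VS 0 lam (fun t => Q (pr t)) (fun t => v (pr t)) (fun p => S⁻¹ * η p + 0) :=
    ((VS_of_sup hsol.2).congr (fun t h1 h2 => by rw [hpre t h1 h2])
      (fun t h1 h2 => by rw [hpre t h1 h2])).add_const (inv_pos.2 hSp) 0
  have hu2 : VS 0 lam (fun t => Q (pr t)) (fun t => v (pr t)) (fun p => -(S⁻¹ * η p + 0)) :=
    VS.neg_congr (((VS_of_sub hsol.1).congr (fun t h1 h2 => by rw [hpre t h1 h2])
      (fun t h1 h2 => by rw [hpre t h1 h2])).add_const (inv_pos.2 hSp) (-0))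
  have key := hcore lam hlam hdata.lam_le_one _ hQc hE (fun t => v (pr t)) (fun t => hdata.vbound _ (hprm t))
    (fun t => hdata.vlast _ (hprm t)) _ hu1 hu2
    (fun p hp => by
      rw [← KcP_eq] at hp
      have := hpos p hp
      rw [add_zero]
      positivity)
    (fun p hp => by
      rw [← KcP_eq] at hp
      have := (abs_le.1 (hS p hp)).2
      rw [add_zero, inv_mul_le_iff₀ hSp]
      linarith)
  have key2 : ∀ X ∈ KcP d (1 / 2), ∀ Y ∈ KcP d (1 / 2), Y.2 ≤ X.2 →
      |η X - η Y| ≤ C * S * pdistL lam X Y ^ α := by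
    rintro ⟨x, t⟩ hX ⟨y, s⟩ hY hst
    obtain ⟨h1, h2, h3, h4⟩ := hsub _ hX
    obtain ⟨g1, g2, g3, g4⟩ := hsub _ hY
    have := key x t y s h1 h2 h3 h4 g1 g2 g3 hst
    have e : S⁻¹ * η (x, t) + 0 - (S⁻¹ * η (y, s) + 0) = S⁻¹ * (η (x, t) - η (y, s)) := by ring
    rw [e, abs_mul, abs_of_pos (inv_pos.2 hSp), inv_mul_le_iff₀ hSp] at this
    refine this.trans (le_of_eq (by ring))
  intro X hX Y hY
  rcases le_total Y.2 X.2 with h | h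
  · exact key2 X hX Y hY h
  · rw [abs_sub_comm, pdistL_comm hlam]
    exact key2 Y hY X hX h
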